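/- arXiv:1306.5419 — 2 statements merged into one kernel-verified Lean document; each statement's English description precedes it below -/
import Mathlib

section
/- Let T be an increasing tableau of straight shape of type A. Then T is a unique rectification target for ℕ×ℕ if and only if every increasing tableau T′ of straight shape whose row word is K-Knuth equivalent to the row word of T satisfies T′ = T. -/
open Classical

noncomputable section

/-- A straight shape in a poset: a finite lower order ideal, given as a `Finset`. -/
def StraightShape {L : Type} [PartialOrder L] (lam : Finset L) : Prop :=
  ∀ a ∈ lam, ∀ b : L, b ≤ a → b ∈ lam

/-- The shape (set of boxes) of a partially defined tableau. -/
def shapeOf {L : Type} {V : Type} (T : L → Option V) : Set L := {α | T α ≠ none}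

/-- `lam ⊆ nu` is a pair of straight shapes, defining the skew shape `nu / lam`. -/
def IsSkewPair {L : Type} [PartialOrder L] (lam nu : Finset L) : Prop :=
  StraightShape lam ∧ StraightShape nu ∧ lam ⊆ nu

/-- `T` is defined on a skew shape `nu / lam`. -/
def HasSkewShape {L : Type} [PartialOrder L] (T : L → Option ℤ) : Prop :=
  ∃ lam nu : Finset L, IsSkewPair lam nu ∧ shapeOf T = (nu : Set L) \ (lam : Set L)

/-- `T` is strictly increasing along the partial order. -/
def Increasing {L : Type} [PartialOrder L] (T : L → Option ℤ) : Prop :=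
  ∀ a b : L, a < b → ∀ x y : ℤ, T a = some x → T b = some y → x < y

/-- An increasing tableau of skew shape. -/
def IncreasingSkewTableau {L : Type} [PartialOrder L] (T : L → Option ℤ) : Prop :=
  HasSkewShape T ∧ Increasing T

/-- Two boxes are neighbors if one covers the other. -/
def Neighbor {L : Type} [PartialOrder L] (a b : L) : Prop := a ⋖ b ∨ b ⋖ a

/-- The swap operation `swap_{s,s'}`. -/
def swapVal {L : Type} [PartialOrder L] {V : Type} (s s' : V) (T : L → Option V) :
    L → Option V := fun α =>
  if T α = some s ∧ ∃ β, Neighbor α β ∧ T β = some s' then some s'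
  else if T α = some s' ∧ ∃ β, Neighbor α β ∧ T β = some s then some s
  else T α

/-- Integer values extended with a dot `•`. -/
abbrev ZDot : Type := ℤ ⊕ Unit

def toDotted {L : Type} (T : L → Option ℤ) : L → Option ZDot := fun α => (T α).map Sum.inl

/-- Place a dot in every box of `C`. -/
def addDots {L : Type} (C : Finset L) (T : L → Option ZDot) : L → Option ZDot := fun α =>
  if α ∈ C then some (Sum.inr ()) else T α

/-- Restrict a dotted tableau to its integer-valued boxes. -/
def restrictInt {L : Type} (T : L → Option ZDot) : L → Option ℤ := fun α =>
  (T α).bind (Sum.elim some fun _ => none)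

/-- Apply `swap_{a,•}, swap_{a+1,•}, …, swap_{a+n-1,•}` in this (increasing) order. -/
def swapUp {L : Type} [PartialOrder L] (a : ℤ) : ℕ → (L → Option ZDot) → (L → Option ZDot)
  | 0, T => T
  | n + 1, T => swapVal (Sum.inl (a + n)) (Sum.inr ()) (swapUp a n T)

/-- Apply `swap_{b,•}, swap_{b-1,•}, …, swap_{b-n+1,•}` in this (decreasing) order. -/
def swapDown {L : Type} [PartialOrder L] (b : ℤ) : ℕ → (L → Option ZDot) → (L → Option ZDot)
  | 0, T => T
  | n + 1, T => swapVal (Sum.inl (b - n)) (Sum.inr ()) (swapDown b n T)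

/-- All values of `T` lie in the interval `[a, b]`. -/
def ValuesIn {L : Type} (T : L → Option ℤ) (a b : ℤ) : Prop :=
  ∀ (α : L) (x : ℤ), T α = some x → a ≤ x ∧ x ≤ b

/-- `T'` is obtained from `T` by a single forward jeu de taquin slide `jdt_C`,
starting from a set `C` of maximal boxes of the inner shape. -/
def IsForwardSlide {L : Type} [PartialOrder L] (T T' : L → Option ℤ) : Prop :=
  ∃ (lam nu C : Finset L) (a b : ℤ),
    IsSkewPair lam nu ∧ shapeOf T = (nu : Set L) \ (lam : Set L) ∧ ValuesIn T a b ∧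
    (∀ c ∈ C, c ∈ lam ∧ ∀ d ∈ lam, ¬ c < d) ∧
    T' = restrictInt (swapUp a (b - a + 1).toNat (addDots C (toDotted T)))

/-- `T'` is obtained from `T` by a single reverse jeu de taquin slide,
starting from a set `C` of minimal boxes of the complement of the outer shape. -/
def IsReverseSlide {L : Type} [PartialOrder L] (T T' : L → Option ℤ) : Prop :=
  ∃ (lam nu C : Finset L) (a b : ℤ),
    IsSkewPair lam nu ∧ shapeOf T = (nu : Set L) \ (lam : Set L) ∧ ValuesIn T a b ∧
    (∀ c ∈ C, c ∉ nu ∧ ∀ d : L, d ∉ nu → ¬ d < c) ∧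
    T' = restrictInt (swapDown b (b - a + 1).toNat (addDots C (toDotted T)))

/-- Jeu de taquin equivalence: a finite sequence of forward and reverse slides. -/
def JdtEquiv {L : Type} [PartialOrder L] (T T' : L → Option ℤ) : Prop :=
  Relation.ReflTransGen (fun A B => IsForwardSlide A B ∨ IsReverseSlide A B) T T'

/-- `T` is defined on a straight shape. -/
def HasStraightShape {L : Type} [PartialOrder L] (T : L → Option ℤ) : Prop :=
  ∃ lam : Finset L, StraightShape lam ∧ shapeOf T = (lam : Set L)

/-- `U` is a rectification of `T`: a straight-shape tableau obtained by forward slides. -/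
def RectifiesTo {L : Type} [PartialOrder L] (T U : L → Option ℤ) : Prop :=
  Relation.ReflTransGen IsForwardSlide T U ∧ HasStraightShape U

/-- Unique rectification target. -/
def IsURT {L : Type} [PartialOrder L] (U : L → Option ℤ) : Prop :=
  HasStraightShape U ∧ Increasing U ∧
    ∀ T : L → Option ℤ, IncreasingSkewTableau T → RectifiesTo T U →
      ∀ U' : L → Option ℤ, RectifiesTo T U' → U' = U

/-- The minimal increasing tableau of a shape `θ`: each box `α` receives the maximal
cardinality of a totally ordered subset of `θ` having `α` as its maximal element. -/
def minTab {L : Type} [PartialOrder L] (θ : Finset L) : L → Option ℤ := fun α =>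
  if α ∈ θ then
    some ((sSup {n : ℕ | ∃ s : Finset L, (s : Set L) ⊆ (θ : Set L) ∧
      (∀ a ∈ s, ∀ b ∈ s, a ≤ b ∨ b ≤ a) ∧ α ∈ s ∧ (∀ a ∈ s, a ≤ α) ∧ s.card = n} : ℕ) : ℤ)
  else none

/-- A unique rectification poset. -/
def IsURP (L : Type) [PartialOrder L] : Prop :=
  ∀ lam : Finset L, StraightShape lam → IsURT (minTab lam)

/-- The structure constant `c^ν_{λ,μ}`: the number of increasing tableaux of
shape `ν/λ` that have the minimal increasing tableau `M_μ` as a rectification. -/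
def ccoef {L : Type} [PartialOrder L] (lam mu nu : Finset L) : ℕ :=
  Set.ncard {T : L → Option ℤ | Increasing T ∧ shapeOf T = (nu : Set L) \ (lam : Set L) ∧
    RectifiesTo T (minTab mu)}

/-- The basic K-Knuth relations. -/
inductive KKnuthStep : List ℤ → List ℤ → Prop
  | dup (u v : List ℤ) (a : ℤ) : KKnuthStep (u ++ [a, a] ++ v) (u ++ [a] ++ v)
  | aba (u v : List ℤ) (a b : ℤ) : KKnuthStep (u ++ [a, b, a] ++ v) (u ++ [b, a, b] ++ v)
  | acb (u v : List ℤ) (a b c : ℤ) (h1 : b < a) (h2 : a < c) :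
      KKnuthStep (u ++ [a, b, c] ++ v) (u ++ [a, c, b] ++ v)
  | bac (u v : List ℤ) (a b c : ℤ) (h1 : a < c) (h2 : c < b) :
      KKnuthStep (u ++ [a, b, c] ++ v) (u ++ [b, a, c] ++ v)

/-- K-Knuth equivalence: the symmetric transitive closure of the basic relations. -/
def KKnuth : List ℤ → List ℤ → Prop := Relation.EqvGen KKnuthStep

/-- The row word of a tableau on boxes in `ℕ × ℕ`: entries are read row by row
from left to right, starting with the bottom row; `rmax` and `cmax` are bounds
enclosing the shape. -/
def rowWord (T : ℕ × ℕ → Option ℤ) (rmax cmax : ℕ) : List ℤ :=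
  (List.range (rmax + 1)).reverse.flatMap fun r =>
    (List.range (cmax + 1)).filterMap fun c => T (r, c)

/-- The shape of `T` is contained in the rectangle `[0, rmax] × [0, cmax]`. -/
def BoundedBy (T : ℕ × ℕ → Option ℤ) (rmax cmax : ℕ) : Prop :=
  ∀ p : ℕ × ℕ, T p ≠ none → p.1 ≤ rmax ∧ p.2 ≤ cmax


namespace KKnuth

theorem refl (u : List ℤ) : KKnuth u u := Relation.EqvGen.refl u

theorem symm {u v : List ℤ} (h : KKnuth u v) : KKnuth v u := Relation.EqvGen.symm _ _ h

theorem trans {u v w : List ℤ} (h : KKnuth u v) (h' : KKnuth v w) : KKnuth u w :=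
  Relation.EqvGen.trans _ _ _ h h'

theorem of_step {u v : List ℤ} (h : KKnuthStep u v) : KKnuth u v := Relation.EqvGen.rel _ _ h

theorem context {v w : List ℤ} (x y : List ℤ) (h : KKnuth v w) :
    KKnuth (x ++ v ++ y) (x ++ w ++ y) := by
  induction h with
  | rel v w h =>
    apply of_step
    cases h with
    | dup u v a => simpa using KKnuthStep.dup (x ++ u) (v ++ y) a
    | aba u v a b => simpa using KKnuthStep.aba (x ++ u) (v ++ y) a b
    | acb u v a b c h1 h2 => simpa using KKnuthStep.acb (x ++ u) (v ++ y) a b c h1 h2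
    | bac u v a b c h1 h2 => simpa using KKnuthStep.bac (x ++ u) (v ++ y) a b c h1 h2
  | refl v => exact refl _
  | symm v w _ ih => exact ih.symm
  | trans u v w _ _ ih1 ih2 => exact ih1.trans ih2

theorem append_left {v w : List ℤ} (x : List ℤ) (h : KKnuth v w) : KKnuth (x ++ v) (x ++ w) := by
  simpa using h.context x []

theorem cons {v w : List ℤ} (x : ℤ) (h : KKnuth v w) : KKnuth (x :: v) (x :: w) :=
  h.append_left [x]

theorem dup (a : ℤ) (v : List ℤ) : KKnuth (a :: a :: v) (a :: v) :=
  of_step (by simpa using KKnuthStep.dup [] v a)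

theorem aba (a b : ℤ) (v : List ℤ) : KKnuth (a :: b :: a :: v) (b :: a :: b :: v) :=
  of_step (by simpa using KKnuthStep.aba [] v a b)

theorem acb {a b c : ℤ} (h1 : b < a) (h2 : a < c) (v : List ℤ) :
    KKnuth (a :: b :: c :: v) (a :: c :: b :: v) :=
  of_step (by simpa using KKnuthStep.acb [] v a b c h1 h2)

theorem bac {a b c : ℤ} (h1 : a < c) (h2 : c < b) (v : List ℤ) :
    KKnuth (a :: b :: c :: v) (b :: a :: c :: v) :=
  of_step (by simpa using KKnuthStep.bac [] v a b c h1 h2)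

/-- A letter smaller than an increasing run moves left past all of it but its first letter. -/
theorem move_left {a y : ℤ} {L : List ℤ} (hL : (y :: L).Pairwise (· < ·)) (ha : a < y)
    (v : List ℤ) : KKnuth (y :: (L ++ a :: v)) (y :: a :: (L ++ v)) := by
  induction L generalizing y with
  | nil => exact refl _
  | cons l L ih =>
    have hyl : y < l := by
      have := List.pairwise_cons.1 hL
      exact this.1 l (by simp)
    have h1 := (ih (List.pairwise_cons.1 hL).2 (ha.trans hyl)).cons y
    exact h1.trans (acb ha hyl _).symm

/-- Duplicating the first letter of a row into the row above it. -/
theorem insert_head {s : ℤ} {B' B : List ℤ} (hB' : (s :: B').Pairwise (· < ·))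
    (hB : B' = [] ∨ ∃ b B0, B = b :: B0 ∧ s < b ∧ ∀ b' ∈ B', b < b') :
    KKnuth (s :: (B' ++ s :: B)) (s :: (B' ++ B)) := by
  cases B' with
  | nil => exact dup s B
  | cons b' B'' =>
    obtain h | ⟨b, B0, rfl, hsb, hb⟩ := hB
    · simp at h
    have hsb' : s < b' := (List.pairwise_cons.1 hB').1 b' (by simp)
    have hbb' : b < b' := hb b' (by simp)
    have hs := (List.pairwise_cons.1 hB').2
    have e1 : KKnuth (s :: b' :: (B'' ++ b :: B0)) (b' :: s :: b :: (B'' ++ B0)) :=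
      ((move_left hs hbb' B0).cons s).trans (bac hsb hbb' _)
    have e2 : KKnuth (s :: b' :: (B'' ++ s :: b :: B0)) (b' :: s :: b :: (B'' ++ B0)) :=
      ((move_left hs hsb' (b :: B0)).cons s).trans <| (aba s b' _).trans <|
        (e1.cons b').trans (dup b' _)
    exact e2.trans e1.symm

/-- Removing an initial column from a pair of rows. -/
theorem exists_peel {a a' : ℤ} {L : List ℤ} (haa : a ≤ a') (hL : (a' :: L).Pairwise (· < ·))
    (hne : L ≠ []) : ∃ x y : ℤ, ∀ v, KKnuth (a' :: (L ++ a :: v)) (x :: y :: (L ++ v)) := by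
  rcases haa.lt_or_eq with h | rfl
  · exact ⟨a', a, fun v => move_left hL h v⟩
  · cases L with
    | nil => exact absurd rfl hne
    | cons x L =>
      have hax : a < x := (List.pairwise_cons.1 hL).1 x (by simp)
      exact ⟨x, a, fun v =>
        ((move_left (List.pairwise_cons.1 hL).2 hax v).cons a).trans (aba a x _)⟩

/-- A letter of a row may be inserted in the row above it. -/
theorem insert_above {s : ℤ} {A' A B' B : List ℤ} (hA : List.SublistForall₂ (· ≤ ·) A A')
    (hs : (A' ++ s :: B').Pairwise (· < ·))
    (hB : B' = [] ∨ ∃ b B0, B = b :: B0 ∧ s < b ∧ ∀ b' ∈ B', b < b') :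
    KKnuth (A' ++ s :: B' ++ (A ++ s :: B)) (A' ++ s :: B' ++ (A ++ B)) := by
  induction hA with
  | nil =>
    rename_i A'
    have := (insert_head ((List.pairwise_append.1 hs).2.1) hB).append_left A'
    simpa using this
  | cons haa _ ih =>
    rename_i a a' A A' _
    obtain ⟨x, y, hxy⟩ := exists_peel haa hs (by simp)
    have h1 := hxy (A ++ s :: B)
    have h2 := hxy (A ++ B)
    have h3 := ((ih (List.pairwise_cons.1 hs).2).cons y).cons x
    exact (h1.trans h3).trans h2.symm
  | cons_right _ ih =>
    rename_i x A A' _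
    exact (ih (List.pairwise_cons.1 hs).2).cons x

/-- Reversal combined with negation of the letters preserves K-Knuth equivalence. -/
theorem reverse_neg {v w : List ℤ} (h : KKnuth v w) :
    KKnuth (v.map (- ·)).reverse (w.map (- ·)).reverse := by
  induction h with
  | rel v w h =>
    cases h with
    | dup u v a =>
      apply of_step
      simpa using KKnuthStep.dup (v.map (- ·)).reverse (u.map (- ·)).reverse (-a)
    | aba u v a b =>
      apply of_step
      simpa using KKnuthStep.aba (v.map (- ·)).reverse (u.map (- ·)).reverse (-a) (-b)
    | acb u v a b c h1 h2 =>
      apply of_step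
      simpa using KKnuthStep.bac (v.map (- ·)).reverse (u.map (- ·)).reverse (-c) (-b) (-a)
        (by omega) (by omega)
    | bac u v a b c h1 h2 =>
      apply of_step
      simpa using KKnuthStep.acb (v.map (- ·)).reverse (u.map (- ·)).reverse (-c) (-b) (-a)
        (by omega) (by omega)
  | refl v => exact refl _
  | symm v w _ ih => exact ih.symm
  | trans u v w _ _ ih1 ih2 => exact ih1.trans ih2

/-- A letter of a row may be deleted from the row below it. -/
theorem delete_below {s : ℤ} {A' A B' B : List ℤ}
    (hB : List.SublistForall₂ (fun b' b => b ≤ b') B' B)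
    (hs : (A ++ s :: B).Pairwise (· < ·))
    (hA : A = [] ∨ ∃ A0 a', A' = A0 ++ [a'] ∧ a' < s ∧ ∀ a ∈ A, a < a') :
    KKnuth (A' ++ s :: B' ++ (A ++ s :: B)) (A' ++ B' ++ (A ++ s :: B)) := by
  have key := @insert_above (-s) (B.map (- ·)).reverse (B'.map (- ·)).reverse
    (A.map (- ·)).reverse (A'.map (- ·)).reverse ?_ ?_ ?_
  · have := key.reverse_neg
    simpa [Function.comp_def] using this
  · obtain ⟨l, h1, h2⟩ := List.sublistForall₂_iff.1 hB
    refine List.sublistForall₂_iff.2 ⟨(l.map (- ·)).reverse, ?_, (h2.map _).reverse⟩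
    rw [List.forall₂_reverse_iff, List.forall₂_map_left_iff, List.forall₂_map_right_iff]
    exact h1.imp (fun _ _ h => neg_le_neg h)
  · have h : ((A ++ s :: B).map (- ·)).reverse.Pairwise (· < ·) := by
      rw [List.pairwise_reverse, List.pairwise_map]
      exact hs.imp (fun h => neg_lt_neg h)
    simpa using h
  · rcases hA with rfl | ⟨A0, a', rfl, h1, h2⟩
    · left; simp
    · right
      refine ⟨-a', (A0.map (- ·)).reverse, by simp, by omega, ?_⟩
      intro b' hb'
      simp only [List.mem_reverse, List.mem_map] at hb'
      obtain ⟨a, ha, rfl⟩ := hb'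
      have := h2 a ha
      omega

end KKnuth

theorem covBy_iff_nat_prod {x y : ℕ × ℕ} :
    x ⋖ y ↔ y = (x.1, x.2 + 1) ∨ y = (x.1 + 1, x.2) := by
  obtain ⟨a, b⟩ := x
  obtain ⟨c, d⟩ := y
  rw [Prod.mk_covBy_mk_iff, Nat.covBy_iff_add_one_eq, Nat.covBy_iff_add_one_eq]
  simp only [Prod.mk.injEq]
  omega

/-- The smaller of two optional integers, where a missing integer is ignored. -/
def optMin : Option ℤ → Option ℤ → Option ℤ
  | none, b => b
  | some a, none => some a
  | some a, some b => some (min a b)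

/-- The smallest value of a tableau among the boxes covering a given box. -/
def succMin (T : ℕ × ℕ → Option ℤ) (x : ℕ × ℕ) : Option ℤ :=
  optMin (T (x.1, x.2 + 1)) (T (x.1 + 1, x.2))

theorem succMin_le {T : ℕ × ℕ → Option ℤ} {x y : ℕ × ℕ} (h : x ⋖ y) {v : ℤ} (hv : T y = some v) :
    ∃ m, succMin T x = some m ∧ m ≤ v := by
  unfold succMin
  rcases covBy_iff_nat_prod.1 h with rfl | rfl
  · rw [hv]
    cases T (x.1 + 1, x.2) with
    | none => exact ⟨v, rfl, le_rfl⟩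
    | some w => exact ⟨_, rfl, min_le_left _ _⟩
  · rw [hv]
    cases T (x.1, x.2 + 1) with
    | none => exact ⟨v, rfl, le_rfl⟩
    | some w => exact ⟨_, rfl, min_le_right _ _⟩

theorem exists_of_succMin {T : ℕ × ℕ → Option ℤ} {x : ℕ × ℕ} {m : ℤ} (h : succMin T x = some m) :
    ∃ y, x ⋖ y ∧ T y = some m := by
  unfold succMin at h
  have h1 : x ⋖ (x.1, x.2 + 1) := covBy_iff_nat_prod.2 (Or.inl rfl)
  have h2 : x ⋖ (x.1 + 1, x.2) := covBy_iff_nat_prod.2 (Or.inr rfl)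
  cases e1 : T (x.1, x.2 + 1) with
  | none => rw [e1] at h; exact ⟨_, h2, h⟩
  | some v =>
    cases e2 : T (x.1 + 1, x.2) with
    | none => rw [e1, e2] at h; exact ⟨_, h1, e1.trans h⟩
    | some w =>
      rw [e1, e2] at h
      simp only [optMin, Option.some.injEq] at h
      rcases min_choice v w with hm | hm
      · exact ⟨_, h1, by rw [e1, ← h, hm]⟩
      · exact ⟨_, h2, by rw [e2, ← h, hm]⟩

theorem lt_succMin {T : ℕ × ℕ → Option ℤ} (hT : Increasing T) {x : ℕ × ℕ} {v m : ℤ}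
    (hv : T x = some v) (hm : succMin T x = some m) : v < m := by
  obtain ⟨y, hy, hy'⟩ := exists_of_succMin hm
  exact hT x y hy.lt v m hv hy'

/-- The boxes visited by a dot during the forward slide starting from `C`. -/
inductive Dot (T : ℕ × ℕ → Option ℤ) (C : Finset (ℕ × ℕ)) : ℕ × ℕ → Prop
  | base {x : ℕ × ℕ} (h : x ∈ C) : Dot T C x
  | step {x y : ℕ × ℕ} {f : ℤ} (h : Dot T C x) (hxy : x ⋖ y) (hy : T y = some f)
      (hx : succMin T x = some f) : Dot T C y

/-- The result of the forward slide starting from `C`, described without intermediate steps. -/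
def slide (T : ℕ × ℕ → Option ℤ) (C : Finset (ℕ × ℕ)) (x : ℕ × ℕ) : Option ℤ :=
  if Dot T C x then succMin T x else T x

/-- `T` has shape `nu / lam`. -/
structure IsSkew (T : ℕ × ℕ → Option ℤ) (lam nu : Finset (ℕ × ℕ)) : Prop where
  pair : IsSkewPair lam nu
  shape : shapeOf T = (nu : Set (ℕ × ℕ)) \ (lam : Set (ℕ × ℕ))

/-- `C` consists of maximal boxes of `lam`. -/
def IsMaxSet (lam C : Finset (ℕ × ℕ)) : Prop := ∀ c ∈ C, c ∈ lam ∧ ∀ d ∈ lam, ¬ c < d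

theorem IsSkew.ne_none_iff {T : ℕ × ℕ → Option ℤ} {lam nu : Finset (ℕ × ℕ)}
    (h : IsSkew T lam nu) (x : ℕ × ℕ) : T x ≠ none ↔ x ∈ nu ∧ x ∉ lam := by
  have := Set.ext_iff.1 h.shape x
  simpa [shapeOf] using this

theorem IsSkew.eq_none {T : ℕ × ℕ → Option ℤ} {lam nu : Finset (ℕ × ℕ)}
    (h : IsSkew T lam nu) {x : ℕ × ℕ} (hx : x ∈ lam) : T x = none := by
  by_contra hn
  exact ((h.ne_none_iff x).1 hn).2 hx

/-- The dotted tableau reached after all swaps with values smaller than `t`. -/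
def slideState (T : ℕ × ℕ → Option ℤ) (C : Finset (ℕ × ℕ)) (t : ℤ) (x : ℕ × ℕ) : Option ZDot :=
  if Dot T C x then
    if ∃ f, T x = some f ∧ t ≤ f then (T x).map Sum.inl
    else if ∃ m, succMin T x = some m ∧ m < t then (succMin T x).map Sum.inl
    else some (Sum.inr ())
  else (T x).map Sum.inl

section

variable {T : ℕ × ℕ → Option ℤ} {C lam nu : Finset (ℕ × ℕ)} {t : ℤ} {x : ℕ × ℕ}

theorem slideState_eq_inl_iff : slideState T C t x = some (Sum.inl t) ↔ T x = some t := by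
  unfold slideState
  split_ifs with h1 h2 h3
  · simp
  · obtain ⟨m, hm, hm'⟩ := h3
    rw [hm]
    simp only [Option.map_some, Option.some.injEq, Sum.inl.injEq]
    constructor
    · intro h; omega
    · intro h; exact absurd ⟨t, h, le_rfl⟩ h2
  · simp only [Option.some.injEq, reduceCtorEq, false_iff]
    intro h
    exact h2 ⟨t, h, le_rfl⟩
  · simp

theorem slideState_eq_inr_iff : slideState T C t x = some (Sum.inr ()) ↔
    Dot T C x ∧ (∀ f, T x = some f → f < t) ∧ ∀ m, succMin T x = some m → t ≤ m := by
  unfold slideState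
  split_ifs with h1 h2 h3
  · simp only [Option.map_eq_some_iff, reduceCtorEq, and_false, exists_false, false_iff]
    rintro ⟨-, h, -⟩
    obtain ⟨f, hf, hf'⟩ := h2
    have := h f hf
    omega
  · simp only [Option.map_eq_some_iff, reduceCtorEq, and_false, exists_false, false_iff]
    rintro ⟨-, -, h⟩
    obtain ⟨m, hm, hm'⟩ := h3
    have := h m hm
    omega
  · push Not at h2 h3
    simp only [true_iff]
    exact ⟨h1, h2, h3⟩
  · simp [h1]

theorem slideState_succ (hT : Increasing T) (hs : IsSkew T lam nu) (hC : IsMaxSet lam C) :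
    swapVal (Sum.inl t) (Sum.inr ()) (slideState T C t) = slideState T C (t + 1) := by
  have key : ∀ x y, Neighbor x y → slideState T C t x = some (Sum.inr ()) → T y = some t →
      x ⋖ y ∧ succMin T x = some t := by
    intro x y hxy hx hy
    obtain ⟨hd, h1, h2⟩ := slideState_eq_inr_iff.1 hx
    rcases hxy with hxy | hxy
    · obtain ⟨m, hm, hm'⟩ := succMin_le hxy hy
      have := h2 m hm
      exact ⟨hxy, by rw [hm, le_antisymm hm' this]⟩
    · exfalso
      cases hd with
      | base h =>
        have := hs.eq_none (hs.pair.1 x (hC x h).1 y hxy.le)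
        simp [hy] at this
      | step _ _ hf _ =>
        have := hT y x hxy.lt _ _ hy hf
        have := h1 _ hf
        omega
  funext x
  unfold swapVal
  simp only [slideState_eq_inl_iff]
  split_ifs with h1 h2
  · obtain ⟨hx, y, hxy, hy⟩ := h1
    have hxy' : Neighbor y x := hxy.symm
    obtain ⟨hyx, hm⟩ := key y x hxy' hy hx
    symm
    refine slideState_eq_inr_iff.2 ⟨(slideState_eq_inr_iff.1 hy).1.step hyx hx hm, ?_, ?_⟩
    · intro f hf
      have := hx.symm.trans hf
      simp only [Option.some.injEq] at this
      omega
    · intro m hm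
      have := lt_succMin hT hx hm
      omega
  · obtain ⟨hx, y, hxy, hy⟩ := h2
    obtain ⟨-, hm⟩ := key x y hxy hx hy
    obtain ⟨hd, h3, -⟩ := slideState_eq_inr_iff.1 hx
    unfold slideState
    rw [if_pos hd, if_neg, if_pos ⟨t, hm, by omega⟩, hm]
    · rfl
    · rintro ⟨f, hf, hf'⟩
      have := h3 f hf
      omega
  · by_cases hx : T x = some t
    · rw [slideState_eq_inl_iff.2 hx]
      by_cases hd : Dot T C x
      · exfalso
        cases hd with
        | base h => simp [hs.eq_none (hC x h).1] at hx
        | @step y _ f hy hyx hf hm =>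
          apply h1
          refine ⟨hx, y, Or.inr hyx, slideState_eq_inr_iff.2 ⟨hy, ?_, ?_⟩⟩
          · intro g hg
            exact hT y x hyx.lt _ _ hg hx
          · intro m hm'
            rw [hx] at hf
            rw [hm] at hm'
            simp only [Option.some.injEq] at hf hm'
            omega
      · unfold slideState
        rw [if_neg hd, hx]
        rfl
    · by_cases hd : Dot T C x
      · by_cases hdot : slideState T C t x = some (Sum.inr ())
        · rw [hdot]
          symm
          obtain ⟨_, h3, h4⟩ := slideState_eq_inr_iff.1 hdot
          refine slideState_eq_inr_iff.2 ⟨hd, fun f hf => by have := h3 f hf; omega, ?_⟩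
          intro m hm
          have := h4 m hm
          rcases this.lt_or_eq with h | rfl
          · omega
          · exfalso
            apply h2
            obtain ⟨y, hy, hy'⟩ := exists_of_succMin hm
            exact ⟨hdot, y, Or.inl hy, hy'⟩
        · have e1 : (∃ f, T x = some f ∧ t ≤ f) ↔ (∃ f, T x = some f ∧ t + 1 ≤ f) := by
            constructor
            · rintro ⟨f, hf, h⟩
              refine ⟨f, hf, ?_⟩
              rcases h.lt_or_eq with h | rfl
              · omega
              · exact absurd hf hx
            · rintro ⟨f, hf, h⟩
              exact ⟨f, hf, by omega⟩
          unfold slideState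
          rw [if_pos hd, if_pos hd]
          by_cases h5 : ∃ f, T x = some f ∧ t ≤ f
          · rw [if_pos h5, if_pos (e1.1 h5)]
          · rw [if_neg h5, if_neg (fun h => h5 (e1.2 h))]
            by_cases h6 : ∃ m, succMin T x = some m ∧ m < t
            · obtain ⟨m, hm, hm'⟩ := h6
              rw [if_pos ⟨m, hm, hm'⟩, if_pos ⟨m, hm, by omega⟩]
            · exfalso
              push Not at h5 h6
              exact hdot (slideState_eq_inr_iff.2 ⟨hd, h5, h6⟩)
      · unfold slideState
        rw [if_neg hd, if_neg hd]

theorem swapUp_eq_slideState (hT : Increasing T) (hs : IsSkew T lam nu) (hC : IsMaxSet lam C)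
    {a b : ℤ} (hv : ValuesIn T a b) (n : ℕ) :
    swapUp a n (addDots C (toDotted T)) = slideState T C (a + n) := by
  induction n with
  | zero =>
    funext x
    simp only [swapUp, addDots, toDotted, slideState, Nat.cast_zero, add_zero]
    by_cases hx : x ∈ C
    · rw [if_pos hx, if_pos (Dot.base hx), if_neg, if_neg]
      · rintro ⟨m, hm, hm'⟩
        obtain ⟨y, -, hy⟩ := exists_of_succMin hm
        have := (hv y m hy).1
        omega
      · rintro ⟨f, hf, -⟩
        simp [hs.eq_none (hC x hx).1] at hf
    · rw [if_neg hx]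
      by_cases hd : Dot T C x
      · rw [if_pos hd, if_pos]
        cases hd with
        | base h => exact absurd h hx
        | @step y _ f hy hyx hf hm => exact ⟨f, hf, (hv x f hf).1⟩
      · rw [if_neg hd]
  | succ n ih =>
    rw [swapUp, ih, slideState_succ hT hs hC]
    push_cast
    rw [add_assoc]

theorem restrictInt_swapUp (hT : Increasing T) (hs : IsSkew T lam nu) (hC : IsMaxSet lam C)
    {a b : ℤ} (hv : ValuesIn T a b) :
    restrictInt (swapUp a (b - a + 1).toNat (addDots C (toDotted T))) = slide T C := by
  rw [swapUp_eq_slideState hT hs hC hv]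
  funext x
  have hb : ∀ y v, T y = some v → v < a + ((b - a + 1).toNat : ℤ) := by
    intro y v h
    have := hv y v h
    omega
  unfold restrictInt slideState slide
  by_cases hd : Dot T C x
  · rw [if_pos hd, if_pos hd, if_neg]
    · cases hm : succMin T x with
      | none => simp
      | some m =>
        obtain ⟨y, -, hy⟩ := exists_of_succMin hm
        rw [if_pos ⟨m, rfl, hb y m hy⟩]
        simp
    · rintro ⟨f, hf, hf'⟩
      have := hb x f hf
      omega
  · rw [if_neg hd, if_neg hd]
    cases T x <;> simp

theorem isForwardSlide_iff {T' : ℕ × ℕ → Option ℤ} (hT : Increasing T) : IsForwardSlide T T' ↔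
    ∃ lam nu C, IsSkew T lam nu ∧ IsMaxSet lam C ∧ T' = slide T C := by
  constructor
  · rintro ⟨lam, nu, C, a, b, h1, h2, h3, h4, rfl⟩
    exact ⟨lam, nu, C, ⟨h1, h2⟩, h4, restrictInt_swapUp hT ⟨h1, h2⟩ h4 h3⟩
  · rintro ⟨lam, nu, C, hs, hC, rfl⟩
    have hfin : {v | ∃ x, T x = some v}.Finite := by
      refine ((nu.finite_toSet).image (fun x => (T x).getD 0)).subset ?_
      rintro v ⟨x, hx⟩
      refine ⟨x, ((hs.ne_none_iff x).1 (by simp [hx])).1, by simp [hx]⟩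
    obtain ⟨a, ha⟩ := hfin.bddBelow
    obtain ⟨b, hb⟩ := hfin.bddAbove
    have hv : ValuesIn T a b := fun x v h => ⟨ha ⟨x, h⟩, hb ⟨x, h⟩⟩
    exact ⟨lam, nu, C, a, b, hs.pair, hs.shape, hv, hC, (restrictInt_swapUp hT hs hC hv).symm⟩

end

section

variable {T : ℕ × ℕ → Option ℤ} {C lam nu : Finset (ℕ × ℕ)} {x y : ℕ × ℕ}

theorem Dot.mem_or (h : Dot T C x) : x ∈ C ∨ ∃ f, T x = some f := by
  cases h with
  | base h => exact Or.inl h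
  | step _ _ hf _ => exact Or.inr ⟨_, hf⟩

theorem Dot.notMem_sdiff (hs : IsSkew T lam nu) (h : Dot T C x) : x ∉ lam \ C := by
  rw [Finset.mem_sdiff]
  rintro ⟨h1, h2⟩
  rcases h.mem_or with h | ⟨f, hf⟩
  · exact h2 h
  · simp [hs.eq_none h1] at hf

theorem Dot.mem_nu (hs : IsSkew T lam nu) (hC : IsMaxSet lam C) (h : Dot T C x) : x ∈ nu := by
  rcases h.mem_or with h | ⟨f, hf⟩
  · exact hs.pair.2.2 (hC x h).1
  · exact ((hs.ne_none_iff x).1 (by simp [hf])).1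

theorem Dot.notMem_of_lt (hs : IsSkew T lam nu) (hC : IsMaxSet lam C) (h : Dot T C x)
    (hxy : x < y) : y ∉ lam := by
  intro hy
  rcases h.mem_or with h | ⟨f, hf⟩
  · exact (hC x h).2 y hy hxy
  · simp [hs.eq_none (hs.pair.1 y hy x hxy.le)] at hf

theorem increasing_of_covBy (hs : IsSkew T lam nu)
    (h : ∀ x y, x ⋖ y → ∀ p q, T x = some p → T y = some q → p < q) : Increasing T := by
  intro x y hxy p q hp hq
  have hy := (hs.ne_none_iff y).1 (by simp [hq])
  have htg := transGen_covBy_of_lt hxy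
  clear hxy
  induction htg using Relation.TransGen.head_induction_on generalizing p with
  | single hxy => exact h _ _ hxy _ _ hp hq
  | @head x z hxz hzy ih =>
    have hzy' : z < y := lt_iff_transGen_covBy.2 hzy
    have hx := (hs.ne_none_iff x).1 (by simp [hp])
    have hz : T z ≠ none := (hs.ne_none_iff z).2
      ⟨hs.pair.2.1 y hy.1 z hzy'.le, fun hz => hx.2 (hs.pair.1 z hz x hxz.le)⟩
    obtain ⟨v, hv⟩ := Option.ne_none_iff_exists'.1 hz
    exact (h _ _ hxz _ _ hp hv).trans (ih _ hv)

theorem slide_isSkew (hs : IsSkew T lam nu) (hC : IsMaxSet lam C) :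
    IsSkew (slide T C) (lam \ C) (nu.filter fun x => ¬ (Dot T C x ∧ succMin T x = none)) := by
  refine ⟨⟨?_, ?_, ?_⟩, ?_⟩
  · intro a ha b hb
    rw [Finset.mem_sdiff] at ha ⊢
    refine ⟨hs.pair.1 a ha.1 b hb, fun hbC => ?_⟩
    rcases hb.lt_or_eq with h | rfl
    · exact (hC b hbC).2 a ha.1 h
    · exact ha.2 hbC
  · intro a ha b hb
    rw [Finset.mem_filter] at ha ⊢
    refine ⟨hs.pair.2.1 a ha.1 b hb, fun hbd => ?_⟩
    rcases hb.lt_or_eq with h | rfl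
    · obtain ⟨c, hc, hca⟩ := exists_covBy_le_of_lt h
      have hcT := (hs.ne_none_iff c).2
        ⟨hs.pair.2.1 a ha.1 c hca, hbd.1.notMem_of_lt hs hC hc.lt⟩
      obtain ⟨v, hv⟩ := Option.ne_none_iff_exists'.1 hcT
      obtain ⟨m, hm, -⟩ := succMin_le hc hv
      simp [hbd.2] at hm
    · exact ha.2 hbd
  · intro x hx
    rw [Finset.mem_filter]
    exact ⟨hs.pair.2.2 (Finset.mem_sdiff.1 hx).1, fun h => h.1.notMem_sdiff hs hx⟩
  · ext x
    simp only [shapeOf, Set.mem_ofPred_eq, Set.mem_sdiff, Finset.mem_coe]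
    by_cases hd : Dot T C x
    · have h1 := hd.notMem_sdiff hs
      have h2 := hd.mem_nu hs hC
      simp only [slide, Finset.mem_filter, h2, hd, h1]
      simp
    · have h1 : x ∉ C := fun h => hd (Dot.base h)
      simp only [slide, Finset.mem_filter, Finset.mem_sdiff, h1, hd]
      simpa using hs.ne_none_iff x

theorem slide_increasing (hT : Increasing T) (hs : IsSkew T lam nu) (hC : IsMaxSet lam C) :
    Increasing (slide T C) := by
  refine increasing_of_covBy (slide_isSkew hs hC) ?_
  intro x y hxy p q hp hq
  unfold slide at hp hq
  split_ifs at hp hq with hx hy hy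
  · rcases hy.mem_or with h | ⟨f, hf⟩
    · exact absurd (hC y h).1 (hx.notMem_of_lt hs hC hxy.lt)
    · obtain ⟨m, hm, hmf⟩ := succMin_le hxy hf
      have := lt_succMin hT hf hq
      rw [hm, Option.some.injEq] at hp
      omega
  · obtain ⟨m, hm, hmf⟩ := succMin_le hxy hq
    rw [hm, Option.some.injEq] at hp
    rcases hmf.lt_or_eq with h | h
    · omega
    · exact absurd (hx.step hxy hq (by rw [hm, h])) hy
  · rcases hy.mem_or with h | ⟨f, hf⟩
    · have := hs.eq_none (hs.pair.1 y (hC y h).1 x hxy.le)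
      simp [hp] at this
    · exact (hT x y hxy.lt p f hp hf).trans (lt_succMin hT hf hq)
  · exact hT x y hxy.lt p q hp hq

theorem IncreasingSkewTableau.exists_isSkew (h : IncreasingSkewTableau T) :
    ∃ lam nu, IsSkew T lam nu := by
  obtain ⟨⟨lam, nu, h1, h2⟩, -⟩ := h
  exact ⟨lam, nu, h1, h2⟩

theorem IsSkew.good (hs : IsSkew T lam nu) (hT : Increasing T) : IncreasingSkewTableau T :=
  ⟨⟨lam, nu, hs.pair, hs.shape⟩, hT⟩

theorem IncreasingSkewTableau.of_slide {T' : ℕ × ℕ → Option ℤ} (h : IncreasingSkewTableau T)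
    (h' : IsForwardSlide T T') : IncreasingSkewTableau T' := by
  obtain ⟨lam, nu, C, hs, hC, rfl⟩ := (isForwardSlide_iff h.2).1 h'
  exact (slide_isSkew hs hC).good (slide_increasing h.2 hs hC)

theorem IncreasingSkewTableau.of_slides {T' : ℕ × ℕ → Option ℤ} (h : IncreasingSkewTableau T)
    (h' : Relation.ReflTransGen IsForwardSlide T T') : IncreasingSkewTableau T' := by
  induction h' with
  | refl => exact h
  | tail _ h' ih => exact ih.of_slide h'

theorem HasStraightShape.good (h : HasStraightShape T) (hT : Increasing T) :
    IncreasingSkewTableau T := by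
  obtain ⟨nu, h1, h2⟩ := h
  exact ⟨⟨∅, nu, ⟨fun a ha => by simp at ha, h1, by simp⟩, by simpa using h2⟩, hT⟩

theorem exists_rectifiesTo (h : IncreasingSkewTableau T) : ∃ U, RectifiesTo T U := by
  obtain ⟨lam, nu, hs⟩ := h.exists_isSkew
  induction hn : lam.card using Nat.strong_induction_on generalizing T lam nu with
  | _ n ih =>
  rcases lam.eq_empty_or_nonempty with rfl | hne
  · exact ⟨T, Relation.ReflTransGen.refl, nu, hs.pair.2.1, by simpa using hs.shape⟩
  · obtain ⟨c, hc⟩ := Finset.exists_maximal hne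
    have hC : IsMaxSet lam {c} := by
      intro d hd
      rw [Finset.mem_singleton] at hd
      subst hd
      exact ⟨hc.1, fun e he hde => hc.not_gt he hde⟩
    have hstep : IsForwardSlide T (slide T {c}) :=
      (isForwardSlide_iff h.2).2 ⟨lam, nu, {c}, hs, hC, rfl⟩
    obtain ⟨U, hU, hU'⟩ := ih (lam \ {c}).card
      (by rw [← hn]; exact Finset.card_lt_card (Finset.sdiff_ssubset (by simpa using hc.1) (by simp)))
      (h.of_slide hstep) _ _ (slide_isSkew hs hC) rfl
    exact ⟨U, hU.head hstep, hU'⟩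

end

/-- The entries of a row in columns smaller than `c`. -/
def rowLt (H : ℕ × ℕ → Option ℤ) (r c : ℕ) : List ℤ :=
  (List.range c).filterMap fun k => H (r, k)

/-- The entries of a row in columns larger than `c` and at most `cm`. -/
def rowGt (H : ℕ × ℕ → Option ℤ) (cm r c : ℕ) : List ℤ :=
  (List.range' (c + 1) (cm - c)).filterMap fun k => H (r, k)

/-- The entries of a row in columns at most `cm`. -/
def rowList (H : ℕ × ℕ → Option ℤ) (cm r : ℕ) : List ℤ :=
  (List.range (cm + 1)).filterMap fun k => H (r, k)

theorem rowLt_succ (H : ℕ × ℕ → Option ℤ) (r c : ℕ) :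
    rowLt H r (c + 1) = rowLt H r c ++ (H (r, c)).toList := by
  unfold rowLt
  rw [List.range_succ, List.filterMap_append]
  cases h : H (r, c) <;> simp [h]

theorem rowGt_eq (H : ℕ × ℕ → Option ℤ) {cm c : ℕ} (r : ℕ) (hc : c + 1 ≤ cm) :
    rowGt H cm r c = (H (r, c + 1)).toList ++ rowGt H cm r (c + 1) := by
  unfold rowGt
  obtain ⟨d, rfl⟩ := Nat.exists_eq_add_of_le hc
  have e1 : c + 1 + d - c = d + 1 := by omega
  have e2 : c + 1 + d - (c + 1) = d := by omega
  rw [e1, e2, List.range'_succ]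
  cases h : H (r, c + 1) <;> simp [h]

theorem range_succ_eq {c m : ℕ} (h : c ≤ m) :
    List.range (m + 1) = List.range c ++ c :: List.range' (c + 1) (m - c) := by
  have e := @List.range'_append_1 0 (c + 1) (m - c)
  rw [show c + 1 + (m - c) = m + 1 by omega, zero_add, ← List.range_eq_range',
    ← List.range_eq_range', List.range_succ] at e
  rw [← e]
  simp

theorem rowList_eq (H : ℕ × ℕ → Option ℤ) {cm c : ℕ} (r : ℕ) (hc : c ≤ cm) :
    rowList H cm r = rowLt H r c ++ (H (r, c)).toList ++ rowGt H cm r c := by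
  unfold rowList rowLt rowGt
  rw [range_succ_eq hc, List.filterMap_append, List.append_assoc]
  cases h : H (r, c) <;> simp [h]

theorem rowWord_eq_flatMap (H : ℕ × ℕ → Option ℤ) (rm cm : ℕ) :
    rowWord H rm cm = (List.range (rm + 1)).reverse.flatMap (rowList H cm) := rfl

theorem rowLt_congr {H H' : ℕ × ℕ → Option ℤ} {r c : ℕ} (h : ∀ k < c, H (r, k) = H' (r, k)) :
    rowLt H r c = rowLt H' r c :=
  List.filterMap_congr fun k hk => h k (List.mem_range.1 hk)

theorem rowGt_congr {H H' : ℕ × ℕ → Option ℤ} {cm r c : ℕ}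
    (h : ∀ k, c < k → H (r, k) = H' (r, k)) : rowGt H cm r c = rowGt H' cm r c :=
  List.filterMap_congr fun k hk => h k (by rw [List.mem_range'_1] at hk; omega)

theorem rowList_congr {H H' : ℕ × ℕ → Option ℤ} {cm r : ℕ} (h : ∀ k, H (r, k) = H' (r, k)) :
    rowList H cm r = rowList H' cm r :=
  List.filterMap_congr fun k _ => h k

theorem rowList_update_of_ne (H : ℕ × ℕ → Option ℤ) {r j : ℕ} (cm c : ℕ) (h : r ≠ j)
    (v : Option ℤ) : rowList (Function.update H (j, c) v) cm r = rowList H cm r :=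
  rowList_congr fun k => Function.update_of_ne (by simp [h]) _ _

theorem rowList_update (H : ℕ × ℕ → Option ℤ) {cm c : ℕ} (j : ℕ) (hc : c ≤ cm) (v : Option ℤ) :
    rowList (Function.update H (j, c) v) cm j = rowLt H j c ++ v.toList ++ rowGt H cm j c := by
  rw [rowList_eq _ j hc, Function.update_self]
  congr 1
  · congr 1
    exact rowLt_congr fun k hk => Function.update_of_ne (by simp; omega) _ _
  · exact rowGt_congr fun k hk => Function.update_of_ne (by simp; omega) _ _

theorem rowWord_update (H : ℕ × ℕ → Option ℤ) {rm cm j c : ℕ} (hj : j ≤ rm) (hc : c ≤ cm)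
    (v : Option ℤ) : rowWord (Function.update H (j, c) v) rm cm =
      (List.range' (j + 1) (rm - j)).reverse.flatMap (rowList H cm) ++
      (rowLt H j c ++ v.toList ++ rowGt H cm j c) ++
      (List.range j).reverse.flatMap (rowList H cm) := by
  rw [rowWord_eq_flatMap, range_succ_eq hj]
  simp only [List.reverse_append, List.reverse_cons, List.flatMap_append, List.flatMap_cons,
    List.flatMap_nil, List.append_nil]
  rw [rowList_update H j hc]
  congr 1
  · congr 1
    exact List.flatMap_congr fun r hr => rowList_update_of_ne H cm c
      (by simp [List.mem_range'_1] at hr; omega) v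
  · exact List.flatMap_congr fun r hr => rowList_update_of_ne H cm c
      (by simp at hr; omega) v

theorem rowWord_update_upper (H : ℕ × ℕ → Option ℤ) {rm cm j c : ℕ} (hj : j + 1 ≤ rm)
    (hc : c ≤ cm) : ∃ X Y, ∀ v : Option ℤ, rowWord (Function.update H (j, c) v) rm cm =
      X ++ (rowLt H (j + 1) c ++ (H (j + 1, c)).toList ++ rowGt H cm (j + 1) c ++
        (rowLt H j c ++ v.toList ++ rowGt H cm j c)) ++ Y := by
  refine ⟨(List.range' (j + 1 + 1) (rm - (j + 1))).reverse.flatMap (rowList H cm),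
    (List.range j).reverse.flatMap (rowList H cm), fun v => ?_⟩
  rw [rowWord_update H (by omega) hc, ← rowList_eq H (j + 1) hc]
  have e : rm - j = rm - (j + 1) + 1 := by omega
  rw [e, List.range'_succ]
  simp only [List.reverse_cons, List.flatMap_append, List.flatMap_cons,
    List.flatMap_nil, List.append_nil, List.append_assoc]

theorem rowWord_update_lower (H : ℕ × ℕ → Option ℤ) {rm cm i c : ℕ} (hj : i + 1 ≤ rm)
    (hc : c ≤ cm) : ∃ X Y, ∀ v : Option ℤ, rowWord (Function.update H (i + 1, c) v) rm cm =
      X ++ (rowLt H (i + 1) c ++ v.toList ++ rowGt H cm (i + 1) c ++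
        (rowLt H i c ++ (H (i, c)).toList ++ rowGt H cm i c)) ++ Y := by
  refine ⟨(List.range' (i + 1 + 1) (rm - (i + 1))).reverse.flatMap (rowList H cm),
    (List.range i).reverse.flatMap (rowList H cm), fun v => ?_⟩
  rw [rowWord_update H hj hc, ← rowList_eq H i hc, List.range_succ]
  simp only [List.reverse_append, List.reverse_singleton, List.singleton_append,
    List.flatMap_cons, List.append_assoc]

theorem sublistForall₂_filterMap {R : ℤ → ℤ → Prop} {p q : ℕ → Option ℤ} (l : List ℕ)
    (h : ∀ k ∈ l, ∀ a, p k = some a → ∃ a', q k = some a' ∧ R a a') :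
    List.SublistForall₂ R (l.filterMap p) (l.filterMap q) := by
  induction l with
  | nil => exact List.SublistForall₂.nil
  | cons k l ih =>
    have ih := ih fun k hk => h k (by simp [hk])
    cases hp : p k with
    | none =>
      rw [List.filterMap_cons_none hp]
      cases hq : q k with
      | none => rwa [List.filterMap_cons_none hq]
      | some b => rw [List.filterMap_cons_some hq]; exact ih.cons_right
    | some a =>
      obtain ⟨a', hq, hR⟩ := h k (by simp) a hp
      rw [List.filterMap_cons_some hp, List.filterMap_cons_some hq]
      exact ih.cons hR

theorem pairwise_rowList {H : ℕ × ℕ → Option ℤ} {r : ℕ} (cm : ℕ)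
    (h : ∀ k k', k < k' → ∀ p q, H (r, k) = some p → H (r, k') = some q → p < q) :
    (rowList H cm r).Pairwise (· < ·) := by
  unfold rowList
  rw [List.pairwise_filterMap]
  exact List.pairwise_lt_range.imp fun hk p hp q hq => h _ _ hk p q hp hq

theorem mem_rowLt {H : ℕ × ℕ → Option ℤ} {r c : ℕ} {a : ℤ} (h : a ∈ rowLt H r c) :
    ∃ k < c, H (r, k) = some a := by
  simpa [rowLt] using h

theorem mem_rowGt {H : ℕ × ℕ → Option ℤ} {cm r c : ℕ} {a : ℤ} (h : a ∈ rowGt H cm r c) :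
    ∃ k, c < k ∧ H (r, k) = some a := by
  unfold rowGt at h
  rw [List.mem_filterMap] at h
  obtain ⟨k, hk, hk'⟩ := h
  rw [List.mem_range'_1] at hk
  exact ⟨k, by omega, hk'⟩

section

variable {H : ℕ × ℕ → Option ℤ} {rm cm : ℕ} {s : ℤ} {v : Option ℤ}

theorem KKnuth.update_dup_right {j c : ℕ} (hj : j ≤ rm) (hc : c + 1 ≤ cm)
    (h : H (j, c + 1) = some s) :
    KKnuth (rowWord (Function.update H (j, c) (some s)) rm cm)
      (rowWord (Function.update H (j, c) none) rm cm) := by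
  rw [rowWord_update H hj (by omega), rowWord_update H hj (by omega), rowGt_eq H j hc, h]
  refine KKnuth.context _ _ ?_
  simpa using (KKnuth.dup s (rowGt H cm j (c + 1))).append_left (rowLt H j c)

theorem KKnuth.update_dup_left {j c : ℕ} (hj : j ≤ rm) (hc : c + 1 ≤ cm)
    (h : H (j, c) = some s) :
    KKnuth (rowWord (Function.update H (j, c + 1) (some s)) rm cm)
      (rowWord (Function.update H (j, c + 1) none) rm cm) := by
  rw [rowWord_update H hj hc, rowWord_update H hj hc, rowLt_succ, h]
  refine KKnuth.context _ _ ?_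
  simpa using (KKnuth.dup s (rowGt H cm j (c + 1))).append_left (rowLt H j c)

theorem KKnuth.update_upper {j c : ℕ} (hj : j + 1 ≤ rm) (hc : c ≤ cm)
    (h : H (j + 1, c) = some s)
    (hrow : ∀ k k', k < k' → ∀ p q, H (j + 1, k) = some p → H (j + 1, k') = some q → p < q)
    (hA : ∀ k < c, ∀ p, H (j, k) = some p → ∃ p', H (j + 1, k) = some p' ∧ p ≤ p')
    (hB : (∀ k, c < k → H (j + 1, k) = none) ∨ (c + 1 ≤ cm ∧ ∃ b, H (j, c + 1) = some b ∧ s < b ∧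
      ∀ k, c < k → ∀ b', H (j + 1, k) = some b' → b < b')) :
    KKnuth (rowWord (Function.update H (j, c) (some s)) rm cm)
      (rowWord (Function.update H (j, c) none) rm cm) := by
  obtain ⟨X, Y, hXY⟩ := rowWord_update_upper H hj hc
  rw [hXY, hXY, h]
  refine KKnuth.context _ _ ?_
  have hs := pairwise_rowList cm hrow
  rw [rowList_eq H (j + 1) hc, h] at hs
  have := @KKnuth.insert_above s (rowLt H (j + 1) c) (rowLt H j c) (rowGt H cm (j + 1) c)
    (rowGt H cm j c) (sublistForall₂_filterMap _ fun k hk => hA k (List.mem_range.1 hk))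
    (by simpa using hs) ?_
  · simpa using this
  · rcases hB with hB | ⟨hc', b, hb, hsb, hB⟩
    · left
      by_contra hne
      obtain ⟨a, ha⟩ := List.exists_mem_of_ne_nil _ hne
      obtain ⟨k, hk, hk'⟩ := mem_rowGt ha
      simp [hB k hk] at hk'
    · right
      refine ⟨b, _, by rw [rowGt_eq H j hc', hb]; rfl, hsb, ?_⟩
      intro b' hb'
      obtain ⟨k, hk, hk'⟩ := mem_rowGt hb'
      exact hB k hk b' hk'

theorem KKnuth.update_lower {i c : ℕ} (hj : i + 1 ≤ rm) (hc : c ≤ cm)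
    (h : H (i, c) = some s)
    (hrow : ∀ k k', k < k' → ∀ p q, H (i, k) = some p → H (i, k') = some q → p < q)
    (hB : ∀ k, c < k → ∀ p, H (i + 1, k) = some p → ∃ p', H (i, k) = some p' ∧ p' ≤ p)
    (hA : (∀ k < c, H (i, k) = none) ∨ ∃ d a', c = d + 1 ∧ H (i + 1, d) = some a' ∧ a' < s ∧
      ∀ k < c, ∀ a, H (i, k) = some a → a < a') :
    KKnuth (rowWord (Function.update H (i + 1, c) (some s)) rm cm)
      (rowWord (Function.update H (i + 1, c) none) rm cm) := by
  obtain ⟨X, Y, hXY⟩ := rowWord_update_lower H hj hc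
  rw [hXY, hXY, h]
  refine KKnuth.context _ _ ?_
  have hs := pairwise_rowList cm hrow
  rw [rowList_eq H i hc, h] at hs
  have := @KKnuth.delete_below s (rowLt H (i + 1) c) (rowLt H i c) (rowGt H cm (i + 1) c)
    (rowGt H cm i c) (sublistForall₂_filterMap _ fun k hk => hB k
      (by rw [List.mem_range'_1] at hk; omega))
    (by simpa using hs) ?_
  · simpa using this
  · rcases hA with hA | ⟨d, a', rfl, ha', has, hA⟩
    · left
      by_contra hne
      obtain ⟨a, ha⟩ := List.exists_mem_of_ne_nil _ hne
      obtain ⟨k, hk, hk'⟩ := mem_rowLt ha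
      simp [hA k hk] at hk'
    · right
      refine ⟨_, a', by rw [rowLt_succ, ha']; rfl, has, ?_⟩
      intro a ha
      obtain ⟨k, hk, hk'⟩ := mem_rowLt ha
      exact hA k hk a hk'

end

/-- The tableau agreeing with `S` before the box `(j, c)` in the order reading rows from top to
bottom and with `T` from this box on. -/
def hybrid (S T : ℕ × ℕ → Option ℤ) (j c : ℕ) (x : ℕ × ℕ) : Option ℤ :=
  if x.1 < j ∨ (x.1 = j ∧ x.2 < c) then S x else T x

theorem hybrid_succ (S T : ℕ × ℕ → Option ℤ) (j c : ℕ) :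
    hybrid S T j (c + 1) = Function.update (hybrid S T j c) (j, c) (S (j, c)) := by
  funext x
  by_cases hx : x = (j, c)
  · subst hx
    simp [hybrid]
  · rw [Function.update_of_ne hx]
    unfold hybrid
    have : (x.1 < j ∨ (x.1 = j ∧ x.2 < c + 1)) ↔ (x.1 < j ∨ (x.1 = j ∧ x.2 < c)) := by
      have : ¬ (x.1 = j ∧ x.2 = c) := fun h => hx (Prod.ext h.1 h.2)
      omega
    simp only [this]

theorem hybrid_eq_update (S T : ℕ × ℕ → Option ℤ) (j c : ℕ) :
    hybrid S T j c = Function.update (hybrid S T j c) (j, c) (T (j, c)) := by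
  rw [eq_comm, Function.update_eq_self_iff]
  simp [hybrid]

theorem hybrid_of_lt {S T : ℕ × ℕ → Option ℤ} {j c i k : ℕ} (h : i < j ∨ (i = j ∧ k < c)) :
    hybrid S T j c (i, k) = S (i, k) := if_pos h

theorem hybrid_of_ge {S T : ℕ × ℕ → Option ℤ} {j c i k : ℕ} (h : j < i ∨ (i = j ∧ c ≤ k)) :
    hybrid S T j c (i, k) = T (i, k) := if_neg (by simp only; omega)

section

variable {T : ℕ × ℕ → Option ℤ} {C lam nu : Finset (ℕ × ℕ)} {rm cm : ℕ}

theorem slide_le {x y : ℕ × ℕ} (hT : Increasing T) (hxy : x ⋖ y) {p p' : ℤ}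
    (hp : slide T C x = some p) (hp' : T y = some p') : p ≤ p' := by
  unfold slide at hp
  split_ifs at hp
  · obtain ⟨m, hm, hmf⟩ := succMin_le hxy hp'
    rw [hm, Option.some.injEq] at hp
    omega
  · exact (hT x y hxy.lt p p' hp hp').le

theorem KKnuth.hybrid_remove (hT : Increasing T) (hs : IsSkew T lam nu) (hC : IsMaxSet lam C)
    (hb : ∀ x ∈ nu, x.1 ≤ rm ∧ x.2 ≤ cm) {j c : ℕ} (hd : Dot T C (j, c)) :
    KKnuth (rowWord (Function.update (hybrid (slide T C) T j c) (j, c) (T (j, c))) rm cm)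
      (rowWord (Function.update (hybrid (slide T C) T j c) (j, c) none) rm cm) := by
  cases hf : T (j, c) with
  | none => exact KKnuth.refl _
  | some f =>
    have hnu : ∀ y v, T y = some v → y ∈ nu ∧ y ∉ lam := fun y v h =>
      (hs.ne_none_iff y).1 (by simp [h])
    have hbj := hb _ (hnu _ _ hf).1
    simp only at hbj
    have hT' := slide_increasing hT hs hC
    have left : ∀ d, c = d + 1 → slide T C (j, d) = some f →
        KKnuth (rowWord (Function.update (hybrid (slide T C) T j c) (j, c) (some f)) rm cm)
          (rowWord (Function.update (hybrid (slide T C) T j c) (j, c) none) rm cm) := by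
      rintro d rfl h
      refine KKnuth.update_dup_left hbj.1 hbj.2 ?_
      rw [hybrid_of_lt (by omega), h]
    cases hd with
    | base h =>
      have := hs.eq_none (hC _ h).1
      simp [hf] at this
    | @step y _ f' hy hyx hf' hm =>
      rw [hf, Option.some.injEq] at hf'
      subst hf'
      have hy' : slide T C y = some f := by rw [slide, if_pos hy, hm]
      obtain ⟨i, k⟩ := y
      rcases covBy_iff_nat_prod.1 hyx with h | h
      · simp only [Prod.mk.injEq] at h
        obtain ⟨rfl, rfl⟩ := h
        exact left k rfl hy'
      · simp only [Prod.mk.injEq] at h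
        obtain ⟨rfl, rfl⟩ := h
        by_cases hl : ∃ d, c = d + 1 ∧ slide T C (i + 1, d) = some f
        · obtain ⟨d, h1, h2⟩ := hl
          exact left d h1 h2
        · refine KKnuth.update_lower hbj.1 hbj.2 (by rw [hybrid_of_lt (by omega), hy']) ?_ ?_ ?_
          · intro k k' hk p q hp hq
            rw [hybrid_of_lt (by omega)] at hp hq
            exact hT' (i, k) (i, k') (by simp [Prod.mk_lt_mk, hk]) p q hp hq
          · intro k hk p hp
            rw [hybrid_of_ge (by omega)] at hp
            rw [hybrid_of_lt (by omega)]
            have hcov : ((i, k) : ℕ × ℕ) ⋖ (i + 1, k) := covBy_iff_nat_prod.2 (Or.inr rfl)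
            have hlt : ((i, c) : ℕ × ℕ) < (i, k) := by simp [Prod.mk_lt_mk, hk]
            have hne : slide T C (i, k) ≠ none := by
              unfold slide
              split_ifs with h
              · obtain ⟨m, hm, -⟩ := succMin_le hcov hp
                simp [hm]
              · exact (hs.ne_none_iff _).2 ⟨hs.pair.2.1 _ (hnu _ _ hp).1 _ hcov.le,
                  hy.notMem_of_lt hs hC hlt⟩
            obtain ⟨p', hp'⟩ := Option.ne_none_iff_exists'.1 hne
            exact ⟨p', hp', slide_le hT hcov hp' hp⟩
          · by_cases hA : ∀ k < c, hybrid (slide T C) T (i + 1) c (i, k) = none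
            · exact Or.inl hA
            · right
              push Not at hA
              obtain ⟨k, hk, hkn⟩ := hA
              rw [hybrid_of_lt (by omega)] at hkn
              obtain ⟨d, rfl⟩ := Nat.exists_eq_add_one_of_ne_zero (by omega : c ≠ 0)
              have hcov : ((i + 1, d) : ℕ × ℕ) ⋖ (i + 1, d + 1) :=
                covBy_iff_nat_prod.2 (Or.inl rfl)
              have hne : slide T C (i + 1, d) ≠ none := by
                unfold slide
                split_ifs with h
                · obtain ⟨m, hm, -⟩ := succMin_le hcov hf
                  simp [hm]
                · refine (hs.ne_none_iff _).2 ⟨hs.pair.2.1 _ (hnu _ _ hf).1 _ hcov.le, ?_⟩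
                  intro hlam
                  have h1 := (((slide_isSkew hs hC).ne_none_iff _).1 hkn).2
                  refine h1 ((slide_isSkew hs hC).pair.1 (i + 1, d) ?_ (i, k) ?_)
                  · exact Finset.mem_sdiff.2 ⟨hlam, fun h' => h (Dot.base h')⟩
                  · simp [Prod.mk_le_mk]; omega
              obtain ⟨a', ha'⟩ := Option.ne_none_iff_exists'.1 hne
              refine ⟨d, a', rfl, by rw [hybrid_of_lt (by omega), ha'], ?_, ?_⟩
              · refine lt_of_le_of_ne (slide_le hT hcov ha' hf) ?_
                rintro rfl
                exact hl ⟨d, rfl, ha'⟩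
              · intro k' hk' a ha
                rw [hybrid_of_lt (by omega)] at ha
                exact hT' (i, k') (i + 1, d) (Prod.mk_lt_mk.2 (Or.inl ⟨by omega, by omega⟩)) a a' ha ha'

theorem KKnuth.hybrid_insert (hT : Increasing T) (hs : IsSkew T lam nu) (hC : IsMaxSet lam C)
    (hb : ∀ x ∈ nu, x.1 ≤ rm ∧ x.2 ≤ cm) {j c : ℕ} (hd : Dot T C (j, c)) :
    KKnuth (rowWord (Function.update (hybrid (slide T C) T j c) (j, c) (succMin T (j, c))) rm cm)
      (rowWord (Function.update (hybrid (slide T C) T j c) (j, c) none) rm cm) := by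
  cases hm : succMin T (j, c) with
  | none => exact KKnuth.refl _
  | some s =>
    have hnu : ∀ y v, T y = some v → y ∈ nu ∧ y ∉ lam := fun y v h =>
      (hs.ne_none_iff y).1 (by simp [h])
    have hbj := hb _ (hd.mem_nu hs hC)
    simp only at hbj
    by_cases hr : T (j, c + 1) = some s
    · exact KKnuth.update_dup_right hbj.1 (hb _ (hnu _ _ hr).1).2
        (by rw [hybrid_of_ge (by omega), hr])
    · have hbelow : T (j + 1, c) = some s := by
        obtain ⟨y, hy, hys⟩ := exists_of_succMin hm
        rcases covBy_iff_nat_prod.1 hy with rfl | rfl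
        · exact absurd hys hr
        · exact hys
      have hbs := hnu _ _ hbelow
      refine KKnuth.update_upper (hb _ hbs.1).1 hbj.2 (by rw [hybrid_of_ge (by omega), hbelow])
        ?_ ?_ ?_
      · intro k k' hk p q hp hq
        rw [hybrid_of_ge (by omega)] at hp hq
        exact hT (j + 1, k) (j + 1, k') (by simp [Prod.mk_lt_mk, hk]) p q hp hq
      · intro k hk p hp
        rw [hybrid_of_lt (by omega)] at hp
        rw [hybrid_of_ge (by omega)]
        have hcov : ((j, k) : ℕ × ℕ) ⋖ (j + 1, k) := covBy_iff_nat_prod.2 (Or.inr rfl)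
        have hne : T (j + 1, k) ≠ none := by
          refine (hs.ne_none_iff _).2 ⟨hs.pair.2.1 _ hbs.1 _ (by simp [Prod.mk_le_mk]; omega), ?_⟩
          intro hlam
          have h1 := hs.eq_none (hs.pair.1 _ hlam _ hcov.le)
          unfold slide at hp
          split_ifs at hp with h
          · exact h.notMem_of_lt hs hC hcov.lt hlam
          · simp [h1] at hp
        obtain ⟨p', hp'⟩ := Option.ne_none_iff_exists'.1 hne
        exact ⟨p', hp', slide_le hT hcov hp hp'⟩
      · by_cases hB : ∀ k, c < k → hybrid (slide T C) T j c (j + 1, k) = none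
        · exact Or.inl hB
        · right
          push Not at hB
          obtain ⟨k, hk, hkn⟩ := hB
          rw [hybrid_of_ge (by omega)] at hkn
          have hcov : ((j, c) : ℕ × ℕ) ⋖ (j, c + 1) := covBy_iff_nat_prod.2 (Or.inl rfl)
          have hne : T (j, c + 1) ≠ none := (hs.ne_none_iff _).2
            ⟨hs.pair.2.1 _ ((hs.ne_none_iff _).1 hkn).1 _ (by simp [Prod.mk_le_mk]; omega),
              hd.notMem_of_lt hs hC hcov.lt⟩
          obtain ⟨b, hb'⟩ := Option.ne_none_iff_exists'.1 hne
          refine ⟨(hb _ (hnu _ _ hb').1).2, b, by rw [hybrid_of_ge (by omega), hb'], ?_, ?_⟩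
          · obtain ⟨m, hm', hmb⟩ := succMin_le hcov hb'
            rw [hm, Option.some.injEq] at hm'
            subst hm'
            refine lt_of_le_of_ne hmb ?_
            rintro rfl
            exact hr hb'
          · intro k' hk' b' hb''
            rw [hybrid_of_ge (by omega)] at hb''
            exact hT (j, c + 1) (j + 1, k') (Prod.mk_lt_mk.2 (Or.inl ⟨by omega, by omega⟩)) b b' hb' hb''

theorem KKnuth.rowWord_slide (hT : Increasing T) (hs : IsSkew T lam nu) (hC : IsMaxSet lam C)
    (hb : ∀ x ∈ nu, x.1 ≤ rm ∧ x.2 ≤ cm) :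
    KKnuth (rowWord (slide T C) rm cm) (rowWord T rm cm) := by
  have hnone : ∀ x, x ∉ nu → T x = none ∧ slide T C x = none := by
    intro x hx
    constructor
    · by_contra h
      exact hx ((hs.ne_none_iff x).1 h).1
    · by_contra h
      exact hx (Finset.mem_filter.1 (((slide_isSkew hs hC).ne_none_iff x).1 h).1).1
  have step : ∀ j c, KKnuth (rowWord (hybrid (slide T C) T j (c + 1)) rm cm)
      (rowWord (hybrid (slide T C) T j c) rm cm) := by
    intro j c
    rw [hybrid_succ]
    suffices h : KKnuth
        (rowWord (Function.update (hybrid (slide T C) T j c) (j, c) (slide T C (j, c))) rm cm)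
        (rowWord (Function.update (hybrid (slide T C) T j c) (j, c) (T (j, c))) rm cm) by
      rwa [← hybrid_eq_update] at h
    by_cases hd : Dot T C (j, c)
    · have e : slide T C (j, c) = succMin T (j, c) := if_pos hd
      rw [e]
      exact (KKnuth.hybrid_insert hT hs hC hb hd).trans
        (KKnuth.hybrid_remove hT hs hC hb hd).symm
    · have e : slide T C (j, c) = T (j, c) := if_neg hd
      rw [e]
      exact KKnuth.refl _
  have row : ∀ j c, KKnuth (rowWord (hybrid (slide T C) T j c) rm cm)
      (rowWord (hybrid (slide T C) T j 0) rm cm) := by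
    intro j c
    induction c with
    | zero => exact KKnuth.refl _
    | succ c ih => exact (step j c).trans ih
  have next : ∀ j, hybrid (slide T C) T (j + 1) 0 = hybrid (slide T C) T j (cm + 1) := by
    intro j
    funext ⟨i, k⟩
    by_cases h : i = j ∧ cm < k
    · have := hnone (i, k) fun h' => by have := (hb _ h').2; simp only at this; omega
      rw [hybrid_of_lt (by omega), hybrid_of_ge (by omega), this.1, this.2]
    · unfold hybrid
      have : (i < j + 1 ∨ (i = j + 1 ∧ k < 0)) ↔ (i < j ∨ (i = j ∧ k < cm + 1)) := by omega
      simp only [this]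
  have all : ∀ j, KKnuth (rowWord (hybrid (slide T C) T j 0) rm cm) (rowWord T rm cm) := by
    intro j
    induction j with
    | zero =>
      have : hybrid (slide T C) T 0 0 = T := by
        funext ⟨i, k⟩
        exact hybrid_of_ge (by omega)
      rw [this]
      exact KKnuth.refl _
    | succ j ih =>
      rw [next]
      exact (row j _).trans ih
  have last : hybrid (slide T C) T (rm + 1) 0 = slide T C := by
    funext ⟨i, k⟩
    by_cases h : rm < i
    · have := hnone (i, k) fun h' => by have := (hb _ h').1; simp only at this; omega
      rw [hybrid_of_ge (by omega), this.1, this.2]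
    · exact hybrid_of_lt (by omega)
  have := all (rm + 1)
  rwa [last] at this

end

theorem rowWord_eq_of_boundedBy {T : ℕ × ℕ → Option ℤ} {rm cm rm' cm' : ℕ}
    (hb : BoundedBy T rm cm) (hr : rm ≤ rm') (hc : cm ≤ cm') :
    rowWord T rm' cm' = rowWord T rm cm := by
  have hrow : ∀ r, rowList T cm' r = rowList T cm r := by
    intro r
    rw [rowList_eq T r hc, rowList, ← rowLt, rowLt_succ]
    have h1 : rowGt T cm' r cm = [] := by
      by_contra hne
      obtain ⟨a, ha⟩ := List.exists_mem_of_ne_nil _ hne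
      obtain ⟨k, hk, hk'⟩ := mem_rowGt ha
      have := (hb (r, k) (by simp [hk'])).2
      simp only at this
      omega
    rw [h1, List.append_nil]
  have hrow' : rowList T cm' = rowList T cm := funext hrow
  rw [rowWord_eq_flatMap, rowWord_eq_flatMap, hrow', range_succ_eq hr, List.range_succ]
  have h2 : (List.range' (rm + 1) (rm' - rm)).reverse.flatMap (rowList T cm) = [] := by
    rw [List.flatMap_eq_nil_iff]
    intro r hr
    simp only [List.mem_reverse, List.mem_range'_1] at hr
    by_contra hne
    obtain ⟨a, ha⟩ := List.exists_mem_of_ne_nil _ hne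
    rw [rowList, ← rowLt] at ha
    obtain ⟨k, hk, hk'⟩ := mem_rowLt ha
    have := (hb (r, k) (by simp [hk'])).1
    simp only at this
    omega
  simp [h2]

theorem KKnuth.rowWord_of_slides {T T' : ℕ × ℕ → Option ℤ} (hT : IncreasingSkewTableau T)
    (h : Relation.ReflTransGen IsForwardSlide T T') :
    ∃ rm cm, ∀ rm' cm', rm ≤ rm' → cm ≤ cm' →
      KKnuth (rowWord T' rm' cm') (rowWord T rm' cm') := by
  induction h with
  | refl => exact ⟨0, 0, fun _ _ _ _ => KKnuth.refl _⟩
  | @tail A B hA hAB ih =>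
    obtain ⟨rm, cm, h⟩ := ih
    have hgA := hT.of_slides hA
    obtain ⟨lam, nu, C, hs, hC, rfl⟩ := (isForwardSlide_iff hgA.2).1 hAB
    refine ⟨max rm (nu.sup Prod.fst), max cm (nu.sup Prod.snd), fun rm' cm' hr hc => ?_⟩
    refine (KKnuth.rowWord_slide hgA.2 hs hC fun x hx => ⟨?_, ?_⟩).trans
      (h rm' cm' (le_trans (le_max_left _ _) hr) (le_trans (le_max_left _ _) hc))
    · exact le_trans (Finset.le_sup (f := Prod.fst) hx) (le_trans (le_max_right _ _) hr)
    · exact le_trans (Finset.le_sup (f := Prod.snd) hx) (le_trans (le_max_right _ _) hc)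

/-- Moving the boxes of each row `r` to the right by `o r` columns. -/
def shiftRows (o : ℕ → ℕ) (T : ℕ × ℕ → Option ℤ) (x : ℕ × ℕ) : Option ℤ :=
  if x.2 < o x.1 then none else T (x.1, x.2 - o x.1)

/-- The straight shape obtained by moving the boxes of each row `r` to the right by `o r` columns
and filling the vacated boxes, where `o` vanishes from row `R` on. -/
def shiftShape (R : ℕ) (o : ℕ → ℕ) (lam : Finset (ℕ × ℕ)) : Finset (ℕ × ℕ) :=
  ((Finset.range R ×ˢ Finset.range (o 0)).filter fun x => x.2 < o x.1) ∪
    lam.image fun x => (x.1, x.2 + o x.1)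

theorem mem_shiftShape {R : ℕ} {o : ℕ → ℕ} (ho : Antitone o) (hR : ∀ r, R ≤ r → o r = 0)
    {lam : Finset (ℕ × ℕ)} {r c : ℕ} :
    (r, c) ∈ shiftShape R o lam ↔ c < o r ∨ (r, c - o r) ∈ lam := by
  have h0 : o r ≤ o 0 := ho (Nat.zero_le r)
  have hr := hR r
  simp only [shiftShape, Finset.mem_union, Finset.mem_filter, Finset.mem_product, Finset.mem_range,
    Finset.mem_image, Prod.mk.injEq, Prod.exists]
  constructor
  · rintro (⟨-, h⟩ | ⟨a, b, hab, rfl, rfl⟩)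
    · exact Or.inl h
    · right
      simpa using hab
  · rintro (h | h)
    · left
      refine ⟨⟨?_, ?_⟩, h⟩ <;> by_contra <;> omega
    · by_cases hc : c < o r
      · left
        refine ⟨⟨?_, ?_⟩, hc⟩ <;> by_contra <;> omega
      · right
        exact ⟨r, c - o r, h, rfl, by omega⟩

theorem straightShape_shiftShape {R : ℕ} {o : ℕ → ℕ} (ho : Antitone o)
    (hR : ∀ r, R ≤ r → o r = 0) {lam : Finset (ℕ × ℕ)} (h : StraightShape lam) :
    StraightShape (shiftShape R o lam) := by
  rintro ⟨r, c⟩ ha ⟨r', c'⟩ hb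
  rw [Prod.mk_le_mk] at hb
  rw [mem_shiftShape ho hR] at ha ⊢
  have := ho hb.1
  by_cases h1 : c' < o r'
  · exact Or.inl h1
  · right
    rcases ha with ha | ha
    · omega
    · exact h _ ha _ (Prod.mk_le_mk.2 ⟨hb.1, by omega⟩)

section

variable {T : ℕ × ℕ → Option ℤ} {lam nu : Finset (ℕ × ℕ)} {o : ℕ → ℕ} {R : ℕ}

theorem shiftRows_isSkew (hs : IsSkew T lam nu) (ho : Antitone o) (hR : ∀ r, R ≤ r → o r = 0) :
    IsSkew (shiftRows o T) (shiftShape R o lam) (shiftShape R o nu) := by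
  refine ⟨⟨straightShape_shiftShape ho hR hs.pair.1, straightShape_shiftShape ho hR hs.pair.2.1,
    ?_⟩, ?_⟩
  · rintro ⟨r, c⟩
    rw [mem_shiftShape ho hR, mem_shiftShape ho hR]
    exact Or.imp_right fun h => hs.pair.2.2 h
  · ext ⟨r, c⟩
    simp only [shapeOf, Set.mem_ofPred_eq, Set.mem_sdiff, Finset.mem_coe, mem_shiftShape ho hR,
      shiftRows]
    have := hs.ne_none_iff (r, c - o r)
    split_ifs with h
    · simp [h]
    · simpa [h] using this

theorem shiftRows_increasing (hT : Increasing T) (ho : Antitone o) :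
    Increasing (shiftRows o T) := by
  rintro ⟨r, c⟩ ⟨r', c'⟩ hlt p q hp hq
  simp only [shiftRows] at hp hq
  split_ifs at hp hq with h1 h2
  rcases Prod.mk_lt_mk.1 hlt with ⟨h3, h4⟩ | ⟨h3, h4⟩
  · have := ho h3.le
    exact hT _ _ (Prod.mk_lt_mk.2 (Or.inl ⟨h3, by omega⟩)) p q hp hq
  · have := ho h3
    exact hT _ _ (Prod.mk_lt_mk.2 (Or.inr ⟨h3, by omega⟩)) p q hp hq

theorem exists_mem_iff_lt (h : StraightShape lam) (i : ℕ) : ∃ l, ∀ c, (i, c) ∈ lam ↔ c < l := by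
  have hex : ∃ c, (i, c) ∉ lam := by
    refine ⟨lam.sup Prod.snd + 1, fun hm => ?_⟩
    have := Finset.le_sup (f := Prod.snd) hm
    simp only at this
    omega
  refine ⟨Nat.find hex, fun c => ⟨fun hc => ?_, fun hc => ?_⟩⟩
  · by_contra hle
    exact Nat.find_spec hex (h _ hc _ (Prod.mk_le_mk.2 ⟨le_rfl, not_lt.1 hle⟩))
  · by_contra hm
    exact Nat.find_min hex hc hm

theorem isForwardSlide_shiftRows (hT : Increasing T) (hs : IsSkew T lam nu) (ho : Antitone o)
    (hR : ∀ r, R ≤ r → o r = 0) {i : ℕ} (hi : o (i + 1) < o i) :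
    IsForwardSlide (shiftRows o T) (shiftRows (Function.update o i (o i - 1)) T) := by
  set S := shiftRows o T with hSdef
  have hS := shiftRows_isSkew hs ho hR
  have hSi := shiftRows_increasing hT ho
  rw [← hSdef] at hS hSi
  obtain ⟨l, hl⟩ := exists_mem_iff_lt hs.pair.1 i
  set c0 := l + o i - 1 with hc0
  have hrow : ∀ c, o i ≤ c + 1 → S (i, c + 1) = T (i, c + 1 - o i) := by
    intro c hc
    simp only [hSdef, shiftRows]
    rw [if_neg (by omega)]
  have hmax : ∀ x ∈ shiftShape R o lam, ¬ (i, c0) < x := by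
    rintro ⟨r, c⟩ hx hlt
    rw [mem_shiftShape ho hR] at hx
    have hle := Prod.mk_le_mk.1 hlt.le
    rcases hle.1.eq_or_lt with rfl | h
    · rw [hl] at hx
      rcases Prod.mk_lt_mk.1 hlt with h' | h' <;> omega
    · have h1 := ho (Nat.succ_le_of_lt h)
      rcases hx with hx | hx
      · simp only [Nat.succ_eq_add_one] at h1; omega
      · have := (hl _).1 (hs.pair.1 _ hx (i, c - o r) (by simp [Prod.mk_le_mk]; omega))
        simp only [Nat.succ_eq_add_one] at h1; omega
  have hmem : (i, c0) ∈ shiftShape R o lam := by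
    rw [mem_shiftShape ho hR, hl]
    omega
  have hC : IsMaxSet (shiftShape R o lam) {(i, c0)} := by
    intro x hx
    rw [Finset.mem_singleton] at hx
    subst hx
    exact ⟨hmem, hmax⟩
  have hsucc : ∀ c, c0 ≤ c → succMin S (i, c) = S (i, c + 1) := by
    intro c hc
    have h1 : ∀ v, S (i + 1, c) = some v → ∃ w, S (i, c + 1) = some w ∧ w < v := by
      intro v hv
      rw [hrow c (by omega)]
      simp only [hSdef, shiftRows] at hv
      rw [if_neg (by intro h; simp [h] at hv)] at hv
      have hlt : ((i, c + 1 - o i) : ℕ × ℕ) < (i + 1, c - o (i + 1)) :=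
        Prod.mk_lt_mk.2 (Or.inl ⟨by omega, by omega⟩)
      have h2 := (hs.ne_none_iff _).1 (by rw [hv]; simp)
      have h3 : T (i, c + 1 - o i) ≠ none := (hs.ne_none_iff _).2
        ⟨hs.pair.2.1 _ h2.1 _ hlt.le, by rw [hl]; omega⟩
      obtain ⟨w, hw⟩ := Option.ne_none_iff_exists'.1 h3
      exact ⟨w, hw, hT _ _ hlt _ _ hw hv⟩
    unfold succMin
    cases h2 : S (i + 1, c) with
    | none => cases h3 : S (i, c + 1) <;> rfl
    | some v =>
      obtain ⟨w, hw, hwv⟩ := h1 v h2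
      simp [hw, optMin, hwv.le]
  have hdot : ∀ x, Dot S {(i, c0)} x → x.1 = i ∧ c0 ≤ x.2 := by
    intro x hx
    induction hx with
    | base h =>
      rw [Finset.mem_singleton] at h
      subst h
      exact ⟨rfl, le_rfl⟩
    | @step x y f _ hxy hy hx ih =>
      obtain ⟨r, c⟩ := x
      obtain ⟨rfl, hc⟩ := ih
      simp only at hc
      rw [hsucc c hc] at hx
      rcases covBy_iff_nat_prod.1 hxy with rfl | rfl
      · exact ⟨rfl, by simp only; omega⟩
      · exfalso
        have hi' : o (r + 1) < o r := hi
        simp only [hSdef, shiftRows] at hy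
        rw [if_neg (by intro h; simp [h] at hy)] at hy
        rw [hrow c (by omega)] at hx
        have := hT (r, c + 1 - o r) (r + 1, c - o (r + 1))
          (Prod.mk_lt_mk.2 (Or.inl ⟨by omega, by omega⟩)) f f hx hy
        omega
  have hdot' : ∀ d, S (i, c0 + d + 1) ≠ none → Dot S {(i, c0)} (i, c0 + d) := by
    intro d
    induction d with
    | zero => intro _; exact Dot.base (by simp)
    | succ d ih =>
      intro h
      have h1 : S (i, c0 + d + 1) ≠ none := by
        refine (hS.ne_none_iff _).2
          ⟨hS.pair.2.1 _ ((hS.ne_none_iff _).1 h).1 _ (by simp [Prod.mk_le_mk]), ?_⟩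
        intro hm
        exact hmax _ hm (by simp [Prod.mk_lt_mk])
      obtain ⟨f, hf⟩ := Option.ne_none_iff_exists'.1 h1
      exact (ih h1).step (covBy_iff_nat_prod.2 (Or.inl rfl)) hf
        (by rw [hsucc _ (by omega), hf])
  refine (isForwardSlide_iff hSi).2 ⟨_, _, _, hS, hC, ?_⟩
  funext ⟨r, c⟩
  by_cases hr : r = i
  · subst hr
    have e1 : shiftRows (Function.update o r (o r - 1)) T (r, c) =
        if c < o r - 1 then none else T (r, c - (o r - 1)) := by
      simp [shiftRows]
    rw [e1]
    unfold slide
    split_ifs with h1 hd hd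
    · have := (hdot _ hd).2
      simp only at this
      omega
    · simp only [hSdef, shiftRows]
      rw [if_pos (by omega)]
    · have := (hdot _ hd).2
      rw [hsucc c this, hrow c (by omega)]
      congr 2
      omega
    · by_cases hc : c < c0
      · have h2 : S (r, c) = none := hS.eq_none (hS.pair.1 _ hmem _ (by simp [Prod.mk_le_mk]; omega))
        rw [h2]
        exact hs.eq_none ((hl _).2 (by omega))
      · obtain ⟨d, rfl⟩ := Nat.exists_eq_add_of_le (not_lt.1 hc)
        have h2 : S (r, c0 + d + 1) = none := by
          by_contra h
          exact hd (hdot' d h)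
        have h3 : S (r, c0 + d) = none := by
          cases d with
          | zero => exact absurd (Dot.base (by simp)) hd
          | succ d =>
            by_contra h
            have h4 := hdot' d h
            obtain ⟨f, hf⟩ := Option.ne_none_iff_exists'.1 h
            exact hd (h4.step (covBy_iff_nat_prod.2 (Or.inl rfl)) hf
              (by rw [hsucc _ (by omega)]; exact hf))
        rw [h3, ← h2, hrow _ (by omega)]
        congr 2
        omega
  · have e1 : shiftRows (Function.update o i (o i - 1)) T (r, c) = S (r, c) := by
      simp [hSdef, shiftRows, Function.update_of_ne hr]
    rw [e1, slide, if_neg fun h => hr (hdot _ h).1]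

theorem shiftRows_slides (hT : Increasing T) (hs : IsSkew T lam nu) (ho : Antitone o)
    (hR : ∀ r, R ≤ r → o r = 0) :
    Relation.ReflTransGen IsForwardSlide (shiftRows o T) T := by
  induction hn : ∑ r ∈ Finset.range R, o r using Nat.strong_induction_on generalizing o with
  | _ n ih =>
  by_cases hz : ∀ r, o r = 0
  · have : shiftRows o T = T := by
      funext x
      simp [shiftRows, hz]
    rw [this]
  · push Not at hz
    obtain ⟨r, hr⟩ := hz
    have hex : ∃ i, o (i + 1) < o i := by
      by_contra hcon
      push Not at hcon
      have h1 : Monotone o := monotone_nat_of_le_succ hcon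
      have h2 := h1 (le_max_left r R)
      have h3 := hR _ (le_max_right r R)
      omega
    obtain ⟨i, hi⟩ := hex
    have hiR : i < R := by
      by_contra h
      have := hR i (by omega)
      omega
    have ho' : Antitone (Function.update o i (o i - 1)) := by
      refine antitone_nat_of_succ_le fun k => ?_
      have h1 := ho (Nat.le_succ k)
      simp only [Nat.succ_eq_add_one] at h1
      simp only [Function.update_apply]
      split_ifs with h2 h3 h3
      · omega
      · subst h2; omega
      · subst h3; omega
      · exact h1
    refine Relation.ReflTransGen.head (isForwardSlide_shiftRows hT hs ho hR hi)
      (ih _ ?_ ho' (fun k hk => ?_) rfl)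
    · rw [← hn]
      refine Finset.sum_lt_sum (fun k _ => ?_) ⟨i, Finset.mem_range.2 hiR, ?_⟩
      · rw [Function.update_apply]
        split_ifs with h
        · subst h; omega
        · exact le_rfl
      · rw [Function.update_self]
        omega
    · rw [Function.update_of_ne (by omega)]
      exact hR k hk

end

/-- The transposed tableau. -/
def transpose (T : ℕ × ℕ → Option ℤ) (x : ℕ × ℕ) : Option ℤ := T x.swap

theorem transpose_transpose (T : ℕ × ℕ → Option ℤ) : transpose (transpose T) = T := by
  funext x
  simp [transpose]

theorem optMin_comm (a b : Option ℤ) : optMin a b = optMin b a := by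
  cases a <;> cases b <;> simp [optMin, min_comm]

theorem succMin_transpose (T : ℕ × ℕ → Option ℤ) (x : ℕ × ℕ) :
    succMin (transpose T) x = succMin T x.swap := by
  simp [succMin, transpose, optMin_comm]

theorem swap_covBy_swap {x y : ℕ × ℕ} : x.swap ⋖ y.swap ↔ x ⋖ y := by
  rw [covBy_iff_nat_prod, covBy_iff_nat_prod]
  obtain ⟨a, b⟩ := x
  obtain ⟨c, d⟩ := y
  simp only [Prod.swap_prod_mk, Prod.mk.injEq]
  omega

section

variable {T : ℕ × ℕ → Option ℤ} {C lam nu : Finset (ℕ × ℕ)}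

theorem Dot.transpose {x : ℕ × ℕ} (h : Dot T C x) :
    Dot (transpose T) (C.image Prod.swap) x.swap := by
  induction h with
  | base h => exact Dot.base (Finset.mem_image_of_mem _ h)
  | step _ hxy hy hx ih =>
    refine ih.step (swap_covBy_swap.2 hxy) (by simpa [_root_.transpose] using hy) ?_
    rw [succMin_transpose, Prod.swap_swap, hx]

theorem mem_image_swap {C : Finset (ℕ × ℕ)} {x : ℕ × ℕ} :
    x ∈ C.image Prod.swap ↔ x.swap ∈ C := by
  obtain ⟨a, b⟩ := x
  simp

theorem image_swap_image_swap (C : Finset (ℕ × ℕ)) :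
    (C.image Prod.swap).image Prod.swap = C := by
  ext x
  rw [mem_image_swap, mem_image_swap, Prod.swap_swap]

theorem dot_transpose_iff {x : ℕ × ℕ} :
    Dot (transpose T) (C.image Prod.swap) x ↔ Dot T C x.swap := by
  constructor
  · intro h
    have := h.transpose
    rwa [transpose_transpose, image_swap_image_swap] at this
  · intro h
    simpa using h.transpose

theorem slide_transpose : slide (transpose T) (C.image Prod.swap) = transpose (slide T C) := by
  funext x
  simp only [slide, transpose, dot_transpose_iff]
  rw [← succMin_transpose]

theorem StraightShape.image_swap (h : StraightShape lam) :
    StraightShape (lam.image Prod.swap) := by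
  intro a ha b hb
  rw [mem_image_swap] at ha ⊢
  exact h _ ha _ (Prod.swap_le_swap.2 hb)

theorem IsSkew.transpose (h : IsSkew T lam nu) :
    IsSkew (transpose T) (lam.image Prod.swap) (nu.image Prod.swap) := by
  refine ⟨⟨h.pair.1.image_swap, h.pair.2.1.image_swap,
    Finset.image_subset_image h.pair.2.2⟩, ?_⟩
  ext x
  simp only [shapeOf, Set.mem_ofPred_eq, Set.mem_sdiff, Finset.mem_coe, mem_image_swap]
  exact h.ne_none_iff x.swap

theorem Increasing.transpose (h : Increasing T) : Increasing (transpose T) :=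
  fun a b hab p q hp hq => h a.swap b.swap (Prod.swap_lt_swap.2 hab) p q hp hq

theorem IsMaxSet.image_swap (h : IsMaxSet lam C) :
    IsMaxSet (lam.image Prod.swap) (C.image Prod.swap) := by
  intro c hc
  rw [mem_image_swap] at hc ⊢
  refine ⟨(h _ hc).1, fun d hd hlt => ?_⟩
  rw [mem_image_swap] at hd
  exact (h _ hc).2 _ hd (Prod.swap_lt_swap.2 hlt)

theorem IsForwardSlide.transpose {T' : ℕ × ℕ → Option ℤ} (hT : Increasing T)
    (h : IsForwardSlide T T') : IsForwardSlide (transpose T) (transpose T') := by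
  obtain ⟨lam, nu, C, hs, hC, rfl⟩ := (isForwardSlide_iff hT).1 h
  exact (isForwardSlide_iff hT.transpose).2
    ⟨_, _, _, hs.transpose, hC.image_swap, slide_transpose.symm⟩

theorem transpose_slides {T' : ℕ × ℕ → Option ℤ} (hT : IncreasingSkewTableau T)
    (h : Relation.ReflTransGen IsForwardSlide T T') :
    Relation.ReflTransGen IsForwardSlide (transpose T) (transpose T') := by
  induction h with
  | refl => exact Relation.ReflTransGen.refl
  | tail h h' ih => exact ih.tail (h'.transpose (hT.of_slides h).2)

theorem IncreasingSkewTableau.transpose (h : IncreasingSkewTableau T) :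
    IncreasingSkewTableau (transpose T) := by
  obtain ⟨lam, nu, hs⟩ := h.exists_isSkew
  exact hs.transpose.good h.2.transpose

theorem IncreasingSkewTableau.shiftRows {o : ℕ → ℕ} {R : ℕ} (h : IncreasingSkewTableau T)
    (ho : Antitone o) (hR : ∀ r, R ≤ r → o r = 0) : IncreasingSkewTableau (shiftRows o T) := by
  obtain ⟨lam, nu, hs⟩ := h.exists_isSkew
  exact (shiftRows_isSkew hs ho hR).good (shiftRows_increasing h.2 ho)

/-- Moving the boxes of each column `c` down by `o c` rows. -/
def shiftCols (o : ℕ → ℕ) (T : ℕ × ℕ → Option ℤ) : ℕ × ℕ → Option ℤ :=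
  transpose (shiftRows o (transpose T))

theorem IncreasingSkewTableau.shiftCols {o : ℕ → ℕ} {R : ℕ} (h : IncreasingSkewTableau T)
    (ho : Antitone o) (hR : ∀ r, R ≤ r → o r = 0) : IncreasingSkewTableau (shiftCols o T) :=
  (h.transpose.shiftRows ho hR).transpose

theorem IncreasingSkewTableau.shiftRows_slides {o : ℕ → ℕ} {R : ℕ} (h : IncreasingSkewTableau T)
    (ho : Antitone o) (hR : ∀ r, R ≤ r → o r = 0) :
    Relation.ReflTransGen IsForwardSlide (_root_.shiftRows o T) T := by
  obtain ⟨lam, nu, hs⟩ := h.exists_isSkew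
  exact _root_.shiftRows_slides h.2 hs ho hR

theorem IncreasingSkewTableau.shiftCols_slides {o : ℕ → ℕ} {R : ℕ} (h : IncreasingSkewTableau T)
    (ho : Antitone o) (hR : ∀ r, R ≤ r → o r = 0) :
    Relation.ReflTransGen IsForwardSlide (_root_.shiftCols o T) T := by
  have := transpose_slides (h.transpose.shiftRows ho hR) (h.transpose.shiftRows_slides ho hR)
  rwa [transpose_transpose] at this

/-- The entries of `S` form the word `w`, its `k`-th letter sitting in the box `p k`. -/
structure Enumerates (S : ℕ × ℕ → Option ℤ) (w : List ℤ) (p : ℕ → ℕ × ℕ) : Prop where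
  apply : ∀ k < w.length, S (p k) = w[k]?
  surj : ∀ x, S x ≠ none → ∃ k < w.length, p k = x

theorem Enumerates.unique {S S' : ℕ × ℕ → Option ℤ} {w : List ℤ} {p : ℕ → ℕ × ℕ}
    (h : Enumerates S w p) (h' : Enumerates S' w p) : S = S' := by
  funext x
  by_cases hx : ∃ k < w.length, p k = x
  · obtain ⟨k, hk, rfl⟩ := hx
    rw [h.apply k hk, h'.apply k hk]
  · have h1 : S x = none := by
      by_contra hn
      exact hx (h.surj x hn)
    have h2 : S' x = none := by
      by_contra hn
      exact hx (h'.surj x hn)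
    rw [h1, h2]

theorem Enumerates.congr {S : ℕ × ℕ → Option ℤ} {w : List ℤ} {p p' : ℕ → ℕ × ℕ}
    (h : Enumerates S w p) (hp : ∀ k < w.length, p k = p' k) : Enumerates S w p' := by
  refine ⟨fun k hk => by rw [← hp k hk, h.apply k hk], fun x hx => ?_⟩
  obtain ⟨k, hk, rfl⟩ := h.surj x hx
  exact ⟨k, hk, (hp k hk).symm⟩

theorem Enumerates.transpose {S : ℕ × ℕ → Option ℤ} {w : List ℤ} {p : ℕ → ℕ × ℕ}
    (h : Enumerates S w p) : Enumerates (transpose S) w (fun k => (p k).swap) := by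
  refine ⟨fun k hk => by simpa [_root_.transpose] using h.apply k hk, fun x hx => ?_⟩
  obtain ⟨k, hk, hk'⟩ := h.surj x.swap hx
  exact ⟨k, hk, by simp [hk']⟩

theorem Enumerates.shiftRows {S : ℕ × ℕ → Option ℤ} {w : List ℤ} {p : ℕ → ℕ × ℕ}
    (h : Enumerates S w p) (o : ℕ → ℕ) :
    Enumerates (shiftRows o S) w (fun k => ((p k).1, (p k).2 + o (p k).1)) := by
  refine ⟨fun k hk => by simpa [_root_.shiftRows] using h.apply k hk, fun x hx => ?_⟩
  unfold _root_.shiftRows at hx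
  split_ifs at hx with h1
  · exact absurd rfl hx
  · obtain ⟨k, hk, hk'⟩ := h.surj _ hx
    refine ⟨k, hk, ?_⟩
    rw [hk']
    exact Prod.ext rfl (by simp only; omega)

theorem Enumerates.shiftCols {S : ℕ × ℕ → Option ℤ} {w : List ℤ} {p : ℕ → ℕ × ℕ}
    (h : Enumerates S w p) (o : ℕ → ℕ) :
    Enumerates (shiftCols o S) w (fun k => ((p k).1 + o (p k).2, (p k).2)) :=
  (h.transpose.shiftRows o).transpose

end

/-- The tableau whose letters form the word `w` along an antidiagonal. -/
def diag (w : List ℤ) (x : ℕ × ℕ) : Option ℤ :=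
  if x.1 + x.2 + 1 = w.length then w[x.2]? else none

theorem diag_enumerates (w : List ℤ) :
    Enumerates (diag w) w (fun k => (w.length - 1 - k, k)) := by
  refine ⟨fun k hk => ?_, fun x hx => ?_⟩
  · rw [diag, if_pos]
    simp only
    omega
  · unfold diag at hx
    split_ifs at hx with h
    · exact ⟨x.2, by omega, Prod.ext (by simp only; omega) rfl⟩
    · exact absurd rfl hx

theorem diag_good (w : List ℤ) : IncreasingSkewTableau (diag w) := by
  have hs : IsSkew (diag w)
      ((Finset.range w.length ×ˢ Finset.range w.length).filter fun x => x.1 + x.2 + 1 < w.length)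
      ((Finset.range w.length ×ˢ Finset.range w.length).filter
        fun x => x.1 + x.2 + 1 ≤ w.length) := by
    refine ⟨⟨?_, ?_, ?_⟩, ?_⟩
    · rintro ⟨a, b⟩ h ⟨c, d⟩ h'
      simp only [Finset.mem_filter, Finset.mem_product, Finset.mem_range, Prod.mk_le_mk] at *
      omega
    · rintro ⟨a, b⟩ h ⟨c, d⟩ h'
      simp only [Finset.mem_filter, Finset.mem_product, Finset.mem_range, Prod.mk_le_mk] at *
      omega
    · rintro ⟨a, b⟩ h
      simp only [Finset.mem_filter, Finset.mem_product, Finset.mem_range] at *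
      omega
    · ext ⟨a, b⟩
      simp only [shapeOf, Set.mem_ofPred_eq, Set.mem_sdiff, Finset.mem_coe, Finset.mem_filter,
        Finset.mem_product, Finset.mem_range, diag]
      split_ifs with h
      · rw [List.getElem?_eq_getElem (by omega)]
        simp
        omega
      · simp
        omega
  refine hs.good ?_
  rintro ⟨a, b⟩ ⟨c, d⟩ hlt p q hp hq
  simp only [diag] at hp hq
  split_ifs at hp hq
  rcases Prod.mk_lt_mk.1 hlt with h | h <;> omega

theorem add_sub_le_of_strictMono {n : ℕ} {C : ℕ → ℕ} (hC : ∀ k k', k < k' → k' < n → C k < C k')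
    {k k' : ℕ} (h : k ≤ k') (h' : k' < n) : C k + (k' - k) ≤ C k' := by
  induction k', h using Nat.le_induction with
  | base => simp
  | succ m hm ih =>
    have h1 := ih (by omega)
    have h2 := hC m (m + 1) (by omega) h'
    omega

theorem spread_slides {w : List ℤ} {R C : ℕ → ℕ}
    (hR : ∀ k k', k < k' → k' < w.length → R k' < R k)
    (hC : ∀ k k', k < k' → k' < w.length → C k < C k')
    {P : ℕ × ℕ → Option ℤ} (hP : Enumerates P w (fun k => (R k, C k))) :
    Relation.ReflTransGen IsForwardSlide P (diag w) := by
  have hC1 : ∀ k k', k ≤ k' → k' < w.length → C k + (k' - k) ≤ C k' := fun k k' h h' =>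
    add_sub_le_of_strictMono hC h h'
  have hR1 : ∀ k k', k ≤ k' → k' < w.length → R k' + (k' - k) ≤ R k := by
    intro k k' h h'
    have := @add_sub_le_of_strictMono w.length (fun i => R (w.length - 1 - i))
      (fun i j hij hj => hR _ _ (by omega) (by omega)) (w.length - 1 - k') (w.length - 1 - k)
      (by omega) (by omega)
    rw [show w.length - 1 - (w.length - 1 - k') = k' by omega,
      show w.length - 1 - (w.length - 1 - k) = k by omega] at this
    omega
  set o : ℕ → ℕ := fun i =>
    if i < w.length then C (w.length - 1 - i) - (w.length - 1 - i) else 0 with hodef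
  have ho : Antitone o := by
    intro i i' hi
    simp only [hodef]
    split_ifs with h1 h2
    · have := hC1 (w.length - 1 - i') (w.length - 1 - i) (by omega) (by omega)
      omega
    · omega
    · omega
    · omega
  have ho0 : ∀ r, w.length ≤ r → o r = 0 := fun r hr => if_neg (by omega)
  set q : ℕ → ℕ := fun c =>
    ((Finset.range w.length).filter fun k => c ≤ C k).sup fun k => R k - (w.length - 1 - k)
    with hqdef
  have hq : Antitone q := by
    intro c c' hc
    refine Finset.sup_mono fun k hk => ?_
    rw [Finset.mem_filter] at hk ⊢
    exact ⟨hk.1, hc.trans hk.2⟩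
  have hq0 : ∀ r, (Finset.range w.length).sup C + 1 ≤ r → q r = 0 := by
    intro r hr
    simp only [hqdef]
    rw [Finset.filter_false_of_mem]
    · rfl
    · intro k hk
      have := Finset.le_sup (f := C) hk
      omega
  have hqC : ∀ k < w.length, q (C k) = R k - (w.length - 1 - k) := by
    intro k hk
    refine le_antisymm (Finset.sup_le fun k' hk' => ?_) ?_
    · rw [Finset.mem_filter, Finset.mem_range] at hk'
      have hkk : k ≤ k' := by
        by_contra h
        have := hC k' k (by omega) hk
        omega
      have := hR1 k k' hkk hk'.1
      omega
    · exact Finset.le_sup (f := fun k => R k - (w.length - 1 - k))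
        (Finset.mem_filter.2 ⟨Finset.mem_range.2 hk, le_rfl⟩)
  have hg := (diag_good w).shiftRows ho ho0
  have key : P = shiftCols q (shiftRows o (diag w)) := by
    refine hP.unique ((((diag_enumerates w).shiftRows o).shiftCols q).congr fun k hk => ?_)
    have e1 : k + o (w.length - 1 - k) = C k := by
      simp only [hodef]
      rw [if_pos (by omega), show w.length - 1 - (w.length - 1 - k) = k by omega]
      have := hC1 0 k (by omega) hk
      omega
    have e2 := hqC k hk
    have := hR1 k (w.length - 1) (by omega) (by omega)
    simp only [e1, e2, Prod.mk.injEq, and_true]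
    omega
  rw [key]
  exact (hg.shiftCols_slides hq hq0).trans ((diag_good w).shiftRows_slides ho ho0)

theorem exists_spread {S : ℕ × ℕ → Option ℤ} {w : List ℤ} {p : ℕ → ℕ × ℕ}
    (hS : IncreasingSkewTableau S) (h : Enumerates S w p)
    (hp : ∀ k k', k < k' → k' < w.length →
      (p k').1 < (p k).1 ∨ ((p k').1 = (p k).1 ∧ (p k).2 < (p k').2)) :
    ∃ P, IncreasingSkewTableau P ∧ Relation.ReflTransGen IsForwardSlide P S ∧
      Relation.ReflTransGen IsForwardSlide P (diag w) := by
  set M := (Finset.range w.length).sup fun k => (p k).1 with hM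
  set N := ((Finset.range w.length).sup fun k => (p k).2) + 1 with hN
  have hpM : ∀ k < w.length, (p k).1 ≤ M := fun k hk =>
    Finset.le_sup (f := fun k => (p k).1) (Finset.mem_range.2 hk)
  have hpN : ∀ k < w.length, (p k).2 < N := fun k hk =>
    Nat.lt_succ_of_le (Finset.le_sup (f := fun k => (p k).2) (Finset.mem_range.2 hk))
  have ho : Antitone fun i => (M - i) * N := fun i i' hi => Nat.mul_le_mul_right _ (by omega)
  have ho0 : ∀ r, M ≤ r → (fun i => (M - i) * N) r = 0 := fun r hr => by
    simp [Nat.sub_eq_zero_of_le hr]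
  set K := (M + 1) * N with hK
  have hq : Antitone fun c => K - c := fun i i' hi => by simp only; omega
  have hq0 : ∀ c, K ≤ c → (fun c => K - c) c = 0 := fun c hc => by simp only; omega
  have hC : ∀ k k', k < k' → k' < w.length →
      (p k).2 + (M - (p k).1) * N < (p k').2 + (M - (p k').1) * N := by
    intro k k' hk hk'
    rcases hp k k' hk hk' with h1 | ⟨h1, h2⟩
    · have h3 := hpN k (by omega)
      have h4 := hpM k (by omega)
      have h5 : (M - (p k).1 + 1) * N ≤ (M - (p k').1) * N := Nat.mul_le_mul_right _ (by omega)
      rw [Nat.add_mul] at h5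
      omega
    · rw [h1]
      omega
  have hCK : ∀ k < w.length, (p k).2 + (M - (p k).1) * N ≤ K := by
    intro k hk
    have h3 := hpN k hk
    have h5 : (M - (p k).1) * N ≤ M * N := Nat.mul_le_mul_right _ (by omega)
    rw [hK, Nat.add_mul]
    omega
  have hg := hS.shiftRows ho ho0
  refine ⟨_, hg.shiftCols hq hq0, (hg.shiftCols_slides hq hq0).trans (hS.shiftRows_slides ho ho0),
    spread_slides ?_ hC ((h.shiftRows _).shiftCols _)⟩
  intro k k' hk hk'
  have h1 := hC k k' hk hk'
  have h2 := hCK k' hk'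
  have h3 := hp k k' hk hk'
  simp only
  omega

/-- `X` and `Y` rectify to the same unique rectification targets. -/
def Linked (X Y : ℕ × ℕ → Option ℤ) : Prop :=
  ∀ U, IsURT U → (RectifiesTo X U ↔ RectifiesTo Y U)

theorem Linked.symm {X Y : ℕ × ℕ → Option ℤ} (h : Linked X Y) : Linked Y X :=
  fun U hU => (h U hU).symm

theorem Linked.trans {X Y Z : ℕ × ℕ → Option ℤ} (h : Linked X Y) (h' : Linked Y Z) :
    Linked X Z := fun U hU => (h U hU).trans (h' U hU)

theorem linked_of_slides {X Y : ℕ × ℕ → Option ℤ} (hX : IncreasingSkewTableau X)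
    (h : Relation.ReflTransGen IsForwardSlide X Y) : Linked X Y := by
  intro U hU
  constructor
  · intro hXU
    obtain ⟨V, hV⟩ := exists_rectifiesTo (hX.of_slides h)
    have := hU.2.2 X hX hXU V ⟨h.trans hV.1, hV.2⟩
    rwa [this] at hV
  · intro hYU
    exact ⟨h.trans hYU.1, hYU.2⟩

/-- The entries of `S` form the word `w` when read along rows from left to right, starting with the
bottom row. -/
def ReadsAs (S : ℕ × ℕ → Option ℤ) (w : List ℤ) : Prop :=
  ∃ L : List (ℕ × ℕ), L.Pairwise (fun x y => y.1 < x.1 ∨ (y.1 = x.1 ∧ x.2 < y.2)) ∧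
    (∀ x, S x ≠ none → x ∈ L) ∧ L.filterMap S = w

theorem ReadsAs.linked_diag {S : ℕ × ℕ → Option ℤ} {w : List ℤ} (hS : IncreasingSkewTableau S)
    (h : ReadsAs S w) : Linked S (diag w) := by
  obtain ⟨L0, hL0, hmem0, hw0⟩ := h
  obtain ⟨L, hL, hmem, hw⟩ : ∃ L : List (ℕ × ℕ),
      L.Pairwise (fun x y => y.1 < x.1 ∨ (y.1 = x.1 ∧ x.2 < y.2)) ∧
      (∀ x, S x ≠ none → x ∈ L) ∧ L.map S = w.map some := by
    refine ⟨L0.filter fun x => (S x).isSome, hL0.filter _, fun x hx => ?_, ?_⟩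
    · exact List.mem_filter.2 ⟨hmem0 x hx, Option.isSome_iff_ne_none.2 hx⟩
    · rw [← hw0]
      clear hL0 hmem0 hw0
      induction L0 with
      | nil => rfl
      | cons x L ih => cases hx : S x <;> simp [hx, ih]
  have hlen : L.length = w.length := by simpa using congrArg List.length hw
  have henum : Enumerates S w fun k => L.getD k (0, 0) := by
    refine ⟨fun k hk => ?_, fun x hx => ?_⟩
    · have := congrArg (fun l => l[k]?) hw
      simp only [List.getElem?_map] at this
      rw [List.getElem?_eq_getElem hk, List.getElem?_eq_getElem (by omega)] at this
      simp only [Option.map_some, Option.some.injEq] at this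
      rw [List.getElem?_eq_getElem hk, List.getD_eq_getElem _ _ (by omega), this]
    · obtain ⟨k, hk, hk'⟩ := List.mem_iff_getElem.1 (hmem x hx)
      exact ⟨k, by omega, by rw [List.getD_eq_getElem _ _ hk, hk']⟩
  obtain ⟨P, hP, h1, h2⟩ := exists_spread hS henum (by
    intro k k' hk hk'
    rw [List.getD_eq_getElem _ _ (by omega), List.getD_eq_getElem _ _ (by omega)]
    exact List.pairwise_iff_getElem.1 hL k k' (by omega) (by omega) hk)
  exact (linked_of_slides hP h1).symm.trans (linked_of_slides hP h2)

theorem readsAs_rowWord {T : ℕ × ℕ → Option ℤ} {rm cm : ℕ} (hb : BoundedBy T rm cm) :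
    ReadsAs T (rowWord T rm cm) := by
  refine ⟨(List.range (rm + 1)).reverse.flatMap fun r => (List.range (cm + 1)).map fun c => (r, c),
    ?_, ?_, ?_⟩
  · rw [List.pairwise_flatMap]
    constructor
    · intro r _
      rw [List.pairwise_map]
      exact List.pairwise_lt_range.imp fun h => Or.inr ⟨rfl, h⟩
    · rw [List.pairwise_reverse]
      refine List.pairwise_lt_range.imp fun h x hx y hy => Or.inl ?_
      simp only [List.mem_map] at hx hy
      obtain ⟨_, _, rfl⟩ := hx
      obtain ⟨_, _, rfl⟩ := hy
      exact h
  · rintro ⟨r, c⟩ hx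
    have := hb _ hx
    simp only [List.mem_flatMap, List.mem_reverse, List.mem_range, List.mem_map, Prod.mk.injEq]
    exact ⟨r, by omega, c, by omega, rfl, rfl⟩
  · rw [List.filterMap_flatMap]
    simp only [List.filterMap_map]
    rfl

theorem optMin_none_right (z : Option ℤ) : optMin z none = z := by cases z <;> rfl

/-- The effect of a forward slide on a two by two square with an empty upper left corner. -/
theorem slide_square {S : ℕ × ℕ → Option ℤ} {h m : ℕ} {p q : ℤ} {z : Option ℤ}
    (h01 : S (h, m + 1) = some p) (h10 : S (h + 1, m) = some q) (h11 : S (h + 1, m + 1) = z)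
    (h02 : S (h, m + 2) = none) (h20 : S (h + 2, m) = none) (h12 : S (h + 1, m + 2) = none)
    (h21 : S (h + 2, m + 1) = none) :
    slide S {(h, m)} = fun x =>
      if x = (h, m) then some (min p q)
      else if x = (h, m + 1) then (if p ≤ q then z else some p)
      else if x = (h + 1, m) then (if q ≤ p then z else some q)
      else if x = (h + 1, m + 1) then none
      else S x := by
  have s00 : succMin S (h, m) = some (min p q) := by simp only [succMin, h01, h10, optMin]
  have s01 : succMin S (h, m + 1) = z := by simp only [succMin, h02, h11, optMin]
  have s10 : succMin S (h + 1, m) = z := by simp only [succMin, h20, h11, optMin_none_right]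
  have s11 : succMin S (h + 1, m + 1) = none := by simp only [succMin, h12, h21, optMin]
  have d00 : Dot S {(h, m)} (h, m) := .base (Finset.mem_singleton_self _)
  have hdot : ∀ x, Dot S {(h, m)} x → x = (h, m) ∨ (x = (h, m + 1) ∧ p ≤ q) ∨
      (x = (h + 1, m) ∧ q ≤ p) ∨ (x = (h + 1, m + 1) ∧ z ≠ none) := by
    intro x hx
    induction hx with
    | base hx => exact Or.inl (Finset.mem_singleton.1 hx)
    | @step x y f _ hxy hy hf ih =>
      rcases ih with rfl | ⟨rfl, hpq⟩ | ⟨rfl, hpq⟩ | ⟨rfl, hz⟩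
      · rw [s00, Option.some.injEq] at hf
        rcases covBy_iff_nat_prod.1 hxy with rfl | rfl
        · rw [h01, Option.some.injEq] at hy
          exact Or.inr (Or.inl ⟨rfl, by omega⟩)
        · rw [h10, Option.some.injEq] at hy
          exact Or.inr (Or.inr (Or.inl ⟨rfl, by omega⟩))
      · rcases covBy_iff_nat_prod.1 hxy with rfl | rfl
        · exact absurd (h02.symm.trans hy) (by simp)
        · exact Or.inr (Or.inr (Or.inr ⟨rfl, by rw [← h11]; simp [hy]⟩))
      · rcases covBy_iff_nat_prod.1 hxy with rfl | rfl
        · exact Or.inr (Or.inr (Or.inr ⟨rfl, by rw [← h11]; simp [hy]⟩))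
        · exact absurd (h20.symm.trans hy) (by simp)
      · rw [s11] at hf
        exact absurd hf (by simp)
  have d01 : p ≤ q → Dot S {(h, m)} (h, m + 1) := fun hpq =>
    .step d00 (covBy_iff_nat_prod.2 (Or.inl rfl)) h01 (by rw [s00, min_eq_left hpq])
  have d10 : q ≤ p → Dot S {(h, m)} (h + 1, m) := fun hpq =>
    .step d00 (covBy_iff_nat_prod.2 (Or.inr rfl)) h10 (by rw [s00, min_eq_right hpq])
  have d11 : ∀ t, z = some t → Dot S {(h, m)} (h + 1, m + 1) := by
    intro t ht
    rcases le_total p q with hpq | hpq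
    · exact .step (d01 hpq) (covBy_iff_nat_prod.2 (Or.inr rfl)) (h11.trans ht) (s01.trans ht)
    · exact .step (d10 hpq) (covBy_iff_nat_prod.2 (Or.inl rfl)) (h11.trans ht) (s10.trans ht)
  funext x
  unfold slide
  by_cases e00 : x = (h, m)
  · subst e00
    rw [if_pos d00, if_pos rfl, s00]
  rw [if_neg e00]
  by_cases e01 : x = (h, m + 1)
  · subst e01
    rw [if_pos rfl]
    by_cases hpq : p ≤ q
    · rw [if_pos (d01 hpq), if_pos hpq, s01]
    · rw [if_neg hpq, if_neg, h01]
      intro hd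
      simpa [hpq] using hdot _ hd
  rw [if_neg e01]
  by_cases e10 : x = (h + 1, m)
  · subst e10
    rw [if_pos rfl]
    by_cases hpq : q ≤ p
    · rw [if_pos (d10 hpq), if_pos hpq, s10]
    · rw [if_neg hpq, if_neg, h10]
      intro hd
      simpa [hpq] using hdot _ hd
  rw [if_neg e10]
  by_cases e11 : x = (h + 1, m + 1)
  · subst e11
    rw [if_pos rfl]
    split_ifs with hd
    · exact s11
    · rw [h11]
      cases z with
      | none => rfl
      | some t => exact absurd (d11 t rfl) hd
  rw [if_neg e11, if_neg]
  intro hd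
  simpa [e00, e01, e10, e11] using hdot _ hd

/-- A two by two square placed between the antidiagonals carrying the words `u` and `v`. -/
def blockTab (u v : List ℤ) (x00 x01 x10 x11 : Option ℤ) (x : ℕ × ℕ) : Option ℤ :=
  if x.2 < u.length then
    (if x.1 + x.2 = u.length + v.length + 1 then u[x.2]? else none)
  else if u.length + 2 ≤ x.2 then
    (if x.1 + x.2 = u.length + v.length + 1 then v[x.2 - (u.length + 2)]? else none)
  else if x.1 = v.length then (if x.2 = u.length then x00 else x01)
  else if x.1 = v.length + 1 then (if x.2 = u.length then x10 else x11)
  else none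

theorem filterMap_range_getElem? (l : List ℤ) :
    (List.range l.length).filterMap (fun k => l[k]?) = l := by
  induction l with
  | nil => rfl
  | cons a l ih =>
    rw [List.length_cons, List.range_succ_eq_map, List.filterMap_cons, List.filterMap_map]
    simpa using ih

theorem filterMap_congr_mem {α β : Type} {f g : α → Option β} {l : List α}
    (h : ∀ x ∈ l, f x = g x) : l.filterMap f = l.filterMap g := by
  induction l with
  | nil => rfl
  | cons a l ih =>
    rw [List.filterMap_cons, List.filterMap_cons, h a (by simp), ih fun x hx => h x (by simp [hx])]

theorem readsAs_blockTab (u v : List ℤ) (x00 x01 x10 x11 : Option ℤ) :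
    ReadsAs (blockTab u v x00 x01 x10 x11)
      (u ++ (x10.toList ++ x11.toList ++ x00.toList ++ x01.toList) ++ v) := by
  refine ⟨(List.range u.length).map (fun k => (v.length + 1 + u.length - k, k)) ++
    [(v.length + 1, u.length), (v.length + 1, u.length + 1), (v.length, u.length),
      (v.length, u.length + 1)] ++
    (List.range v.length).map (fun j => (v.length - 1 - j, u.length + 2 + j)), ?_, ?_, ?_⟩
  · rw [List.pairwise_append, List.pairwise_append, List.pairwise_map, List.pairwise_map]
    refine ⟨⟨?_, ?_, ?_⟩, ?_, ?_⟩
    · refine List.pairwise_lt_range.imp_of_mem fun ha hb h => Or.inl ?_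
      rw [List.mem_range] at ha hb
      simp only
      omega
    · simp
    · intro x hx y hy
      simp only [List.mem_map, List.mem_range] at hx
      obtain ⟨k, hk, rfl⟩ := hx
      simp only [List.mem_cons, List.not_mem_nil, or_false] at hy
      rcases hy with rfl | rfl | rfl | rfl <;> simp only <;> omega
    · refine List.pairwise_lt_range.imp_of_mem fun ha hb h => Or.inl ?_
      rw [List.mem_range] at ha hb
      simp only
      omega
    · intro x hx y hy
      simp only [List.mem_map, List.mem_range] at hy
      obtain ⟨k, hk, rfl⟩ := hy
      simp only [List.mem_append, List.mem_map, List.mem_range, List.mem_cons, List.not_mem_nil,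
        or_false] at hx
      rcases hx with ⟨j, hj, rfl⟩ | rfl | rfl | rfl | rfl <;> simp only <;> omega
  · rintro ⟨r, c⟩ hx
    simp only [List.mem_append, List.mem_map, List.mem_range, List.mem_cons, List.not_mem_nil,
      or_false, Prod.mk.injEq]
    unfold blockTab at hx
    simp only at hx
    split_ifs at hx
    · exact Or.inl (Or.inl ⟨c, by omega, by omega, rfl⟩)
    · exact absurd rfl hx
    · have : c - (u.length + 2) < v.length := by
        by_contra hn
        exact hx (List.getElem?_eq_none (by omega))
      exact Or.inr ⟨c - (u.length + 2), this, by omega, by omega⟩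
    · exact absurd rfl hx
    · exact Or.inl (Or.inr (by omega))
    · exact Or.inl (Or.inr (by omega))
    · exact Or.inl (Or.inr (by omega))
    · exact Or.inl (Or.inr (by omega))
    · exact absurd rfl hx
  · rw [List.filterMap_append, List.filterMap_append, List.filterMap_map, List.filterMap_map]
    congr 1
    · congr 1
      · conv_rhs => rw [← filterMap_range_getElem? u]
        refine filterMap_congr_mem fun k hk => ?_
        rw [List.mem_range] at hk
        simp only [Function.comp, blockTab]
        rw [if_pos hk, if_pos (by omega)]
      · have e10 : blockTab u v x00 x01 x10 x11 (v.length + 1, u.length) = x10 := by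
          simp [blockTab]
        have e11 : blockTab u v x00 x01 x10 x11 (v.length + 1, u.length + 1) = x11 := by
          simp [blockTab]
        have e00 : blockTab u v x00 x01 x10 x11 (v.length, u.length) = x00 := by
          simp [blockTab]
        have e01 : blockTab u v x00 x01 x10 x11 (v.length, u.length + 1) = x01 := by
          simp [blockTab]
        simp only [List.filterMap_cons, e10, e11, e00, e01, List.filterMap_nil]
        cases x10 <;> cases x11 <;> cases x00 <;> cases x01 <;> rfl
    · conv_rhs => rw [← filterMap_range_getElem? v]
      refine filterMap_congr_mem fun k hk => ?_
      rw [List.mem_range] at hk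
      simp only [Function.comp, blockTab]
      rw [if_neg (by omega), if_pos (by omega), if_pos (by omega)]
      congr 1
      omega

theorem blockTab_isSkew (u v : List ℤ) (p q : ℤ) (z : Option ℤ) :
    IsSkew (blockTab u v none (some p) (some q) z)
      ((Finset.range (u.length + v.length + 3) ×ˢ Finset.range (u.length + v.length + 3)).filter
        fun x => x.1 + x.2 ≤ u.length + v.length)
      ((Finset.range (u.length + v.length + 3) ×ˢ Finset.range (u.length + v.length + 3)).filter
        fun x => x.1 + x.2 ≤ u.length + v.length + 1 ∨
          (z ≠ none ∧ x.1 = v.length + 1 ∧ x.2 = u.length + 1)) := by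
  refine ⟨⟨?_, ?_, ?_⟩, ?_⟩
  · rintro ⟨a, b⟩ h ⟨c, d⟩ h'
    simp only [Finset.mem_filter, Finset.mem_product, Finset.mem_range, Prod.mk_le_mk] at *
    omega
  · rintro ⟨a, b⟩ h ⟨c, d⟩ h'
    simp only [Finset.mem_filter, Finset.mem_product, Finset.mem_range, Prod.mk_le_mk] at *
    by_cases hz : z = none
    · simp only [hz, ne_eq, not_true_eq_false, false_and, or_false] at *
      omega
    · simp only [hz, ne_eq, not_false_eq_true, true_and] at *
      omega
  · rintro ⟨a, b⟩ h
    simp only [Finset.mem_filter, Finset.mem_product, Finset.mem_range] at *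
    exact ⟨h.1, Or.inl (by omega)⟩
  · ext ⟨r, c⟩
    simp only [shapeOf, Set.mem_ofPred_eq, Set.mem_sdiff, Finset.mem_coe, Finset.mem_filter,
      Finset.mem_product, Finset.mem_range, blockTab]
    by_cases hz : z = none
    all_goals
      simp only [hz, ne_eq, not_true_eq_false, not_false_eq_true, true_and, false_and, or_false]
      split_ifs
    all_goals
      try rw [List.getElem?_eq_none_iff]
      try simp only [not_true_eq_false, not_false_eq_true, true_iff, false_iff, hz]
      try omega

theorem blockTab_slide (u v : List ℤ) {p q : ℤ} {z : Option ℤ}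
    (hz : ∀ t, z = some t → p < t ∧ q < t) :
    IncreasingSkewTableau (blockTab u v none (some p) (some q) z) ∧
    IsForwardSlide (blockTab u v none (some p) (some q) z)
      (blockTab u v (some (min p q)) (if p ≤ q then z else some p) (if q ≤ p then z else some q)
        none) := by
  have hs := blockTab_isSkew u v p q z
  set S := blockTab u v none (some p) (some q) z with hS
  have h01 : S (v.length, u.length + 1) = some p := by simp [hS, blockTab]
  have h10 : S (v.length + 1, u.length) = some q := by simp [hS, blockTab]
  have h11 : S (v.length + 1, u.length + 1) = z := by simp [hS, blockTab]
  have hinc : Increasing S := by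
    refine increasing_of_covBy hs fun x y hxy a b ha hb => ?_
    have hx := (hs.ne_none_iff x).1 (by simp [ha])
    have hy := (hs.ne_none_iff y).1 (by simp [hb])
    obtain ⟨r, c⟩ := x
    obtain ⟨r', c'⟩ := y
    rw [covBy_iff_nat_prod] at hxy
    simp only [Finset.mem_filter, Finset.mem_product, Finset.mem_range, Prod.mk.injEq] at hx hy hxy
    have hy' : r' = v.length + 1 ∧ c' = u.length + 1 := by
      rcases hy.1.2 with h | h
      · omega
      · exact h.2
    obtain ⟨rfl, rfl⟩ := hy'
    have := hz b (h11.symm.trans hb)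
    rcases hxy with ⟨h1, h2⟩ | ⟨h1, h2⟩
    · obtain ⟨rfl, rfl⟩ : r = v.length + 1 ∧ c = u.length := by omega
      rw [h10, Option.some.injEq] at ha
      omega
    · obtain ⟨rfl, rfl⟩ : r = v.length ∧ c = u.length + 1 := by omega
      rw [h01, Option.some.injEq] at ha
      omega
  refine ⟨hs.good hinc, (isForwardSlide_iff hinc).2
    ⟨_, _, {(v.length, u.length)}, hs, ?_, ?_⟩⟩
  · intro x hx
    rw [Finset.mem_singleton] at hx
    subst hx
    refine ⟨?_, ?_⟩
    · simp only [Finset.mem_filter, Finset.mem_product, Finset.mem_range]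
      omega
    · rintro ⟨r, c⟩ hd hlt
      simp only [Finset.mem_filter, Finset.mem_product, Finset.mem_range] at hd
      rcases Prod.mk_lt_mk.1 hlt with h | h <;> omega
  · have h02 : S (v.length, u.length + 2) = none := by
      simp only [hS, blockTab]
      rw [if_neg (by omega), if_pos le_rfl, if_neg (by omega)]
    have h12 : S (v.length + 1, u.length + 2) = none := by
      simp only [hS, blockTab]
      rw [if_neg (by omega), if_pos le_rfl, if_neg (by omega)]
    rw [slide_square h01 h10 h11 h02 (by simp [hS, blockTab]) h12 (by simp [hS, blockTab])]
    funext ⟨r, c⟩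
    simp only [Prod.mk.injEq]
    by_cases e00 : r = v.length ∧ c = u.length
    · obtain ⟨rfl, rfl⟩ := e00
      simp [blockTab]
    rw [if_neg e00]
    by_cases e01 : r = v.length ∧ c = u.length + 1
    · obtain ⟨rfl, rfl⟩ := e01
      simp [blockTab]
    rw [if_neg e01]
    by_cases e10 : r = v.length + 1 ∧ c = u.length
    · obtain ⟨rfl, rfl⟩ := e10
      simp [blockTab]
    rw [if_neg e10]
    by_cases e11 : r = v.length + 1 ∧ c = u.length + 1
    · obtain ⟨rfl, rfl⟩ := e11
      simp [blockTab]
    rw [if_neg e11]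
    simp only [hS, blockTab]
    split_ifs <;> first | rfl | omega

theorem linked_diag_square (u v : List ℤ) {p q : ℤ} {z : Option ℤ}
    (hz : ∀ t, z = some t → p < t ∧ q < t) :
    Linked (diag (u ++ (q :: (z.toList ++ [p])) ++ v))
      (diag (u ++ ((if q ≤ p then z else some q).toList ++
        (min p q :: (if p ≤ q then z else some p).toList)) ++ v)) := by
  obtain ⟨hgood, hslide⟩ := blockTab_slide u v hz
  have h1 := (readsAs_blockTab u v none (some p) (some q) z).linked_diag hgood
  have h2 := (readsAs_blockTab u v _ _ _ _).linked_diag (hgood.of_slide hslide)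
  have h := h1.symm.trans ((linked_of_slides hgood (.single hslide)).trans h2)
  simpa using h

theorem KKnuthStep.linked_diag {w w' : List ℤ} (h : KKnuthStep w w') :
    Linked (diag w) (diag w') := by
  have aba : ∀ (u v : List ℤ) (a b : ℤ), a < b →
      Linked (diag (u ++ [a, b, a] ++ v)) (diag (u ++ [b, a, b] ++ v)) := by
    intro u v a b hab
    have := linked_diag_square u v (p := a) (q := a) (z := some b)
      (by intro t ht; cases ht; exact ⟨hab, hab⟩)
    simpa using this
  cases h with
  | dup u v a =>
    have := linked_diag_square u v (p := a) (q := a) (z := none) (by simp)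
    simpa using this
  | aba u v a b =>
    rcases lt_trichotomy a b with h | rfl | h
    · exact aba u v a b h
    · exact fun U _ => Iff.rfl
    · exact (aba u v b a h).symm
  | acb u v a b c h1 h2 =>
    have := linked_diag_square u v (p := b) (q := a) (z := some c)
      (by intro t ht; cases ht; omega)
    simpa [h1.le, h1.not_ge] using this.symm
  | bac u v a b c h1 h2 =>
    have := linked_diag_square u v (p := c) (q := a) (z := some b)
      (by intro t ht; cases ht; omega)
    simpa [h1.le, h1.not_ge] using this

theorem KKnuth.linked_diag {w w' : List ℤ} (h : KKnuth w w') : Linked (diag w) (diag w') := by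
  induction h with
  | rel _ _ h => exact h.linked_diag
  | refl _ => exact fun U _ => Iff.rfl
  | symm _ _ _ ih => exact ih.symm
  | trans _ _ _ _ _ ih1 ih2 => exact ih1.trans ih2

theorem HasStraightShape.exists_boundedBy {T : ℕ × ℕ → Option ℤ} (h : HasStraightShape T) :
    ∃ rm cm, BoundedBy T rm cm := by
  obtain ⟨nu, -, hnu⟩ := h
  refine ⟨nu.sup Prod.fst, nu.sup Prod.snd, fun x hx => ?_⟩
  have hx' : x ∈ nu := by
    have := Set.ext_iff.1 hnu x
    simpa [shapeOf, hx] using this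
  exact ⟨Finset.le_sup (f := Prod.fst) hx', Finset.le_sup (f := Prod.snd) hx'⟩

theorem urt_iff_kknuth_unique_typeA
    (T : ℕ × ℕ → Option ℤ) (hsh : HasStraightShape T) (hinc : Increasing T)
    (rm cm : ℕ) (hb : BoundedBy T rm cm) :
    IsURT T ↔
      ∀ (T' : ℕ × ℕ → Option ℤ) (rm' cm' : ℕ),
        HasStraightShape T' → Increasing T' → BoundedBy T' rm' cm' →
        KKnuth (rowWord T' rm' cm') (rowWord T rm cm) → T' = T := by
  constructor
  · intro hU T' rm' cm' hsh' hinc' hb' hk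
    have h1 := (readsAs_rowWord hb').linked_diag (hsh'.good hinc')
    have h2 := (readsAs_rowWord hb).linked_diag (hsh.good hinc)
    have h := h1.trans (hk.linked_diag.trans h2.symm)
    exact hU.2.2 T' (hsh'.good hinc') ((h T hU).2 ⟨.refl, hsh⟩) T' ⟨.refl, hsh'⟩
  · intro hu
    refine ⟨hsh, hinc, fun X hX hXT U hXU => ?_⟩
    obtain ⟨r1, c1, h1⟩ := KKnuth.rowWord_of_slides hX hXT.1
    obtain ⟨r2, c2, h2⟩ := KKnuth.rowWord_of_slides hX hXU.1
    obtain ⟨r3, c3, hb3⟩ := hXU.2.exists_boundedBy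
    obtain ⟨r, hr1, hr2, hr3, hr⟩ : ∃ r, r1 ≤ r ∧ r2 ≤ r ∧ r3 ≤ r ∧ rm ≤ r :=
      ⟨r1 + r2 + r3 + rm, by omega, by omega, by omega, by omega⟩
    obtain ⟨c, hc1, hc2, hc3, hc⟩ : ∃ c, c1 ≤ c ∧ c2 ≤ c ∧ c3 ≤ c ∧ cm ≤ c :=
      ⟨c1 + c2 + c3 + cm, by omega, by omega, by omega, by omega⟩
    refine hu U r3 c3 hXU.2 (hX.of_slides hXU.1).2 hb3 ?_
    rw [← rowWord_eq_of_boundedBy hb3 hr3 hc3, ← rowWord_eq_of_boundedBy hb hr hc]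
    exact (h2 r c hr2 hc2).trans (h1 r c hr1 hc1).symm
end
end

section
/- If T and T′ are jeu de taquin equivalent increasing tableaux of type A, then their Hecke permutations coincide: w(T) = w(T′). In particular, the Hecke permutation of an increasing tableau of type A is invariant under forward and reverse jeu de taquin slides. -/
open Classical

noncomputable section

/-- The length (number of inversions) of a finitely supported permutation of `ℤ`. -/
def heckeLen (w : Equiv.Perm ℤ) : ℕ :=
  Set.ncard {p : ℤ × ℤ | p.1 < p.2 ∧ w p.2 < w p.1}

/-- The Hecke product `u · s_i`. -/
def heckeStep (u : Equiv.Perm ℤ) (i : ℤ) : Equiv.Perm ℤ :=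
  if heckeLen u < heckeLen (u * Equiv.swap i (i + 1)) then u * Equiv.swap i (i + 1) else u

/-- The Hecke permutation `w(a) = s_{a_1} · s_{a_2} · … · s_{a_k}` of a word. -/
def heckeWord (a : List ℤ) : Equiv.Perm ℤ := a.foldl heckeStep 1

/-- The inversions of a permutation of `ℤ`. -/
def invSet (w : Equiv.Perm ℤ) : Set (ℤ × ℤ) := {p | p.1 < p.2 ∧ w p.2 < w p.1}

/-- Right multiplication by `s_i` whenever the entries in positions `i`, `i + 1` increase. -/
def bubble (i : ℤ) (u : Equiv.Perm ℤ) : Equiv.Perm ℤ :=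
  if u i < u (i + 1) then u * Equiv.swap i (i + 1) else u

lemma swap_lt_swap {i x y : ℤ} (h : x < y) (hne : ¬ (x = i ∧ y = i + 1)) :
    Equiv.swap i (i + 1) x < Equiv.swap i (i + 1) y := by
  simp only [Equiv.swap_apply_def]
  split_ifs <;> omega

lemma invSet_mul_swap (u : Equiv.Perm ℤ) (i : ℤ) (h : u i < u (i + 1)) :
    invSet (u * Equiv.swap i (i + 1)) =
      insert (i, i + 1)
        (Prod.map (Equiv.swap i (i + 1)) (Equiv.swap i (i + 1)) '' invSet u) := by
  ext ⟨x, y⟩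
  simp only [invSet, Set.mem_insert_iff, Set.mem_image, Set.mem_ofPred_eq, Prod.map_apply,
    Prod.mk.injEq, Prod.exists, Equiv.Perm.mul_apply]
  constructor
  · rintro ⟨hxy, hu⟩
    by_cases hne : x = i ∧ y = i + 1
    · exact Or.inl hne
    · exact Or.inr ⟨_, _, ⟨swap_lt_swap hxy hne, hu⟩, by simp, by simp⟩
  · rintro (⟨rfl, rfl⟩ | ⟨a, b, ⟨hab, hu⟩, rfl, rfl⟩)
    · simpa using h
    · have hne : ¬ (a = i ∧ b = i + 1) := by
        rintro ⟨rfl, rfl⟩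
        exact absurd hu (not_lt.mpr h.le)
      exact ⟨swap_lt_swap hab hne, by simpa using hu⟩

lemma invSet_finite_mul_swap {u : Equiv.Perm ℤ} (hu : (invSet u).Finite) {i : ℤ}
    (h : u i < u (i + 1)) : (invSet (u * Equiv.swap i (i + 1))).Finite := by
  rw [invSet_mul_swap u i h]
  exact (hu.image _).insert _

lemma heckeLen_mul_swap {u : Equiv.Perm ℤ} (hu : (invSet u).Finite) {i : ℤ}
    (h : u i < u (i + 1)) : heckeLen (u * Equiv.swap i (i + 1)) = heckeLen u + 1 := by
  change (invSet _).ncard = (invSet u).ncard + 1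
  rw [invSet_mul_swap u i h, Set.ncard_insert_of_notMem _ (hu.image _),
    Set.ncard_image_of_injective]
  · exact (Equiv.injective _).prodMap (Equiv.injective _)
  · rintro ⟨⟨a, b⟩, ⟨hab, -⟩, hp⟩
    simp only [Prod.map_apply, Prod.mk.injEq, Equiv.swap_apply_eq_iff, Equiv.swap_apply_left,
      Equiv.swap_apply_right] at hp
    simp only at hab
    omega

lemma bubble_finite {u : Equiv.Perm ℤ} (hu : (invSet u).Finite) (i : ℤ) :
    (invSet (bubble i u)).Finite := by
  unfold bubble
  split_ifs with h
  · exact invSet_finite_mul_swap hu h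
  · exact hu

lemma heckeStep_eq_bubble {u : Equiv.Perm ℤ} (hu : (invSet u).Finite) (i : ℤ) :
    heckeStep u i = bubble i u := by
  unfold heckeStep bubble
  by_cases h : u i < u (i + 1)
  · rw [if_pos h, heckeLen_mul_swap hu h, if_pos (Nat.lt_succ_self _)]
  · rw [if_neg h, if_neg]
    have hne : u i ≠ u (i + 1) := fun e => by simpa using u.injective e
    set v := u * Equiv.swap i (i + 1) with hv
    have hvu : v * Equiv.swap i (i + 1) = u := by simp [hv, mul_assoc]
    have hlt : v i < v (i + 1) := by
      simp only [hv, Equiv.Perm.mul_apply, Equiv.swap_apply_left, Equiv.swap_apply_right]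
      omega
    have hfin : (invSet v).Finite := by
      by_contra hinf
      refine hinf (Set.Finite.of_finite_image (f := Prod.map (Equiv.swap i (i + 1))
        (Equiv.swap i (i + 1))) (hu.subset ?_)
        (((Equiv.injective _).prodMap (Equiv.injective _)).injOn))
      rw [← hvu, invSet_mul_swap v i hlt]
      exact Set.subset_insert _ _
    have := heckeLen_mul_swap hfin hlt
    rw [hvu] at this
    omega

lemma bubble_bubble (i : ℤ) (u : Equiv.Perm ℤ) : bubble i (bubble i u) = bubble i u := by
  rcases lt_or_ge (u i) (u (i + 1)) with h | h
  · simp [bubble, h, h.not_gt]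
  · simp [bubble, h.not_gt]

lemma bubble_comm {i j : ℤ} (hij : i + 2 ≤ j) (u : Equiv.Perm ℤ) :
    bubble i (bubble j u) = bubble j (bubble i u) := by
  have e1 : Equiv.swap j (j + 1) i = i := Equiv.swap_apply_of_ne_of_ne (by omega) (by omega)
  have e2 : Equiv.swap j (j + 1) (i + 1) = i + 1 :=
    Equiv.swap_apply_of_ne_of_ne (by omega) (by omega)
  have e3 : Equiv.swap i (i + 1) j = j := Equiv.swap_apply_of_ne_of_ne (by omega) (by omega)
  have e4 : Equiv.swap i (i + 1) (j + 1) = j + 1 :=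
    Equiv.swap_apply_of_ne_of_ne (by omega) (by omega)
  have e5 : Equiv.swap i (i + 1) * Equiv.swap j (j + 1) =
      Equiv.swap j (j + 1) * Equiv.swap i (i + 1) := by
    ext x
    simp only [Equiv.Perm.mul_apply, Equiv.swap_apply_def]
    split_ifs <;> omega
  by_cases h : u i < u (i + 1) <;> by_cases h' : u j < u (j + 1) <;>
    simp [bubble, h, h', e1, e2, e3, e4, mul_assoc, e5]

lemma bubble_braid (i : ℤ) (u : Equiv.Perm ℤ) :
    bubble i (bubble (i + 1) (bubble i u)) =
      bubble (i + 1) (bubble i (bubble (i + 1) u)) := by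
  have e1 : Equiv.swap i (i + 1) (i + 1 + 1) = i + 1 + 1 :=
    Equiv.swap_apply_of_ne_of_ne (by omega) (by omega)
  have e2 : Equiv.swap (i + 1) (i + 1 + 1) i = i :=
    Equiv.swap_apply_of_ne_of_ne (by omega) (by omega)
  have e3 : Equiv.swap i (i + 1) * (Equiv.swap (i + 1) (i + 1 + 1) * Equiv.swap i (i + 1)) =
      Equiv.swap (i + 1) (i + 1 + 1) *
        (Equiv.swap i (i + 1) * Equiv.swap (i + 1) (i + 1 + 1)) := by
    ext x
    simp only [Equiv.Perm.mul_apply, Equiv.swap_apply_def]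
    split_ifs <;> omega
  have n1 : u i ≠ u (i + 1) := fun e => by simpa using u.injective e
  have n2 : u (i + 1) ≠ u (i + 1 + 1) := fun e => by simpa using u.injective e
  have n3 : u i ≠ u (i + 1 + 1) := fun e => by
    have := u.injective e
    omega
  rcases lt_or_gt_of_ne n1 with h1 | h1 <;> rcases lt_or_gt_of_ne n2 with h2 | h2 <;>
    rcases lt_or_gt_of_ne n3 with h3 | h3 <;>
    first
    | (exfalso; omega)
    | simp [bubble, h1, h2, h3, h1.not_gt, h2.not_gt, h3.not_gt, e1, e2, e3, mul_assoc]

/-- The relations of the 0-Hecke monoid for a family indexed by `ℤ`. -/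
structure HeckeRel {M : Type*} [Monoid M] (s : ℤ → M) : Prop where
  idem : ∀ i, s i * s i = s i
  comm : ∀ i j, i + 2 ≤ j → Commute (s i) (s j)
  braid : ∀ i, s i * s (i + 1) * s i = s (i + 1) * s i * s (i + 1)

/-- `bubble` as a family in the opposite of the monoid of self-maps of permutations. -/
def bubbleOp (i : ℤ) : (Function.End (Equiv.Perm ℤ))ᵐᵒᵖ := MulOpposite.op (bubble i)

lemma heckeRel_bubbleOp : HeckeRel bubbleOp where
  idem i := MulOpposite.unop_injective (funext fun u => bubble_bubble i u)
  comm _ _ h := MulOpposite.unop_injective (funext fun u => (bubble_comm h u).symm)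
  braid i := MulOpposite.unop_injective (funext fun u => bubble_braid i u)

lemma foldl_heckeStep (l : List ℤ) (u : Equiv.Perm ℤ) (hu : (invSet u).Finite) :
    l.foldl heckeStep u = (l.map bubbleOp).prod.unop u := by
  induction l generalizing u with
  | nil => rfl
  | cons i l ih =>
    rw [List.foldl_cons, heckeStep_eq_bubble hu, ih _ (bubble_finite hu i)]
    rfl

lemma heckeWord_eq (l : List ℤ) : heckeWord l = (l.map bubbleOp).prod.unop 1 := by
  refine foldl_heckeStep l 1 ?_
  convert Set.finite_empty
  ext p
  simp only [invSet, Equiv.Perm.one_apply, Set.mem_ofPred_eq, Set.mem_empty_iff_false, iff_false]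
  omega


/-- The position of an entry in the total order on `ℤ ∪ {•}` in which the dot lies
immediately before `k`. -/
def dotRank (k : ℤ) : ZDot → ℤ :=
  Sum.elim (fun x => if x < k then x else x + 1) fun _ => k

@[simp] lemma dotRank_inr (k : ℤ) (u : Unit) : dotRank k (Sum.inr u) = k := rfl

lemma dotRank_inl (k x : ℤ) : dotRank k (Sum.inl x) = if x < k then x else x + 1 := rfl

lemma dotRank_injective (k : ℤ) : Function.Injective (dotRank k) := by
  rintro (x | x) (y | y) h <;> simp only [dotRank_inl, dotRank_inr] at h
  · congr 1
    split_ifs at h <;> omega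
  · split_ifs at h <;> omega
  · split_ifs at h <;> omega
  · rfl

/-- A dotted tableau that increases along covers when the dot is placed before `k`. -/
def DotIncreasing {L : Type} [PartialOrder L] (k : ℤ) (V : L → Option ZDot) : Prop :=
  ∀ p q, p ⋖ q → ∀ x y, V p = some x → V q = some y → dotRank k x < dotRank k y

section SwapVal

variable {L : Type} [PartialOrder L]

/-- The operation `swap_{k,•}`. -/
def dotSwap (k : ℤ) (V : L → Option ZDot) : L → Option ZDot :=
  swapVal (Sum.inl k) (Sum.inr ()) V

lemma Neighbor.symm {p q : L} (h : Neighbor p q) : Neighbor q p := Or.symm h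

variable {k : ℤ} {V : L → Option ZDot} {p q : L}

lemma dotSwap_of_dot (hp : V p = some (Sum.inr ())) (hq : V q = some (Sum.inl k))
    (hpq : Neighbor p q) : dotSwap k V p = some (Sum.inl k) := by
  have : ∃ β, Neighbor p β ∧ V β = some (Sum.inl k) := ⟨q, hpq, hq⟩
  simp [dotSwap, swapVal, hp, this]

lemma dotSwap_of_val (hp : V p = some (Sum.inl k)) (hq : V q = some (Sum.inr ()))
    (hpq : Neighbor p q) : dotSwap k V p = some (Sum.inr ()) := by
  have : ∃ β, Neighbor p β ∧ V β = some (Sum.inr ()) := ⟨q, hpq, hq⟩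
  simp [dotSwap, swapVal, hp, this]

lemma dotSwap_of_ne {x : ZDot} (hp : V p = some x) (hk : x ≠ Sum.inl k) (hd : x ≠ Sum.inr ()) :
    dotSwap k V p = some x := by
  simp [dotSwap, swapVal, hp, hk, hd]

lemma dotSwap_eq_some {x : ZDot} (h : dotSwap k V p = some x) :
    V p = some x ∨
      (V p = some (Sum.inl k) ∧ x = Sum.inr () ∧ ∃ q, Neighbor p q ∧ V q = some (Sum.inr ())) ∨
      (V p = some (Sum.inr ()) ∧ x = Sum.inl k ∧ ∃ q, Neighbor p q ∧ V q = some (Sum.inl k)) := by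
  unfold dotSwap swapVal at h
  split_ifs at h with h1 h2
  · exact Or.inr (Or.inl ⟨h1.1, (Option.some.inj h).symm, h1.2⟩)
  · exact Or.inr (Or.inr ⟨h2.1, (Option.some.inj h).symm, h2.2⟩)
  · exact Or.inl h

lemma dotSwap_eq_none : dotSwap k V p = none ↔ V p = none := by
  unfold dotSwap swapVal
  split_ifs with h1 h2
  · simp [h1.1]
  · simp [h2.1]
  · rfl

lemma shapeOf_dotSwap : shapeOf (dotSwap k V) = shapeOf V := by
  ext p
  exact not_congr dotSwap_eq_none

lemma dotSwap_eq_val {x : ℤ} (hx : x ≠ k) :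
    dotSwap k V p = some (Sum.inl x) ↔ V p = some (Sum.inl x) := by
  constructor
  · intro h
    rcases dotSwap_eq_some h with h | ⟨-, h, -⟩ | ⟨-, h, -⟩
    · exact h
    · cases h
    · exact absurd (Sum.inl.inj h) hx
  · intro h
    exact dotSwap_of_ne h (by simpa using hx) (by simp)

lemma exists_of_dotSwap_eq_val {x : ℤ} (h : dotSwap k V p = some (Sum.inl x)) :
    ∃ q, V q = some (Sum.inl x) := by
  rcases dotSwap_eq_some h with h | ⟨-, h, -⟩ | ⟨-, h, q, -, hq⟩
  · exact ⟨p, h⟩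
  · cases h
  · exact ⟨q, h ▸ hq⟩

lemma DotIncreasing.ne_of_neighbor (hV : DotIncreasing k V) (hpq : Neighbor p q) {x : ZDot}
    (hp : V p = some x) : V q ≠ some x := by
  intro hq
  rcases hpq with h | h
  · exact lt_irrefl _ (hV p q h x x hp hq)
  · exact lt_irrefl _ (hV q p h x x hq hp)

lemma dotSwap_dotSwap {j : ℤ} (hV : DotIncreasing j V) : dotSwap k (dotSwap k V) = V := by
  funext p
  rcases hp : V p with _ | (x | ⟨⟨⟩⟩)
  · rw [dotSwap_eq_none, dotSwap_eq_none, hp]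
  · by_cases hx : x = k
    · subst hx
      by_cases hn : ∃ q, Neighbor p q ∧ V q = some (Sum.inr ())
      · obtain ⟨q, hpq, hq⟩ := hn
        exact dotSwap_of_dot (dotSwap_of_val hp hq hpq) (dotSwap_of_dot hq hp hpq.symm) hpq
      · have h1 : dotSwap x V p = some (Sum.inl x) := by
          simp [dotSwap, swapVal, hp, hn]
        have h2 : ¬ ∃ q, Neighbor p q ∧ dotSwap x V q = some (Sum.inr ()) := by
          rintro ⟨q, hpq, hq⟩
          rcases dotSwap_eq_some hq with h | ⟨h, -, -⟩ | ⟨-, h, -⟩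
          · exact hn ⟨q, hpq, h⟩
          · exact hV.ne_of_neighbor hpq hp h
          · cases h
        rw [dotSwap, swapVal, h1]
        simp [h2]
    · rw [dotSwap_eq_val hx, dotSwap_eq_val hx, hp]
  · by_cases hn : ∃ q, Neighbor p q ∧ V q = some (Sum.inl k)
    · obtain ⟨q, hpq, hq⟩ := hn
      exact dotSwap_of_val (dotSwap_of_dot hp hq hpq) (dotSwap_of_val hq hp hpq.symm) hpq
    · have h1 : dotSwap k V p = some (Sum.inr ()) := by
        simp [dotSwap, swapVal, hp, hn]
      have h2 : ¬ ∃ q, Neighbor p q ∧ dotSwap k V q = some (Sum.inl k) := by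
        rintro ⟨q, hpq, hq⟩
        rcases dotSwap_eq_some hq with h | ⟨-, h, -⟩ | ⟨h, -, -⟩
        · exact hn ⟨q, hpq, h⟩
        · cases h
        · exact hV.ne_of_neighbor hpq hp h
      rw [dotSwap, swapVal, h1]
      simp [h2]

lemma DotIncreasing.dotSwap (hV : DotIncreasing k V) : DotIncreasing (k + 1) (dotSwap k V) := by
  intro p q hpq x y hx hy
  have key : V p = some (Sum.inr ()) → V q = some (Sum.inl k) →
      x = Sum.inl k ∧ y = Sum.inr () := by
    intro hp hq
    rw [dotSwap_of_dot hp hq (Or.inl hpq)] at hx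
    rw [dotSwap_of_val hq hp (Or.inr hpq)] at hy
    exact ⟨(Option.some.inj hx).symm, (Option.some.inj hy).symm⟩
  have hlt := hV p q hpq
  rcases x with x | ⟨⟨⟩⟩ <;> rcases y with y | ⟨⟨⟩⟩ <;>
    rcases dotSwap_eq_some hx with h1 | ⟨h1, e1, -⟩ | ⟨h1, e1, -⟩ <;>
    rcases dotSwap_eq_some hy with h2 | ⟨h2, e2, -⟩ | ⟨h2, e2, -⟩ <;>
    specialize hlt _ _ h1 h2 <;> simp_all [dotRank_inl] <;> split_ifs at hlt ⊢ <;> omega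

lemma DotIncreasing.dotSwap_down (hV : DotIncreasing (k + 1) V) :
    DotIncreasing k (_root_.dotSwap k V) := by
  intro p q hpq x y hx hy
  have key : V p = some (Sum.inl k) → V q = some (Sum.inr ()) →
      x = Sum.inr () ∧ y = Sum.inl k := by
    intro hp hq
    rw [dotSwap_of_val hp hq (Or.inl hpq)] at hx
    rw [dotSwap_of_dot hq hp (Or.inr hpq)] at hy
    exact ⟨(Option.some.inj hx).symm, (Option.some.inj hy).symm⟩
  have hlt := hV p q hpq
  rcases x with x | ⟨⟨⟩⟩ <;> rcases y with y | ⟨⟨⟩⟩ <;>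
    rcases dotSwap_eq_some hx with h1 | ⟨h1, e1, -⟩ | ⟨h1, e1, -⟩ <;>
    rcases dotSwap_eq_some hy with h2 | ⟨h2, e2, -⟩ | ⟨h2, e2, -⟩ <;>
    specialize hlt _ _ h1 h2 <;> simp_all [dotRank_inl] <;> split_ifs at hlt ⊢ <;> omega

end SwapVal


lemma covBy_right (i c : ℕ) : ((i, c) : ℕ × ℕ) ⋖ (i, c + 1) :=
  Prod.mk_covBy_mk_iff.mpr (Or.inr ⟨Order.covBy_add_one c, rfl⟩)

lemma covBy_below (i c : ℕ) : ((i, c) : ℕ × ℕ) ⋖ (i + 1, c) :=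
  Prod.mk_covBy_mk_iff.mpr (Or.inl ⟨Order.covBy_add_one i, rfl⟩)

lemma covBy_cases {p q : ℕ × ℕ} (h : p ⋖ q) : q = (p.1, p.2 + 1) ∨ q = (p.1 + 1, p.2) := by
  obtain ⟨i, c⟩ := p
  obtain ⟨j, d⟩ := q
  rcases Prod.mk_covBy_mk_iff.mp h with ⟨h1, h2⟩ | ⟨h1, h2⟩ <;>
    rw [Order.covBy_iff_add_one_eq] at h1 <;> simp [h1, h2]

/-- A dotted tableau in the course of a slide: its support is convex, and it increases when
the dot is placed before `k`. -/
structure DotTableau (k : ℤ) (V : ℕ × ℕ → Option ZDot) : Prop where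
  inc : DotIncreasing k V
  conv : (shapeOf V).OrdConnected

namespace DotTableau

variable {k : ℤ} {V : ℕ × ℕ → Option ZDot}

lemma dotSwap (hV : DotTableau k V) : DotTableau (k + 1) (dotSwap k V) :=
  ⟨hV.inc.dotSwap, by rw [shapeOf_dotSwap]; exact hV.conv⟩

lemma dotSwap_down (hV : DotTableau (k + 1) V) : DotTableau k (_root_.dotSwap k V) :=
  ⟨hV.inc.dotSwap_down, by rw [shapeOf_dotSwap]; exact hV.conv⟩

lemma exists_between (hV : DotTableau k V) {p q r : ℕ × ℕ} {x y : ZDot} (hp : V p = some x)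
    (hq : V q = some y) (hpr : p ≤ r) (hrq : r ≤ q) : ∃ z, V r = some z := by
  refine Option.ne_none_iff_exists'.mp (hV.conv.out (x := p) (y := q) ?_ ?_ ⟨hpr, hrq⟩)
  · simp [shapeOf, hp]
  · simp [shapeOf, hq]

variable {i c c' : ℕ} {x y : ZDot}

lemma rank_add_le (hV : DotTableau k V) {d : ℕ} (hx : V (i, c) = some x)
    (hy : V (i, c + d) = some y) : dotRank k x + d ≤ dotRank k y := by
  induction d generalizing y with
  | zero =>
    rw [Nat.add_zero, hx] at hy
    simp [Option.some.inj hy]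
  | succ d ih =>
    obtain ⟨z, hz⟩ := hV.exists_between hx hy (r := (i, c + d))
      (Prod.mk_le_mk.mpr ⟨le_rfl, by omega⟩) (Prod.mk_le_mk.mpr ⟨le_rfl, by omega⟩)
    have h1 := ih hz
    have h2 := hV.inc _ _ (covBy_right i (c + d)) _ _ hz hy
    push_cast
    omega

lemma lt_of_rank_lt (hV : DotTableau k V) (hx : V (i, c) = some x) (hy : V (i, c') = some y)
    (h : dotRank k x < dotRank k y) : c < c' := by
  by_contra hc
  obtain ⟨d, rfl⟩ := Nat.exists_eq_add_of_le (not_lt.mp hc)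
  have := hV.rank_add_le hy hx
  omega

lemma rank_lt_of_lt (hV : DotTableau k V) (hx : V (i, c) = some x) (hy : V (i, c') = some y)
    (h : c < c') : dotRank k x < dotRank k y := by
  obtain ⟨d, rfl⟩ := Nat.exists_eq_add_of_le h.le
  have := hV.rank_add_le hx hy
  omega

lemma eq_succ_of_rank (hV : DotTableau k V) (hx : V (i, c) = some x) (hy : V (i, c') = some y)
    (h : dotRank k y = dotRank k x + 1) : c' = c + 1 := by
  obtain ⟨d, rfl⟩ := Nat.exists_eq_add_of_le (hV.lt_of_rank_lt hx hy (by omega)).le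
  have := hV.rank_add_le hx hy
  have : d ≠ 0 := by
    rintro rfl
    rw [Nat.add_zero, hx] at hy
    rw [Option.some.inj hy] at h
    omega
  omega

lemma eq_of_rank (hV : DotTableau k V) {p q r : ℕ × ℕ} {z : ZDot} (hpr : p ⋖ r) (hrq : r ⋖ q)
    (hx : V p = some x) (hy : V q = some y) (h : dotRank k x + 1 = dotRank k z)
    (h' : dotRank k z + 1 = dotRank k y) : V r = some z := by
  obtain ⟨w, hw⟩ := hV.exists_between hx hy hpr.le hrq.le
  have h1 := hV.inc _ _ hpr _ _ hx hw
  have h2 := hV.inc _ _ hrq _ _ hw hy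
  rw [hw, dotRank_injective k (show dotRank k w = dotRank k z by omega)]

end DotTableau

/-- Row `i` contains the entry `x`. -/
def RowHas (V : ℕ × ℕ → Option ZDot) (x : ZDot) (i : ℕ) : Prop := ∃ c, V (i, c) = some x

/-- Row `i` contains a dot lying immediately above the entry `k`. -/
def DotOver (k : ℤ) (V : ℕ × ℕ → Option ZDot) (i : ℕ) : Prop :=
  ∃ c, V (i, c) = some (Sum.inr ()) ∧ V (i + 1, c) = some (Sum.inl k)

lemma DotOver.rowHas {k : ℤ} {V : ℕ × ℕ → Option ZDot} {i : ℕ} (h : DotOver k V i) :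
    RowHas V (Sum.inl k) (i + 1) := h.imp fun _ => And.right

lemma rowHas_dotSwap {k x : ℤ} (hx : x ≠ k) {V : ℕ × ℕ → Option ZDot} {i : ℕ} :
    RowHas (dotSwap k V) (Sum.inl x) i ↔ RowHas V (Sum.inl x) i :=
  exists_congr fun _ => dotSwap_eq_val hx

namespace DotTableau

variable {k : ℤ} {V : ℕ × ℕ → Option ZDot} {i : ℕ}

lemma rowHas_dotSwap_of_dotOver (h : DotOver k V i) :
    RowHas (_root_.dotSwap k V) (Sum.inl k) i := by
  obtain ⟨c, h1, h2⟩ := h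
  exact ⟨c, dotSwap_of_dot h1 h2 (Or.inl (covBy_below i c))⟩

lemma dotOver_dotSwap_of_rowHas (hV : DotTableau k V) (hd : DotOver k V i)
    (hm : RowHas V (Sum.inl k) i) (he : RowHas V (Sum.inl (k + 1)) (i + 1)) :
    DotOver (k + 1) (_root_.dotSwap k V) i := by
  obtain ⟨c, h1, h2⟩ := hd
  obtain ⟨c1, hm⟩ := hm
  obtain ⟨c2, he⟩ := he
  obtain rfl := hV.eq_succ_of_rank h1 hm (by simp [dotRank_inl])
  obtain rfl := hV.eq_succ_of_rank h2 he (by simp [dotRank_inl])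
  exact ⟨c + 1, dotSwap_of_val hm h1 (Or.inr (covBy_right i c)),
    (dotSwap_eq_val (by omega)).mpr he⟩

lemma not_rowHas_below (hV : DotTableau k V) (hd : DotOver k V i)
    (hm : ¬ RowHas V (Sum.inl k) i) : ¬ RowHas V (Sum.inl (k + 1)) (i + 1) := by
  rintro ⟨c2, he⟩
  obtain ⟨c, h1, h2⟩ := hd
  obtain rfl := hV.eq_succ_of_rank h2 he (by simp [dotRank_inl])
  exact hm ⟨c + 1, hV.eq_of_rank (covBy_right i c) (covBy_below i (c + 1)) h1 he
    (by simp [dotRank_inl]) (by simp [dotRank_inl])⟩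

lemma rowHas_of_rowHas_dotSwap (hd : ¬ DotOver k V i) (hV : DotTableau k V)
    (hm : RowHas (_root_.dotSwap k V) (Sum.inl k) i) : RowHas V (Sum.inl k) i := by
  obtain ⟨c, hm⟩ := hm
  rcases dotSwap_eq_some hm with h | ⟨-, h, -⟩ | ⟨hc, -, q, hq | hq, hqk⟩
  · exact ⟨c, h⟩
  · cases h
  · rcases covBy_cases hq with rfl | rfl
    · exact ⟨_, hqk⟩
    · exact absurd ⟨c, hc, hqk⟩ hd
  · have := hV.inc _ _ hq _ _ hqk hc
    simp [dotRank_inl] at this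

lemma not_dotOver_dotSwap (hd : ¬ DotOver k V i) (hV : DotTableau k V)
    (hm : RowHas (_root_.dotSwap k V) (Sum.inl k) i) :
    ¬ DotOver (k + 1) (_root_.dotSwap k V) i := by
  rintro ⟨c', h1, h2⟩
  obtain ⟨c, hm⟩ := hm
  obtain rfl := hV.dotSwap.eq_succ_of_rank hm h1 (by simp [dotRank_inl])
  have h2' := (dotSwap_eq_val (by omega)).mp h2
  have hlt := hV.inc _ _ (covBy_right i c)
  have hc : V (i, c) = some (Sum.inr ()) ∧ V (i, c + 1) = some (Sum.inl k) := by
    rcases dotSwap_eq_some hm with a | ⟨-, a, -⟩ | ⟨a, -, -⟩ <;>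
      rcases dotSwap_eq_some h1 with b | ⟨b, -, -⟩ | ⟨-, b, -⟩ <;>
      first
      | cases a
      | cases b
      | exact ⟨a, b⟩
      | (have := hlt _ _ a b
         simp [dotRank_inl] at this
         try omega)
  exact hd ⟨c, hc.1, hV.eq_of_rank (covBy_below i c) (covBy_right (i + 1) c) hc.1 h2'
    (by simp [dotRank_inl]) (by simp [dotRank_inl])⟩

/-- If row `i` loses its entry `k`, then this entry moves up from below a dot and is not
preceded by a dot in its row. -/
lemma vacated (hV : DotTableau k V) (hm : RowHas V (Sum.inl k) i)
    (hm' : ¬ RowHas (_root_.dotSwap k V) (Sum.inl k) i) :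
    ∃ j, i = j + 1 ∧ DotOver k V j ∧ ¬ RowHas V (Sum.inl (k - 1)) j := by
  obtain ⟨c, hc⟩ := hm
  have hleft : ∀ c', c = c' + 1 → V (i, c') ≠ some (Sum.inr ()) := by
    rintro c' rfl h
    exact hm' ⟨c', dotSwap_of_dot h hc (Or.inl (covBy_right i c'))⟩
  have hn : ∃ q, Neighbor (i, c) q ∧ V q = some (Sum.inr ()) := by
    by_contra hn
    exact hm' ⟨c, by simp [_root_.dotSwap, swapVal, hc, hn]⟩
  obtain ⟨⟨j, c'⟩, hq | hq, hqd⟩ := hn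
  · have := hV.inc _ _ hq _ _ hc hqd
    simp [dotRank_inl] at this
  · rcases covBy_cases hq with h | h <;> simp only [Prod.mk.injEq] at h
    · obtain ⟨rfl, rfl⟩ := h
      exact absurd hqd (hleft _ rfl)
    · obtain ⟨rfl, rfl⟩ := h
      refine ⟨j, rfl, ⟨c, hqd, hc⟩, ?_⟩
      rintro ⟨c0, h0⟩
      obtain rfl := hV.eq_succ_of_rank h0 hqd (by simp [dotRank_inl])
      exact hleft c0 rfl (hV.eq_of_rank (covBy_below j c0) (covBy_right (j + 1) c0) h0 hc
        (by simp [dotRank_inl]) (by simp [dotRank_inl]))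

end DotTableau


section RowProd

variable {M : Type*} [Monoid M] {s : ℤ → M}

/-- The factor `s x` of an entry `x` satisfying `P`, and `1` for all other entries. -/
def entryFactor (s : ℤ → M) (P : ℤ → Prop) : Option ZDot → M
  | some (Sum.inl x) => if P x then s x else 1
  | _ => 1

/-- The product, from left to right, of the factors of the entries of row `i` satisfying `P`. -/
def rowProd (s : ℤ → M) (n : ℕ) (P : ℤ → Prop) (V : ℕ × ℕ → Option ZDot) (i : ℕ) : M :=
  ((List.range n).map fun c => entryFactor s P (V (i, c))).prod

/-- The factor `s x` if row `i` contains `x`. -/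
def hasFactor (s : ℤ → M) (x : ℤ) (V : ℕ × ℕ → Option ZDot) (i : ℕ) : M :=
  if RowHas V (Sum.inl x) i then s x else 1

/-- The factor `s k` if row `i` contains a dot above `k`. -/
def dotFactor (s : ℤ → M) (k : ℤ) (V : ℕ × ℕ → Option ZDot) (i : ℕ) : M :=
  if DotOver k V i then s k else 1

variable {n : ℕ} {P Q : ℤ → Prop} {V W : ℕ × ℕ → Option ZDot} {i : ℕ} {k : ℤ}

lemma entryFactor_eq_one_or (P : ℤ → Prop) (o : Option ZDot) :
    entryFactor s P o = 1 ∨ ∃ x, o = some (Sum.inl x) ∧ P x ∧ entryFactor s P o = s x := by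
  rcases o with _ | (x | u)
  · exact Or.inl rfl
  · by_cases h : P x
    · exact Or.inr ⟨x, rfl, h, if_pos h⟩
    · exact Or.inl (if_neg h)
  · exact Or.inl rfl

lemma rowProd_succ : rowProd s (n + 1) P V i = rowProd s n P V i * entryFactor s P (V (i, n)) := by
  simp [rowProd, List.range_succ]

lemma rowProd_congr (h : ∀ c x, (V (i, c) = some (Sum.inl x) ∧ P x) ↔
    (W (i, c) = some (Sum.inl x) ∧ Q x)) : rowProd s n P V i = rowProd s n Q W i := by
  unfold rowProd
  congr 1
  refine List.map_congr_left fun c _ => ?_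
  rcases entryFactor_eq_one_or (s := s) P (V (i, c)) with h1 | ⟨x, h1, h2, h3⟩
  · rcases entryFactor_eq_one_or (s := s) Q (W (i, c)) with h4 | ⟨y, h4, h5, -⟩
    · rw [h1, h4]
    · obtain ⟨h6, h7⟩ := (h c y).mpr ⟨h4, h5⟩
      simp only [h6, h4, entryFactor, if_pos h7, if_pos h5]
  · obtain ⟨h6, h7⟩ := (h c x).mp ⟨h1, h2⟩
    simp only [h1, h6, entryFactor, if_pos h2, if_pos h7]

lemma commute_rowProd {m : M} (h : ∀ c x, V (i, c) = some (Sum.inl x) → P x → Commute m (s x)) :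
    Commute m (rowProd s n P V i) := by
  refine Commute.list_prod_right _ _ fun y hy => ?_
  obtain ⟨c, -, rfl⟩ := List.mem_map.mp hy
  rcases entryFactor_eq_one_or (s := s) P (V (i, c)) with h1 | ⟨x, h1, h2, h3⟩
  · rw [h1]
    exact Commute.one_right m
  · rw [h3]
    exact h c x h1 h2

lemma rowProd_eq_one (h : ∀ c x, V (i, c) = some (Sum.inl x) → ¬ P x) :
    rowProd s n P V i = 1 := by
  refine List.prod_eq_one fun y hy => ?_
  obtain ⟨c, -, rfl⟩ := List.mem_map.mp hy
  rcases entryFactor_eq_one_or (s := s) P (V (i, c)) with h1 | ⟨x, h1, h2, -⟩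
  · exact h1
  · exact absurd h2 (h c x h1)

lemma DotTableau.val_lt (hV : DotTableau k V) {c c' : ℕ} {x y : ℤ}
    (hx : V (i, c) = some (Sum.inl x)) (hy : V (i, c') = some (Sum.inl y)) (h : c < c') :
    x < y := by
  have := hV.rank_lt_of_lt hx hy h
  simp only [dotRank_inl] at this
  split_ifs at this <;> omega

lemma DotTableau.rowProd_or (hV : DotTableau k V) (h : ∀ x y, P x → Q y → x < y) :
    rowProd s n (fun x => P x ∨ Q x) V i = rowProd s n P V i * rowProd s n Q V i := by
  induction n with
  | zero => simp [rowProd]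
  | succ n ih =>
    rw [rowProd_succ, rowProd_succ, rowProd_succ, ih]
    rcases hV' : V (i, n) with _ | (x | u)
    · simp [entryFactor]
    · by_cases hP : P x
      · have hQ : ¬ Q x := fun hQ => lt_irrefl _ (h x x hP hQ)
        have h1 : rowProd s n Q V i = 1 := by
          refine List.prod_eq_one fun y hy => ?_
          obtain ⟨c, hc, rfl⟩ := List.mem_map.mp hy
          rcases entryFactor_eq_one_or (s := s) Q (V (i, c)) with h1 | ⟨y, h1, h2, -⟩
          · exact h1
          · have := hV.val_lt h1 hV' (List.mem_range.mp hc)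
            have := h x y hP h2
            omega
        simp [entryFactor, hP, hQ, h1]
      · by_cases hQ : Q x <;> simp [entryFactor, hP, hQ, mul_assoc]
    · simp [entryFactor]

lemma rowProd_eq_hasFactor (hs : HeckeRel s) (hn : ∀ c, V (i, c) ≠ none → c < n) (k : ℤ) :
    rowProd s n (fun x => x = k) V i = hasFactor s k V i := by
  have key : ∀ n, rowProd s n (fun x => x = k) V i =
      if ∃ c < n, V (i, c) = some (Sum.inl k) then s k else 1 := by
    intro n
    induction n with
    | zero => simp [rowProd]
    | succ n ih =>
      rw [rowProd_succ, ih]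
      by_cases h : V (i, n) = some (Sum.inl k)
      · rw [if_pos (⟨n, n.lt_succ_self, h⟩ : ∃ c < n + 1, V (i, c) = some (Sum.inl k)), h]
        split_ifs <;> simp [entryFactor, hs.idem]
      · have h1 : entryFactor s (fun x => x = k) (V (i, n)) = 1 := by
          rcases entryFactor_eq_one_or (s := s) (fun x => x = k) (V (i, n)) with
            h1 | ⟨x, h1, rfl, -⟩
          · exact h1
          · exact absurd h1 h
        rw [h1, mul_one]
        congr 1
        refine propext (exists_congr fun c => ?_)
        constructor
        · exact fun hc => ⟨by omega, hc.2⟩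
        · rintro ⟨hc, hc'⟩
          refine ⟨?_, hc'⟩
          have : c ≠ n := by
            rintro rfl
            exact h hc'
          omega
  rw [key, hasFactor]
  congr 1
  refine propext (exists_congr fun c => ⟨And.right, fun h => ⟨hn c ?_, h⟩⟩)
  simp [h]

/-- The product for rows `0, …, i` of a dotted tableau during a slide, without the entries
`≤ k` of row `i`. The entries smaller than `k` of a row, followed by an additional `k` if the
row contains a dot above `k`, are read before the entries greater than `k` of the next row. -/
def stateProd (s : ℤ → M) (n : ℕ) (k : ℤ) (V : ℕ × ℕ → Option ZDot) : ℕ → M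
  | 0 => rowProd s n (fun x => k < x) V 0
  | i + 1 => rowProd s n (fun x => x < k) V i * dotFactor s k V i *
      rowProd s n (fun x => k < x) V (i + 1) * hasFactor s k V i * stateProd s n k V i

lemma DotTableau.rowProd_lt_succ (hs : HeckeRel s) (hV : DotTableau k V)
    (hn : ∀ i c, V (i, c) ≠ none → c < n) (i : ℕ) :
    rowProd s n (fun x => x < k + 1) (_root_.dotSwap k V) i =
      rowProd s n (fun x => x < k) V i * hasFactor s k (_root_.dotSwap k V) i := by
  have h1 : rowProd s n (fun x => x < k) V i =
      rowProd s n (fun x => x < k) (_root_.dotSwap k V) i := by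
    refine rowProd_congr fun c x => and_congr_left fun hx => ?_
    exact (dotSwap_eq_val hx.ne).symm
  rw [h1, ← rowProd_eq_hasFactor hs (fun c hc => hn i c (mt dotSwap_eq_none.mpr hc)),
    ← hV.dotSwap.rowProd_or (fun x y hx hy => by omega)]
  refine rowProd_congr fun c x => and_congr_right fun _ => ?_
  omega

lemma DotTableau.rowProd_gt (hs : HeckeRel s) (hV : DotTableau k V)
    (hn : ∀ i c, V (i, c) ≠ none → c < n) (i : ℕ) :
    rowProd s n (fun x => k < x) V i =
      hasFactor s (k + 1) V i * rowProd s n (fun x => k + 1 < x) V i := by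
  rw [← rowProd_eq_hasFactor hs (hn i), ← hV.rowProd_or (fun x y hx hy => by omega)]
  refine rowProd_congr fun c x => and_congr_right fun _ => ?_
  omega

lemma rowProd_gt_dotSwap (i : ℕ) :
    rowProd s n (fun x => k + 1 < x) (dotSwap k V) i = rowProd s n (fun x => k + 1 < x) V i := by
  refine rowProd_congr fun c x => and_congr_left fun hx => ?_
  exact dotSwap_eq_val (by omega)

lemma hasFactor_succ_dotSwap (i : ℕ) :
    hasFactor s (k + 1) (dotSwap k V) i = hasFactor s (k + 1) V i := by
  simp only [hasFactor, rowHas_dotSwap (show k + 1 ≠ k by omega)]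

/-- The local identity behind a swap between two consecutive rows. -/
lemma DotTableau.swap_identity (hs : HeckeRel s) (hV : DotTableau k V) (i : ℕ) :
    dotFactor s k V i * hasFactor s (k + 1) V (i + 1) * hasFactor s k V i =
      hasFactor s (k + 1) V (i + 1) * hasFactor s k (_root_.dotSwap k V) i *
        dotFactor s (k + 1) (_root_.dotSwap k V) i * hasFactor s k V i := by
  have h0 : DotOver (k + 1) (_root_.dotSwap k V) i → RowHas V (Sum.inl (k + 1)) (i + 1) :=
    fun h => (rowHas_dotSwap (by omega)).mp h.rowHas
  have hk := hs.idem k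
  have ht := hs.idem (k + 1)
  by_cases hd : DotOver k V i
  · have hm' := rowHas_dotSwap_of_dotOver hd
    by_cases hm : RowHas V (Sum.inl k) i
    · by_cases he : RowHas V (Sum.inl (k + 1)) (i + 1)
      · have hd' := hV.dotOver_dotSwap_of_rowHas hd hm he
        simp only [dotFactor, hasFactor, if_pos hd, if_pos hm, if_pos hm', if_pos he, if_pos hd']
        rw [← hs.braid, mul_assoc _ (s k) (s k), hk]
      · simp [dotFactor, hasFactor, hd, hm, hm', he, mt h0 he]
    · have he := hV.not_rowHas_below hd hm
      simp [dotFactor, hasFactor, hd, hm, hm', he, mt h0 he]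
  · by_cases hm' : RowHas (_root_.dotSwap k V) (Sum.inl k) i
    · have hm := rowHas_of_rowHas_dotSwap hd hV hm'
      simp [dotFactor, hasFactor, hd, hm, hm', not_dotOver_dotSwap hd hV hm', mul_assoc, hk]
    · by_cases hd' : DotOver (k + 1) (_root_.dotSwap k V) i
      · simp [dotFactor, hasFactor, hd, hm', hd', h0 hd', ht]
      · simp [dotFactor, hasFactor, hd, hm', hd']

lemma DotTableau.mul_stateProd_dotSwap (hs : HeckeRel s) (hV : DotTableau k V)
    (hn : ∀ i c, V (i, c) ≠ none → c < n) (i : ℕ) (Z : M)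
    (hZ : RowHas (_root_.dotSwap k V) (Sum.inl k) i → Z * s k = Z) :
    Z * hasFactor s k V i * stateProd s n k V i =
      Z * hasFactor s (k + 1) (_root_.dotSwap k V) i *
        stateProd s n (k + 1) (_root_.dotSwap k V) i := by
  induction i generalizing Z with
  | zero =>
    have h : Z * hasFactor s k V 0 = Z := by
      by_cases hm : RowHas V (Sum.inl k) 0
      · rw [hasFactor, if_pos hm]
        refine hZ (by_contra fun hm' => ?_)
        obtain ⟨j, hj, -⟩ := hV.vacated hm hm'
        omega
      · simp [hasFactor, hm]
    rw [h, stateProd, stateProd, hV.rowProd_gt hs hn, rowProd_gt_dotSwap,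
      hasFactor_succ_dotSwap, mul_assoc]
  | succ i ih =>
    set lo := rowProd s n (fun x => x < k) V i with hlo
    set S := rowProd s n (fun x => k + 1 < x) V (i + 1) with hS
    set m := hasFactor s k V i with hm
    set m' := hasFactor s k (_root_.dotSwap k V) i with hm'
    set e := hasFactor s (k + 1) V (i + 1) with he
    set δ := dotFactor s k V i with hδ
    set δ' := dotFactor s (k + 1) (_root_.dotSwap k V) i with hδ'
    have absorb : Z * hasFactor s k V (i + 1) * lo * δ = Z * lo * δ := by
      by_cases h : RowHas V (Sum.inl k) (i + 1)
      · by_cases h' : RowHas (_root_.dotSwap k V) (Sum.inl k) (i + 1)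
        · rw [hasFactor, if_pos h, hZ h']
        · obtain ⟨j, hj, hd, hr⟩ := hV.vacated h h'
          obtain rfl : j = i := by omega
          have hc : Commute (s k) lo := by
            refine commute_rowProd fun c x hx hxk => ?_
            have : x ≠ k - 1 := by
              rintro rfl
              exact hr ⟨c, hx⟩
            exact (hs.comm x k (by omega)).symm
          rw [hasFactor, if_pos h, hδ, dotFactor, if_pos hd, mul_assoc Z, hc.eq, mul_assoc,
            mul_assoc, hs.idem, mul_assoc]
      · simp [hasFactor, h]
    have hSk : Commute S (s k) :=
      (commute_rowProd fun c x _ hx => hs.comm k x (by omega)).symm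
    have hSm : Commute S m := by
      rw [hm, hasFactor]
      split_ifs
      · exact hSk
      · exact Commute.one_right S
    have hloe : Commute lo e := by
      rw [he, hasFactor]
      split_ifs
      · exact (commute_rowProd fun c x _ hx => (hs.comm x (k + 1) (by omega)).symm).symm
      · exact Commute.one_right lo
    have hswap : δ * e * m = e * m' * δ' * m := hV.swap_identity hs i
    have hZ' : RowHas (_root_.dotSwap k V) (Sum.inl k) i →
        Z * lo * e * m' * δ' * S * s k = Z * lo * e * m' * δ' * S := by
      intro h
      have h1 : e * m' * δ' * s k = e * m' * δ' := by
        rw [hm', hasFactor, if_pos h, hδ', dotFactor]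
        split_ifs with h2
        · have h3 : e = s (k + 1) := if_pos ((rowHas_dotSwap (by omega)).mp h2.rowHas)
          rw [h3, ← hs.braid, mul_assoc _ (s k) (s k), hs.idem]
        · rw [mul_one, mul_assoc, hs.idem]
      calc Z * lo * e * m' * δ' * S * s k
          = Z * lo * (e * m' * δ' * s k) * S := by
            rw [mul_assoc _ S, hSk.eq]
            simp only [mul_assoc]
        _ = Z * lo * e * m' * δ' * S := by
            rw [h1]
            simp only [mul_assoc]
    calc Z * hasFactor s k V (i + 1) * stateProd s n k V (i + 1)
        = (Z * hasFactor s k V (i + 1) * lo * δ) * (e * S * m * stateProd s n k V i) := by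
          rw [stateProd, hV.rowProd_gt hs hn]
          simp only [mul_assoc]
          rfl
      _ = Z * lo * (δ * e * m) * S * stateProd s n k V i := by
          rw [absorb, mul_assoc e, hSm.eq]
          simp only [mul_assoc]
      _ = Z * lo * e * m' * δ' * S * m * stateProd s n k V i := by
          rw [hswap, mul_assoc _ S m, hSm.eq]
          simp only [mul_assoc]
      _ = Z * lo * e * m' * δ' * S * hasFactor s (k + 1) (_root_.dotSwap k V) i *
            stateProd s n (k + 1) (_root_.dotSwap k V) i := ih _ hZ'
      _ = _ := by
          rw [mul_assoc Z, hloe.eq, stateProd, hV.rowProd_lt_succ hs hn, rowProd_gt_dotSwap,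
            hasFactor_succ_dotSwap (i + 1)]
          simp only [mul_assoc]
          rfl

lemma DotTableau.stateProd_dotSwap (hs : HeckeRel s) (hV : DotTableau k V)
    (hn : ∀ i c, V (i, c) ≠ none → c < n) {N : ℕ} (hN : ∀ c, V (N, c) = none) :
    stateProd s n k V N = stateProd s n (k + 1) (_root_.dotSwap k V) N := by
  have h1 : ∀ x, ¬ RowHas V x N := by
    rintro x ⟨c, hc⟩
    simp [hN] at hc
  have h2 : ∀ x, ¬ RowHas (_root_.dotSwap k V) x N := by
    rintro x ⟨c, hc⟩
    simp [dotSwap_eq_none.mpr (hN c)] at hc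
  simpa [hasFactor, h1, h2] using
    hV.mul_stateProd_dotSwap hs hn N 1 fun h => absurd h (h2 _)

/-- The product over the entries of rows `0, …, N - 1`, the row with the largest index first. -/
def wordProd (s : ℤ → M) (n : ℕ) (V : ℕ × ℕ → Option ZDot) : ℕ → M
  | 0 => 1
  | i + 1 => rowProd s n (fun _ => True) V i * wordProd s n V i

lemma stateProd_of_lt (h : ∀ p x, V p = some (Sum.inl x) → x < k) (N : ℕ) :
    stateProd s n k V N = wordProd s n V N := by
  have h1 : ∀ i, rowProd s n (fun x => k < x) V i = 1 :=
    fun i => rowProd_eq_one fun c x hx => (h _ x hx).not_gt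
  have h2 : ∀ i, ¬ RowHas V (Sum.inl k) i := by
    rintro i ⟨c, hc⟩
    exact lt_irrefl _ (h _ _ hc)
  have h3 : ∀ i, ¬ DotOver k V i := fun i hd => h2 _ hd.rowHas
  induction N with
  | zero => exact h1 0
  | succ i ih =>
    rw [stateProd, wordProd, ih, h1, dotFactor, if_neg (h3 i), hasFactor, if_neg (h2 i)]
    simp only [mul_one]
    congr 1
    exact rowProd_congr fun c x => and_congr_right fun hx => by simp [h _ x hx]

lemma DotTableau.stateProd_of_ge (hs : HeckeRel s) (hV : DotTableau k V)
    (hn : ∀ i c, V (i, c) ≠ none → c < n) (h : ∀ p x, V p = some (Sum.inl x) → k ≤ x) {N : ℕ}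
    (hN : ∀ c, V (N, c) = none) : stateProd s n k V N = wordProd s n V N := by
  have hrow : ∀ i, rowProd s n (fun _ => True) V i =
      hasFactor s k V i * rowProd s n (fun x => k < x) V i := by
    intro i
    rw [← rowProd_eq_hasFactor hs (hn i), ← hV.rowProd_or (fun x y hx hy => by omega)]
    refine rowProd_congr fun c x => and_congr_right fun hx => ?_
    have := h _ x hx
    simp only [true_iff]
    omega
  have key : ∀ i, hasFactor s k V i * stateProd s n k V i =
      rowProd s n (fun _ => True) V i * wordProd s n V i := by
    intro i
    induction i with
    | zero => rw [stateProd, wordProd, hrow, mul_one]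
    | succ i ih =>
      have hlo : rowProd s n (fun x => x < k) V i = 1 :=
        rowProd_eq_one fun c x hx => not_lt.mpr (h _ x hx)
      have habs : hasFactor s k V (i + 1) * dotFactor s k V i = hasFactor s k V (i + 1) := by
        rw [dotFactor]
        split_ifs with hd
        · rw [hasFactor, if_pos hd.rowHas, hs.idem]
        · rw [mul_one]
      rw [stateProd, hlo, one_mul, mul_assoc _ (hasFactor s k V i), ih, ← mul_assoc, ← mul_assoc,
        ← mul_assoc, habs, ← hrow, wordProd, mul_assoc]
  have h1 : ¬ RowHas V (Sum.inl k) N := by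
    rintro ⟨c, hc⟩
    simp [hN] at hc
  have h2 : rowProd s n (fun _ => True) V N = 1 := by
    refine rowProd_eq_one fun c x hx => ?_
    simp [hN] at hx
  have := key N
  rwa [hasFactor, if_neg h1, h2, one_mul, one_mul] at this

end RowProd

section Slides

variable {M : Type*} [Monoid M] {s : ℤ → M}

/-- The support of `V` lies in the first `m` rows and the first `n` columns. -/
def InBox {A : Type} (m n : ℕ) (V : ℕ × ℕ → Option A) : Prop :=
  ∀ i c, V (i, c) ≠ none → i < m ∧ c < n

/-- An increasing filling, tested along covers only. -/
def CoverIncreasing (T : ℕ × ℕ → Option ℤ) : Prop :=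
  ∀ p q, p ⋖ q → ∀ x y, T p = some x → T q = some y → x < y

lemma toDotted_eq_inl {L : Type} {T : L → Option ℤ} {p : L} {x : ℤ} :
    toDotted T p = some (Sum.inl x) ↔ T p = some x := by
  simp [toDotted]

lemma restrictInt_eq_some {L : Type} {V : L → Option ZDot} {p : L} {x : ℤ} :
    restrictInt V p = some x ↔ V p = some (Sum.inl x) := by
  rcases h : V p with _ | (y | u) <;> simp [restrictInt, h]

lemma wordProd_congr {n : ℕ} {V W : ℕ × ℕ → Option ZDot}
    (h : ∀ p x, V p = some (Sum.inl x) ↔ W p = some (Sum.inl x)) (m : ℕ) :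
    wordProd s n V m = wordProd s n W m := by
  induction m with
  | zero => rfl
  | succ i ih =>
    rw [wordProd, wordProd, ih]
    congr 1
    exact rowProd_congr fun c x => by rw [h]

lemma wordProd_eq_of_inBox {m n m' n' : ℕ} {V : ℕ × ℕ → Option ZDot} (hV : InBox m n V)
    (hm : m ≤ m') (hn : n ≤ n') : wordProd s n' V m' = wordProd s n V m := by
  have hrow : ∀ i, rowProd s n' (fun _ => True) V i = rowProd s n (fun _ => True) V i := by
    intro i
    induction n', hn using Nat.le_induction with
    | base => rfl
    | succ l hl ih =>
      have h : V (i, l) = none := by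
        by_contra h
        exact absurd (hV i l h).2 (not_lt.mpr hl)
      rw [rowProd_succ, ih, h, entryFactor, mul_one]
      simp
  have h1 : ∀ j, wordProd s n' V j = wordProd s n V j := by
    intro j
    induction j with
    | zero => rfl
    | succ j ih => rw [wordProd, wordProd, ih, hrow]
  induction m', hm using Nat.le_induction with
  | base => exact h1 m
  | succ l hl ih =>
    rw [wordProd, ih, rowProd_eq_one, one_mul]
    intro c x hx
    exact absurd (hV l c (by simp [hx])).1 (not_lt.mpr hl)

lemma wordProd_eq_wordProd_of_inBox {m n m' n' : ℕ} {V : ℕ × ℕ → Option ZDot}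
    (hV : InBox m n V) (hV' : InBox m' n' V) : wordProd s n V m = wordProd s n' V m' := by
  rw [← wordProd_eq_of_inBox hV (le_max_left m m') (le_max_left n n'),
    wordProd_eq_of_inBox hV' (le_max_right m m') (le_max_right n n')]

lemma prod_map_rowWord (T : ℕ × ℕ → Option ℤ) (rm cm : ℕ) :
    ((rowWord T rm cm).map s).prod = wordProd s (cm + 1) (toDotted T) (rm + 1) := by
  have hrow : ∀ i n, (((List.range n).filterMap fun c => T (i, c)).map s).prod =
      rowProd s n (fun _ => True) (toDotted T) i := by
    intro i n
    induction n with
    | zero => rfl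
    | succ n ih =>
      rw [rowProd_succ, ← ih, List.range_succ, List.filterMap_append, List.map_append,
        List.prod_append]
      congr 1
      rcases h : T (i, n) with _ | x <;> simp [h, toDotted, entryFactor]
  unfold rowWord
  generalize rm + 1 = m
  induction m with
  | zero => rfl
  | succ m ih =>
    rw [List.range_succ (n := m), List.reverse_append, List.reverse_singleton, List.singleton_append,
      List.flatMap_cons, List.map_append, List.prod_append, ih, hrow, wordProd]

lemma DotIncreasing.coverIncreasing {k : ℤ} {V : ℕ × ℕ → Option ZDot} (hV : DotIncreasing k V) :
    CoverIncreasing (restrictInt V) := by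
  intro p q hpq x y hx hy
  have := hV p q hpq _ _ (restrictInt_eq_some.mp hx) (restrictInt_eq_some.mp hy)
  simp only [dotRank_inl] at this
  split_ifs at this <;> omega

lemma swapUp_invariant (hs : HeckeRel s) {a : ℤ} {V : ℕ × ℕ → Option ZDot} (hV : DotTableau a V)
    {N : ℕ} (hN : InBox N N V) (j : ℕ) :
    DotTableau (a + j) (swapUp a j V) ∧ InBox N N (swapUp a j V) ∧
      (∀ p x, swapUp a j V p = some (Sum.inl x) → ∃ q, V q = some (Sum.inl x)) ∧
      stateProd s N a V N = stateProd s N (a + j) (swapUp a j V) N := by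
  induction j with
  | zero => simpa [swapUp] using ⟨hV, hN, fun p q x h => ⟨p, q, h⟩⟩
  | succ j ih =>
    obtain ⟨h1, h2, h3, h4⟩ := ih
    have e : a + ((j + 1 : ℕ) : ℤ) = a + j + 1 := by
      push_cast
      ring
    rw [e]
    refine ⟨h1.dotSwap, fun i c h => h2 i c (mt dotSwap_eq_none.mpr h), fun p x h => ?_, ?_⟩
    · obtain ⟨q, hq⟩ := exists_of_dotSwap_eq_val h
      exact h3 q x hq
    · rw [h4]
      exact h1.stateProd_dotSwap hs (fun i c h => (h2 i c h).2)
        fun c => by_contra fun h => lt_irrefl _ (h2 N c h).1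

lemma swapDown_invariant (hs : HeckeRel s) {b : ℤ} {V : ℕ × ℕ → Option ZDot}
    (hV : DotTableau (b + 1) V) {N : ℕ} (hN : InBox N N V) (j : ℕ) :
    DotTableau (b + 1 - j) (swapDown b j V) ∧ InBox N N (swapDown b j V) ∧
      (∀ p x, swapDown b j V p = some (Sum.inl x) → ∃ q, V q = some (Sum.inl x)) ∧
      stateProd s N (b + 1) V N = stateProd s N (b + 1 - j) (swapDown b j V) N := by
  induction j with
  | zero => simpa [swapDown] using ⟨hV, hN, fun p q x h => ⟨p, q, h⟩⟩
  | succ j ih =>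
    obtain ⟨h1, h2, h3, h4⟩ := ih
    have e : b + 1 - ((j + 1 : ℕ) : ℤ) = b - j := by
      push_cast
      ring
    have e' : b + 1 - (j : ℤ) = b - j + 1 := by ring
    rw [e]
    rw [e'] at h1 h4
    have h2' : InBox N N (dotSwap (b - j) (swapDown b j V)) :=
      fun i c h => h2 i c (mt dotSwap_eq_none.mpr h)
    refine ⟨h1.dotSwap_down, h2', fun p x h => ?_, ?_⟩
    · obtain ⟨q, hq⟩ := exists_of_dotSwap_eq_val h
      exact h3 q x hq
    · have := h1.dotSwap_down.stateProd_dotSwap hs (fun i c h => (h2' i c h).2)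
        fun c => by_contra fun h => lt_irrefl _ (h2' N c h).1
      rw [dotSwap_dotSwap h1.inc] at this
      rw [h4]
      exact this.symm

/-- `T` and `T'` have finite support and the same product over their row words. -/
def SameWordProd (s : ℤ → M) (T T' : ℕ × ℕ → Option ℤ) : Prop :=
  ∃ N, InBox N N (toDotted T) ∧ InBox N N (toDotted T') ∧
    wordProd s N (toDotted T) N = wordProd s N (toDotted T') N

lemma SameWordProd.trans {T₁ T₂ T₃ : ℕ × ℕ → Option ℤ} (h : SameWordProd s T₁ T₂)
    (h' : SameWordProd s T₂ T₃) : SameWordProd s T₁ T₃ := by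
  obtain ⟨N, h1, h2, h3⟩ := h
  obtain ⟨N', h1', h2', h3'⟩ := h'
  have mono : ∀ {K : ℕ} {V : ℕ × ℕ → Option ZDot}, K ≤ max N N' → InBox K K V →
      InBox (max N N') (max N N') V :=
    fun hK hV i c h => ⟨(hV i c h).1.trans_le hK, (hV i c h).2.trans_le hK⟩
  have hl := le_max_left N N'
  have hr := le_max_right N N'
  refine ⟨max N N', mono hl h1, mono hr h2', ?_⟩
  rw [wordProd_eq_of_inBox h1 hl hl, h3, wordProd_eq_of_inBox h2' hr hr, ← h3']
  exact wordProd_eq_wordProd_of_inBox h2 h1'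

variable {T : ℕ × ℕ → Option ℤ} {C : Finset (ℕ × ℕ)}

lemma addDots_eq_inl (hC : ∀ p ∈ C, T p = none) {p : ℕ × ℕ} {x : ℤ} :
    addDots C (toDotted T) p = some (Sum.inl x) ↔ T p = some x := by
  unfold addDots
  split_ifs with h
  · simp [hC p h]
  · exact toDotted_eq_inl

lemma addDots_cases {p : ℕ × ℕ} {x : ZDot} (h : addDots C (toDotted T) p = some x) :
    (p ∈ C ∧ x = Sum.inr ()) ∨ (p ∉ C ∧ ∃ y, T p = some y ∧ x = Sum.inl y) := by
  unfold addDots at h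
  split_ifs at h with hp
  · exact Or.inl ⟨hp, (Option.some.inj h).symm⟩
  · obtain ⟨y, h1, h2⟩ := Option.map_eq_some_iff.mp h
    exact Or.inr ⟨hp, y, h1, h2.symm⟩

lemma shapeOf_addDots : shapeOf (addDots C (toDotted T)) = (C : Set (ℕ × ℕ)) ∪ shapeOf T := by
  ext p
  by_cases h : p ∈ C <;> simp [shapeOf, addDots, toDotted, h]

/-- A slide preserves the product over the row word, provided that its dotted tableaux before
and after the swaps have the same product. -/
lemma sameWordProd_restrictInt (hC : ∀ p ∈ C, T p = none) {W : ℕ × ℕ → Option ZDot} {N : ℕ}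
    (hV : InBox N N (addDots C (toDotted T))) (hW : InBox N N W)
    (h : wordProd s N (addDots C (toDotted T)) N = wordProd s N W N) :
    SameWordProd s T (restrictInt W) := by
  have e1 : ∀ p x, toDotted T p = some (Sum.inl x) ↔
      addDots C (toDotted T) p = some (Sum.inl x) :=
    fun p x => by rw [addDots_eq_inl hC, toDotted_eq_inl]
  have e2 : ∀ p x, toDotted (restrictInt W) p = some (Sum.inl x) ↔ W p = some (Sum.inl x) :=
    fun p x => by rw [toDotted_eq_inl, restrictInt_eq_some]
  refine ⟨N, fun i c hc => ?_, fun i c hc => ?_, ?_⟩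
  · refine hV i c ?_
    unfold addDots
    split_ifs
    · simp
    · exact hc
  · refine hW i c fun hn => hc ?_
    simp [toDotted, restrictInt, hn]
  · rw [wordProd_congr e1, wordProd_congr e2, h]

lemma exists_inBox_addDots {lam nu : Finset (ℕ × ℕ)}
    (hT : shapeOf T = (nu : Set (ℕ × ℕ)) \ (lam : Set (ℕ × ℕ))) (C : Finset (ℕ × ℕ)) :
    ∃ N, InBox N N (addDots C (toDotted T)) := by
  obtain ⟨⟨m, n⟩, h⟩ := (C ∪ nu).exists_le
  refine ⟨max m n + 1, fun i c hic => ?_⟩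
  have hmem : (i, c) ∈ (C : Set (ℕ × ℕ)) ∪ shapeOf T := shapeOf_addDots ▸ hic
  have hle : (i, c) ≤ (m, n) := by
    refine h _ (Finset.mem_union.mpr (hmem.imp id fun h => ?_))
    rw [hT] at h
    exact h.1
  obtain ⟨h1, h2⟩ := Prod.mk_le_mk.mp hle
  omega

lemma sameWordProd_of_isForwardSlide (hs : HeckeRel s) {T' : ℕ × ℕ → Option ℤ}
    (hT : CoverIncreasing T) (h : IsForwardSlide T T') :
    CoverIncreasing T' ∧ SameWordProd s T T' := by
  obtain ⟨lam, nu, C, a, b, ⟨hlam, hnu, hsub⟩, hshape, hval, hC, rfl⟩ := h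
  have hmem : ∀ p x, T p = some x → p ∈ nu ∧ p ∉ lam := fun p x hx => by
    have : p ∈ shapeOf T := by simp [shapeOf, hx]
    rw [hshape] at this
    exact this
  have hnone : ∀ p ∈ C, T p = none := fun p hp => by
    by_contra hne
    obtain ⟨x, hx⟩ := Option.ne_none_iff_exists'.mp hne
    exact (hmem p x hx).2 (hC p hp).1
  have hV : DotTableau a (addDots C (toDotted T)) := by
    constructor
    · intro p q hpq x y hx hy
      rcases addDots_cases hx with ⟨hp, rfl⟩ | ⟨hp, x, hTp, rfl⟩ <;>
        rcases addDots_cases hy with ⟨hq, rfl⟩ | ⟨hq, y, hTq, rfl⟩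
      · exact absurd hpq.lt ((hC p hp).2 q (hC q hq).1)
      · have := (hval q y hTq).1
        rw [dotRank_inr, dotRank_inl, if_neg (not_lt.mpr this)]
        omega
      · exact absurd (hlam q (hC q hq).1 p hpq.le) (hmem p x hTp).2
      · have := hT p q hpq x y hTp hTq
        simp only [dotRank_inl]
        split_ifs <;> omega
    · rw [shapeOf_addDots, hshape]
      refine ⟨fun x hx y hy z ⟨hxz, hzy⟩ => ?_⟩
      have hz : z ∈ nu := by
        rcases hy with hy | hy
        · exact hnu y (hsub (hC y hy).1) z hzy
        · exact hnu y hy.1 z hzy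
      by_cases hzl : z ∈ lam
      · rcases hx with hx | hx
        · rcases hxz.eq_or_lt with rfl | hlt
          · exact Or.inl hx
          · exact absurd hlt ((hC x hx).2 z hzl)
        · exact absurd (hlam z hzl x hxz) hx.2
      · exact Or.inr ⟨hz, hzl⟩
  obtain ⟨N, hN⟩ := exists_inBox_addDots hshape C
  obtain ⟨h1, h2, h3, h4⟩ := swapUp_invariant hs hV hN (b - a + 1).toNat
  refine ⟨h1.inc.coverIncreasing, sameWordProd_restrictInt hnone hN h2 ?_⟩
  rw [← hV.stateProd_of_ge hs (fun i c h => (hN i c h).2)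
    (fun p x hx => (hval p x ((addDots_eq_inl hnone).mp hx)).1)
    (fun c => by_contra fun h => lt_irrefl _ (hN N c h).1), h4]
  refine stateProd_of_lt (fun p x hx => ?_) N
  obtain ⟨q, hq⟩ := h3 p x hx
  have := hval q x ((addDots_eq_inl hnone).mp hq)
  omega

lemma sameWordProd_of_isReverseSlide (hs : HeckeRel s) {T' : ℕ × ℕ → Option ℤ}
    (hT : CoverIncreasing T) (h : IsReverseSlide T T') :
    CoverIncreasing T' ∧ SameWordProd s T T' := by
  obtain ⟨lam, nu, C, a, b, ⟨hlam, hnu, hsub⟩, hshape, hval, hC, rfl⟩ := h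
  have hmem : ∀ p x, T p = some x → p ∈ nu ∧ p ∉ lam := fun p x hx => by
    have : p ∈ shapeOf T := by simp [shapeOf, hx]
    rw [hshape] at this
    exact this
  have hnone : ∀ p ∈ C, T p = none := fun p hp => by
    by_contra hne
    obtain ⟨x, hx⟩ := Option.ne_none_iff_exists'.mp hne
    exact (hC p hp).1 (hmem p x hx).1
  have hV : DotTableau (b + 1) (addDots C (toDotted T)) := by
    constructor
    · intro p q hpq x y hx hy
      rcases addDots_cases hx with ⟨hp, rfl⟩ | ⟨hp, x, hTp, rfl⟩ <;>
        rcases addDots_cases hy with ⟨hq, rfl⟩ | ⟨hq, y, hTq, rfl⟩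
      · exact absurd hpq.lt ((hC q hq).2 p (hC p hp).1)
      · exact absurd (hnu q (hmem q y hTq).1 p hpq.le) (hC p hp).1
      · have := (hval p x hTp).2
        rw [dotRank_inr, dotRank_inl, if_pos (by omega)]
        omega
      · have := hT p q hpq x y hTp hTq
        simp only [dotRank_inl]
        split_ifs <;> omega
    · rw [shapeOf_addDots, hshape]
      refine ⟨fun x hx y hy z ⟨hxz, hzy⟩ => ?_⟩
      have hz : z ∉ lam := fun hz => by
        have hxl := hlam z hz x hxz
        rcases hx with hx | hx
        · exact (hC x hx).1 (hsub hxl)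
        · exact hx.2 hxl
      by_cases hzn : z ∈ nu
      · exact Or.inr ⟨hzn, hz⟩
      · rcases hy with hy | hy
        · rcases hzy.eq_or_lt with rfl | hlt
          · exact Or.inl hy
          · exact absurd hlt ((hC y hy).2 z hzn)
        · exact absurd (hnu y hy.1 z hzy) hzn
  obtain ⟨N, hN⟩ := exists_inBox_addDots hshape C
  obtain ⟨h1, h2, h3, h4⟩ := swapDown_invariant hs hV hN (b - a + 1).toNat
  refine ⟨h1.inc.coverIncreasing, sameWordProd_restrictInt hnone hN h2 ?_⟩
  rw [← stateProd_of_lt (k := b + 1) (fun p x hx => ?_) N, h4]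
  · refine h1.stateProd_of_ge hs (fun i c h => (h2 i c h).2) (fun p x hx => ?_)
      fun c => by_contra fun h => lt_irrefl _ (h2 N c h).1
    obtain ⟨q, hq⟩ := h3 p x hx
    have := hval q x ((addDots_eq_inl hnone).mp hq)
    omega
  · have := (hval p x ((addDots_eq_inl hnone).mp hx)).2
    omega

lemma BoundedBy.inBox {rm cm : ℕ} (h : BoundedBy T rm cm) :
    InBox (rm + 1) (cm + 1) (toDotted T) := by
  intro i c hic
  have := h (i, c) fun hn => hic (by simp [toDotted, hn])
  omega

lemma JdtEquiv.sameWordProd (hs : HeckeRel s) {T' : ℕ × ℕ → Option ℤ} (h : JdtEquiv T T')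
    (hT : CoverIncreasing T) {rm cm : ℕ} (hb : BoundedBy T rm cm) : SameWordProd s T T' := by
  refine And.right (a := CoverIncreasing T') ?_
  induction h with
  | refl =>
    refine ⟨hT, max rm cm + 1, fun i c h => ?_, fun i c h => ?_, rfl⟩ <;>
    · have := hb.inBox i c h
      omega
  | tail _ hstep ih =>
    obtain ⟨h1, h2⟩ := hstep.elim (sameWordProd_of_isForwardSlide hs ih.1)
      (sameWordProd_of_isReverseSlide hs ih.1)
    exact ⟨h1, ih.2.trans h2⟩

end Slides

theorem hecke_perm_jdt_invariant
    (T T' : ℕ × ℕ → Option ℤ)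
    (hT : IncreasingSkewTableau T) (hT' : IncreasingSkewTableau T')
    (h : JdtEquiv T T')
    (rm cm rm' cm' : ℕ) (hb : BoundedBy T rm cm) (hb' : BoundedBy T' rm' cm') :
    heckeWord (rowWord T rm cm) = heckeWord (rowWord T' rm' cm') := by
  obtain ⟨N, h1, h2, h3⟩ := h.sameWordProd heckeRel_bubbleOp
    (fun p q hpq => hT.2 p q hpq.lt) hb
  rw [heckeWord_eq, heckeWord_eq, prod_map_rowWord, prod_map_rowWord,
    wordProd_eq_wordProd_of_inBox hb.inBox h1, h3, wordProd_eq_wordProd_of_inBox h2 hb'.inBox]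
end
end
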